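/- The ℚ-linear span of W^a_ℤ(ℤ̄) inside ℂ^{ℕ≥1} equals the ℚ-linear span of the set {ζ^(γ) : γ ∈ ℚ}; it is a ℚ-subalgebra of ℂ^{ℕ≥1}, and the ℚ-algebra homomorphism from the group algebra ℚ[ℚ/ℤ] to ℂ^{ℕ≥1} determined by [γ] ↦ ζ^(γ) is injective with image equal to this span. In particular E_ℚ := ℚ ⊗ W^a_ℤ(ℤ̄) is isomorphic as a ℚ-algebra to ℚ[ℚ/ℤ], and the algebraic Witt vectors over ℚ are precisely the ℚ-linear combinations of the vectors ζ^(γ), γ ∈ ℚ. -/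

import Mathlib

open scoped Real

/-- The sets `U_k` in the inductive construction of `W_ℤ(ℤ̄) ⊆ ℂ^{ℕ≥1}`:
`U_0` consists of the vectors whose entries are integral over `ℤ` (i.e. lie in `ℤ̄`),
and `U_{k+1}` consists of those `ξ ∈ U_k` such that for every prime `p` the vector
`ψ_p ξ - ξ^p = (ξ_{pn} - ξ_n^p)_n` lies in the ℤ-submodule generated by `{p·η : η ∈ U_k}`. -/
def UQ : ℕ → Set (ℕ+ → ℂ)
  | 0 => {ξ | ∀ n, IsIntegral ℤ (ξ n)}
  | k + 1 =>
      {ξ | ξ ∈ UQ k ∧ ∀ (p : ℕ) (hp : p.Prime),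
        (fun n => ξ (⟨p, hp.pos⟩ * n)) - ξ ^ p ∈
          Submodule.span ℤ {x | ∃ η ∈ UQ k, x = (p : ℤ) • η}}

/-- The set `W^a_ℤ(ℤ̄)` of integral Witt vectors over `ℤ`: elements of
`W_ℤ(ℤ̄) = ⋂ k, U_k` that are integral over `ℤ` as elements of `ℂ^{ℕ≥1}`. -/
def WaQ : Set (ℕ+ → ℂ) := {ξ | (∀ k, ξ ∈ UQ k) ∧ IsIntegral ℤ ξ}

/-- The vector `ζ^(γ) = (e^{2πiγn})_{n ≥ 1}`. -/
noncomputable def zetaVec (γ : ℚ) : ℕ+ → ℂ :=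
  fun n => Complex.exp (2 * π * Complex.I * (γ : ℂ) * (n : ℂ))

def VQ (F : Type*) [Field F] : ℕ → Set (ℕ+ → F)
  | 0 => {ξ | ∀ n, IsIntegral ℤ (ξ n)}
  | k + 1 => {ξ | ξ ∈ VQ F k ∧ ∀ (p : ℕ) (hp : p.Prime), ∃ η ∈ VQ F k,
      ∀ n, ξ (⟨p, hp.pos⟩ * n) = ξ n ^ p + (p : F) * η n}

def IsW {F : Type*} [Field F] (ξ : ℕ+ → F) : Prop := ∀ k, ξ ∈ VQ F k

section part1
variable {F : Type*} [Field F]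

theorem VQ_subring (k : ℕ) : ∃ S : Subring (ℕ+ → F), (S : Set (ℕ+ → F)) = VQ F k := by
  induction k with
  | zero =>
    refine ⟨⟨⟨⟨⟨VQ F 0, ?_⟩, ?_⟩, ?_, ?_⟩, ?_⟩, rfl⟩
    · intro a b ha hb n; exact (ha n).mul (hb n)
    · intro n; exact isIntegral_one
    · intro a b ha hb n; exact (ha n).add (hb n)
    · intro n; exact isIntegral_zero
    · intro a ha n; exact (ha n).neg
  | succ k ih =>
    obtain ⟨S, hS⟩ := ih
    have key : ∀ ξ, ξ ∈ VQ F (k+1) ↔ (ξ ∈ S ∧ ∀ (p : ℕ) (hp : p.Prime), ∃ η ∈ S,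
      ∀ n, ξ (⟨p, hp.pos⟩ * n) = ξ n ^ p + (p : F) * η n) := by
      intro ξ
      rw [VQ, ← hS]
      rfl
    have hmul : ∀ {a b : ℕ+ → F}, a ∈ VQ F (k+1) → b ∈ VQ F (k+1) → a * b ∈ VQ F (k+1) := by
      intro a b ha hb
      rw [key] at *
      refine ⟨S.mul_mem ha.1 hb.1, fun p hp => ?_⟩
      obtain ⟨x, hx, hx'⟩ := ha.2 p hp
      obtain ⟨y, hy, hy'⟩ := hb.2 p hp
      refine ⟨a ^ p * y + b ^ p * x + (p : ℕ+ → F) * x * y, ?_, ?_⟩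
      · exact S.add_mem (S.add_mem (S.mul_mem (S.pow_mem ha.1 p) hy) (S.mul_mem (S.pow_mem hb.1 p) hx))
          (S.mul_mem (S.mul_mem (natCast_mem S p) hx) hy)
      · intro n
        simp only [Pi.mul_apply, hx' n, hy' n, Pi.add_apply, Pi.pow_apply, Pi.natCast_apply]
        ring
    have hadd : ∀ {a b : ℕ+ → F}, a ∈ VQ F (k+1) → b ∈ VQ F (k+1) → a + b ∈ VQ F (k+1) := by
      intro a b ha hb
      rw [key] at *
      refine ⟨S.add_mem ha.1 hb.1, fun p hp => ?_⟩
      obtain ⟨x, hx, hx'⟩ := ha.2 p hp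
      obtain ⟨y, hy, hy'⟩ := hb.2 p hp
      obtain ⟨r, hr⟩ := exists_add_pow_prime_eq hp (⟨a, ha.1⟩ : S) ⟨b, hb.1⟩
      refine ⟨x + y - a * b * r, ?_, ?_⟩
      · exact S.sub_mem (S.add_mem hx hy) (S.mul_mem (S.mul_mem ha.1 hb.1) r.2)
      · intro n
        have := congrFun (congrArg Subtype.val hr) n
        simp only [Subring.coe_pow, Subring.coe_add, Subring.coe_mul, Pi.mul_apply, Pi.add_apply, Pi.pow_apply, Subring.coe_natCast, Pi.natCast_apply] at this
        simp only [Pi.mul_apply, hx' n, hy' n, Pi.add_apply, Pi.sub_apply, this]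
        ring
    have hone : (1 : ℕ+ → F) ∈ VQ F (k+1) := by
      rw [key]
      refine ⟨S.one_mem, fun p hp => ⟨0, S.zero_mem, fun n => by simp⟩⟩
    have hneg : (-1 : ℕ+ → F) ∈ VQ F (k+1) := by
      rw [key]
      refine ⟨S.neg_mem S.one_mem, fun p hp => ?_⟩
      rcases hp.eq_two_or_odd' with rfl | h
      · exact ⟨-1, S.neg_mem S.one_mem, fun n => by simp; norm_num⟩
      · exact ⟨0, S.zero_mem, fun n => by simp [h.neg_one_pow]⟩
    refine ⟨⟨⟨⟨⟨VQ F (k+1), hmul⟩, hone⟩, hadd, ?_⟩, ?_⟩, rfl⟩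
    · change (0 : ℕ+ → F) ∈ VQ F (k+1)
      rw [key]
      exact ⟨S.zero_mem, fun p hp => ⟨0, S.zero_mem, fun n => by simp [hp.ne_zero]⟩⟩
    · intro a ha
      have := hmul hneg ha
      rw [neg_one_mul] at this
      exact this

theorem IsW.integral {ξ : ℕ+ → F} (h : IsW ξ) (n : ℕ+) : IsIntegral ℤ (ξ n) := h 0 n

theorem IsW.add {a b : ℕ+ → F} (ha : IsW a) (hb : IsW b) : IsW (a + b) := by
  intro k
  obtain ⟨S, hS⟩ := VQ_subring (F := F) k
  rw [← hS]
  exact S.add_mem (by rw [← SetLike.mem_coe, hS]; exact ha k) (by rw [← SetLike.mem_coe, hS]; exact hb k)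

theorem IsW.mul {a b : ℕ+ → F} (ha : IsW a) (hb : IsW b) : IsW (a * b) := by
  intro k
  obtain ⟨S, hS⟩ := VQ_subring (F := F) k
  rw [← hS]
  exact S.mul_mem (by rw [← SetLike.mem_coe, hS]; exact ha k) (by rw [← SetLike.mem_coe, hS]; exact hb k)

theorem IsW.neg {a : ℕ+ → F} (ha : IsW a) : IsW (-a) := by
  intro k
  obtain ⟨S, hS⟩ := VQ_subring (F := F) k
  rw [← hS]
  exact S.neg_mem (by rw [← SetLike.mem_coe, hS]; exact ha k)

theorem IsW.one : IsW (1 : ℕ+ → F) := by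
  intro k
  obtain ⟨S, hS⟩ := VQ_subring (F := F) k
  rw [← hS]
  exact S.one_mem

theorem IsW.zero : IsW (0 : ℕ+ → F) := by
  intro k
  obtain ⟨S, hS⟩ := VQ_subring (F := F) k
  rw [← hS]
  exact S.zero_mem

theorem IsW.sub {a b : ℕ+ → F} (ha : IsW a) (hb : IsW b) : IsW (a - b) := by
  rw [sub_eq_add_neg]; exact ha.add hb.neg

/-- The subring of Witt vectors. -/
def Wring (F : Type*) [Field F] : Subring (ℕ+ → F) where
  carrier := {ξ | IsW ξ}
  mul_mem' := IsW.mul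
  one_mem' := IsW.one
  add_mem' := IsW.add
  zero_mem' := IsW.zero
  neg_mem' := IsW.neg

theorem mem_Wring {ξ : ℕ+ → F} : ξ ∈ Wring F ↔ IsW ξ := Iff.rfl

theorem IsW.frob [CharZero F] {ξ : ℕ+ → F} (h : IsW ξ) (p : ℕ) (hp : p.Prime) :
    ∃ η, IsW η ∧ ∀ n, ξ (⟨p, hp.pos⟩ * n) = ξ n ^ p + (p : F) * η n := by
  have hp0 : (p : F) ≠ 0 := by exact_mod_cast hp.ne_zero
  refine ⟨fun n => (ξ (⟨p, hp.pos⟩ * n) - ξ n ^ p) / p, fun k => ?_, fun n => ?_⟩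
  · obtain ⟨η, hη, hη'⟩ := (h (k+1)).2 p hp
    convert hη using 1
    ext n
    rw [hη']
    field_simp
    ring
  · field_simp
    ring

theorem VQ_map {F' : Type*} [Field F'] [CharZero F] [CharZero F'] (f : F →+* F') (k : ℕ) (ξ : ℕ+ → F) :
    (fun n => f (ξ n)) ∈ VQ F' k ↔ ξ ∈ VQ F k := by
  induction k generalizing ξ with
  | zero =>
    exact forall_congr' fun n => isIntegral_algHom_iff f.toIntAlgHom f.injective
  | succ k ih =>
    refine and_congr (ih ξ) (forall_congr' fun p => forall_congr' fun hp => ?_)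
    have hp0 : (p : F') ≠ 0 := by exact_mod_cast hp.ne_zero
    have hp1 : (p : F) ≠ 0 := by exact_mod_cast hp.ne_zero
    constructor
    · rintro ⟨η, hη, h⟩
      refine ⟨fun n => (ξ (⟨p, hp.pos⟩ * n) - ξ n ^ p) / p, ?_, ?_⟩
      · rw [← ih]
        convert hη using 1
        ext n
        have := h n
        simp only [map_div₀, map_sub, map_pow, map_natCast, this]
        field_simp
        ring
      · intro n; field_simp; ring
    · rintro ⟨η, hη, h⟩
      refine ⟨fun n => f (η n), (ih η).2 hη, fun n => ?_⟩
      simp [h n]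

theorem IsW_map {F' : Type*} [Field F'] [CharZero F] [CharZero F'] (f : F →+* F') (ξ : ℕ+ → F) :
    IsW (fun n => f (ξ n)) ↔ IsW ξ := forall_congr' fun k => VQ_map f k ξ

theorem VQ_psi (m : ℕ+) (k : ℕ) : ∀ ξ : ℕ+ → F, ξ ∈ VQ F k → (fun n => ξ (m * n)) ∈ VQ F k := by
  induction k with
  | zero => intro ξ h n; exact h _
  | succ k ih =>
    intro ξ h
    refine ⟨ih _ h.1, fun p hp => ?_⟩
    obtain ⟨η, hη, h'⟩ := h.2 p hp
    refine ⟨fun n => η (m * n), ih _ hη, fun n => ?_⟩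
    have h2 := h' (m * n)
    have h3 : ∀ q : ℕ+, ξ (m * (q * n)) = ξ (q * (m * n)) := fun q => congrArg ξ (mul_left_comm m q n)
    exact (h3 _).trans h2

theorem IsW.psi {ξ : ℕ+ → F} (h : IsW ξ) (m : ℕ+) : IsW (fun n => ξ (m * n)) :=
  fun k => VQ_psi m k ξ (h k)

/-- The characters. -/
theorem IsW.char {ξ : ℕ+ → F} (hi : ∀ n, IsIntegral ℤ (ξ n)) (h : ∀ (p : ℕ) (hp : p.Prime) n, ξ (⟨p, hp.pos⟩ * n) = ξ n ^ p) :
    IsW ξ := by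
  intro k
  induction k with
  | zero => exact hi
  | succ k ih =>
    refine ⟨ih, fun p hp => ⟨0, IsW.zero k, fun n => by simp [h p hp n]⟩⟩

theorem UQ_eq_VQ (k : ℕ) : UQ k = VQ ℂ k := by
  induction k with
  | zero => rfl
  | succ k ih =>
    ext ξ
    rw [UQ, VQ, ih]
    refine and_congr Iff.rfl (forall_congr' fun p => forall_congr' fun hp => ?_)
    obtain ⟨S, hS⟩ := VQ_subring (F := ℂ) k
    have hp0 : (p : ℂ) ≠ 0 := by exact_mod_cast hp.ne_zero
    have : Submodule.span ℤ {x | ∃ η ∈ VQ ℂ k, x = (p : ℤ) • η} =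
        AddSubgroup.toIntSubmodule (S.toAddSubgroup.map (AddMonoidHom.mulLeft (p : ℕ+ → ℂ))) := by
      refine le_antisymm (Submodule.span_le.2 ?_) ?_
      · rintro _ ⟨η, hη, rfl⟩
        refine ⟨η, ?_, ?_⟩
        · rw [← hS] at hη; exact hη
        · ext n; simp
      · rintro _ ⟨η, hη, rfl⟩
        refine Submodule.subset_span ⟨η, ?_, ?_⟩
        · rw [← hS]; exact hη
        · ext n; simp
    rw [this]
    constructor
    · rintro ⟨η, hη, h⟩
      refine ⟨η, by rw [← hS]; exact hη, fun n => ?_⟩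
      have := congrFun h n
      simp at this
      rw [this]; ring
    · rintro ⟨η, hη, h⟩
      refine ⟨η, by rw [← hS] at hη; exact hη, ?_⟩
      ext n
      simp [h n]

theorem mem_WaQ {ξ : ℕ+ → ℂ} : ξ ∈ WaQ ↔ IsW ξ ∧ IsIntegral ℤ ξ := by
  simp [WaQ, IsW, UQ_eq_VQ]

end part1

section part2

theorem natCast_dvd_of_prime_pow {R : Type*} [CommRing R] (y : R) (n : ℕ) (hn : n ≠ 0)
    (h : ∀ p k : ℕ, p.Prime → p ^ k ∣ n → ((p : R) ^ k) ∣ y) : (n : R) ∣ y := by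
  induction n using Nat.recOnPosPrimePosCoprime with
  | prime_pow p k hp hk => simpa using h p k hp dvd_rfl
  | zero => exact absurd rfl hn
  | one => simp
  | coprime a b ha hb hab iha ihb =>
    rw [Nat.cast_mul]
    have hc : IsCoprime (a : R) (b : R) := by
      have := (Nat.isCoprime_iff_coprime.2 hab).map (Int.castRingHom R)
      simpa using this
    refine hc.mul_dvd (iha (by omega) fun p k hp hd => h p k hp (hd.mul_right _))
      (ihb (by omega) fun p k hp hd => h p k hp (hd.mul_left _))

theorem dwork_aux {R : Type*} [CommRing R] (p : ℕ) (a b : R) (h : (p : R) ∣ a - b)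
    (e d k : ℕ) (hd : p ^ (k + 1) ∣ p * (d * e)) (hp : p.Prime) (he : e ≠ 0) (hd0 : d ≠ 0) :
    ((p : R) ^ (k + 1)) ∣ (d : R) * a ^ e - (d : R) * b ^ e := by
  obtain ⟨v, u, hu, rfl⟩ := Nat.exists_eq_pow_mul_and_not_dvd he p hp.ne_one
  obtain ⟨w, t, ht, rfl⟩ := Nat.exists_eq_pow_mul_and_not_dvd hd0 p hp.ne_one
  have hk : k ≤ w + v := by
    have h1 : p ^ (k+1) ∣ p ^ (w + v + 1) * (t * u) := by
      refine hd.trans (dvd_of_eq ?_); ring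
    have h2 : Nat.Coprime (p ^ (k+1)) (t * u) :=
      Nat.Coprime.pow_left _ (Nat.Coprime.mul_right ((hp.coprime_iff_not_dvd).2 ht) ((hp.coprime_iff_not_dvd).2 hu))
    have h3 := h2.dvd_of_dvd_mul_right h1
    have := (Nat.pow_dvd_pow_iff_le_right hp.one_lt).1 h3
    omega
  have h1 := dvd_sub_pow_of_dvd_sub h v
  have h2 : ((p : R) ^ (v+1)) ∣ a ^ (p ^ v * u) - b ^ (p ^ v * u) := by
    rw [pow_mul, pow_mul]
    exact h1.trans (sub_dvd_pow_sub_pow _ _ _)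
  rw [← mul_sub]
  refine (pow_dvd_pow (p : R) (by omega : k + 1 ≤ w + (v + 1))).trans ?_
  rw [pow_add]
  refine mul_dvd_mul ?_ h2
  push_cast
  exact Dvd.intro _ rfl

open Classical in
noncomputable def dworkX {R : Type*} [CommRing R] (ξ : ℕ → R) (n : ℕ) : R :=
  if h : ∃ y, (n : R) * y = ξ n - ∑ d ∈ n.properDivisors.attach, (d.1 : R) * dworkX ξ d.1 ^ (n / d.1)
  then h.choose else 0
termination_by n
decreasing_by exact (Nat.mem_properDivisors.1 d.2).2

theorem dworkX_spec {R : Type*} [CommRing R] (ξ : ℕ → R) (n : ℕ)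
    (h : (n : R) ∣ ξ n - ∑ d ∈ n.properDivisors, (d : R) * dworkX ξ d ^ (n / d)) :
    (n : R) * dworkX ξ n = ξ n - ∑ d ∈ n.properDivisors, (d : R) * dworkX ξ d ^ (n / d) := by
  rw [← Finset.sum_attach] at h ⊢
  have h' : ∃ y, (n : R) * y = ξ n - ∑ d ∈ n.properDivisors.attach, (d.1 : R) * dworkX ξ d.1 ^ (n / d.1) := by
    obtain ⟨y, hy⟩ := h; exact ⟨y, hy.symm⟩
  have := h'.choose_spec
  rw [← this]
  congr 1
  conv_lhs => rw [dworkX, dif_pos h']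

theorem dwork {R : Type*} [CommRing R] (ξ : ℕ → R) (ψ : ℕ → R →+* R)
    (h1 : ∀ p m : ℕ, p.Prime → 0 < m → ξ (p * m) = ψ p (ξ m))
    (h2 : ∀ p : ℕ, p.Prime → ∀ x : R, (p : R) ∣ ψ p x - x ^ p) (n : ℕ) (hn : 0 < n) :
    ξ n = ∑ d ∈ n.divisors, (d : R) * dworkX ξ d ^ (n / d) := by
  induction n using Nat.strong_induction_on with
  | _ n ih =>
  rw [← Nat.cons_self_properDivisors hn.ne', Finset.sum_cons, Nat.div_self hn, pow_one,
    dworkX_spec, sub_add_cancel]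
  refine natCast_dvd_of_prime_pow _ n hn.ne' fun p k hp hk => ?_
  rcases k with _ | k
  · simp
  obtain ⟨m, rfl⟩ : p ∣ n := (dvd_pow_self p (by omega)).trans hk
  have hm : 0 < m := Nat.pos_of_mul_pos_left hn
  have hlt : m < p * m := by nlinarith [hp.two_le]
  rw [h1 p m hp hm, ih m hlt hm, map_sum]
  have hsub : m.divisors ⊆ (p * m).properDivisors := by
    intro d hd
    rw [Nat.mem_divisors] at hd
    rw [Nat.mem_properDivisors]
    exact ⟨hd.1.mul_left _, (Nat.le_of_dvd hm hd.1).trans_lt hlt⟩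
  rw [← Finset.sum_sdiff hsub, sub_add_eq_sub_sub_swap, ← Finset.sum_sub_distrib]
  refine dvd_sub (Finset.dvd_sum fun d hd => ?_) (Finset.dvd_sum fun d hd => ?_)
  · rw [Nat.mem_divisors] at hd
    obtain ⟨e, rfl⟩ := hd.1
    have hd0 : d ≠ 0 := by rintro rfl; simp at hm
    have he0 : e ≠ 0 := by rintro rfl; simp at hm
    rw [map_mul, map_natCast, map_pow, Nat.mul_div_cancel_left _ (by omega),
      show p * (d * e) / d = p * e by rw [mul_left_comm, Nat.mul_div_cancel_left _ (by omega)], pow_mul]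
    exact dwork_aux p _ _ (h2 p hp _) e d k hk hp he0 hd0
  · rw [Finset.mem_sdiff, Nat.mem_properDivisors, Nat.mem_divisors] at hd
    have hd1 := hd.1.1
    have hd2 : ¬ d ∣ m := fun h => hd.2 ⟨h, hm.ne'⟩
    refine Dvd.dvd.mul_right ?_ _
    have : p ^ (k+1) ∣ d := by
      obtain ⟨e, he⟩ := hd1
      by_cases hpe : p ∣ e
      · obtain ⟨e', rfl⟩ := hpe
        exfalso; apply hd2
        refine ⟨e', ?_⟩
        have : p * m = p * (d * e') := by rw [he]; ring
        exact Nat.eq_of_mul_eq_mul_left hp.pos this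
      · rw [he] at hk
        exact (Nat.Coprime.pow_left _ ((hp.coprime_iff_not_dvd).2 hpe)).dvd_of_dvd_mul_right hk
    obtain ⟨c, rfl⟩ := this
    push_cast
    exact Dvd.intro _ rfl

end part2

section part3
open PowerSeries

variable {A : Type*} [CommRing A]

noncomputable def geo (x : A) (d : ℕ) : A⟦X⟧ := PowerSeries.mk fun m => if d ∣ m then x ^ (m / d) else 0

theorem geo_mul (x : A) (d : ℕ) (hd : 0 < d) : (1 - C x * X ^ d) * geo x d = 1 := by
  ext m
  rw [sub_mul, one_mul, map_sub, mul_assoc, coeff_C_mul, coeff_X_pow_mul', geo, coeff_mk, coeff_one]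
  by_cases hm : d ≤ m
  · obtain ⟨k, rfl⟩ := Nat.exists_eq_add_of_le hm
    rw [if_pos hm, Nat.add_sub_cancel_left, coeff_mk]
    rw [if_neg (by omega : ¬ d + k = 0)]
    by_cases h : d ∣ k
    · rw [if_pos h, if_pos (by simpa using h), Nat.add_div_left k hd, pow_succ]; ring
    · rw [if_neg h, if_neg (by simpa using h)]; simp
  · rw [if_neg hm, mul_zero, sub_zero]
    by_cases h0 : m = 0
    · subst h0; simp
    · rw [if_neg h0, if_neg]
      intro h
      exact hm (Nat.le_of_dvd (by omega) h)

theorem geo_deriv (x : A) (d : ℕ) (hd : 0 < d) :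
    X * derivative A (geo x d) = geo x d * (C (d * x) * X ^ d * geo x d) := by
  have h := geo_mul x d hd
  have h2 := congrArg (derivative A) h
  rw [Derivation.leibniz, map_sub] at h2
  simp only [Derivation.map_one_eq_zero, smul_eq_mul, Derivation.leibniz, derivative_C, Derivation.leibniz_pow, derivative_X] at h2
  simp only [mul_zero, add_zero, zero_sub, mul_one] at h2
  have h3 : (X : A⟦X⟧) ^ d = X ^ (d-1) * X := by rw [← pow_succ, Nat.sub_add_cancel hd]
  have h4 : (C ((d:A) * x) : A⟦X⟧) = (d : A⟦X⟧) * C x := by simp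
  rw [h4]
  simp only [nsmul_eq_mul] at h2
  have h5 : (1 - C x * X ^ d) * derivative A (geo x d) = (geo x d) * (C x * ((d : A⟦X⟧) * X ^ (d-1))) := by
    linear_combination h2
  calc X * derivative A (geo x d) = X * (((1 - C x * X ^ d) * geo x d) * derivative A (geo x d)) := by rw [h]; ring
    _ = X * geo x d * ((1 - C x * X ^ d) * derivative A (geo x d)) := by ring
    _ = _ := by rw [h5, h3]; ring

theorem geo_coeff (x : A) (d : ℕ) (hd : 0 < d) (m : ℕ) : coeff m (C (d * x) * X ^ d * geo x d) =
    if m = 0 then 0 else if d ∣ m then d * x ^ (m / d) else 0 := by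
  rw [mul_assoc, coeff_C_mul, coeff_X_pow_mul', geo]
  by_cases hm : d ≤ m
  · obtain ⟨k, rfl⟩ := Nat.exists_eq_add_of_le hm
    rw [if_pos hm, Nat.add_sub_cancel_left, coeff_mk]
    rw [if_neg (by omega : ¬ d + k = 0)]
    by_cases h : d ∣ k
    · rw [if_pos h, if_pos (by simpa using h), Nat.add_div_left k hd, pow_succ]; ring
    · rw [if_neg h, if_neg (by simpa using h)]; simp
  · rw [if_neg hm, mul_zero]
    by_cases h0 : m = 0
    · subst h0; simp
    · rw [if_neg h0, if_neg]
      intro h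
      exact hm (Nat.le_of_dvd (by omega) h)

noncomputable def geoP (x : ℕ → A) : ℕ → A⟦X⟧
  | 0 => 1
  | N + 1 => geoP x N * geo (x (N+1)) (N+1)

theorem geoP_deriv (x : ℕ → A) (N : ℕ) : X * derivative A (geoP x N) =
    geoP x N * ∑ d ∈ Finset.Icc 1 N, (C (d * x d) * X ^ d * geo (x d) d) := by
  induction N with
  | zero => simp [geoP]
  | succ N ih =>
    rw [geoP, Derivation.leibniz, Finset.sum_Icc_succ_top (by omega)]
    simp only [smul_eq_mul]
    have := geo_deriv (x (N+1)) (N+1) (by omega)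
    linear_combination (geoP x N) * this + geo (x (N+1)) (N+1) * ih

theorem geoP_stable (x : ℕ → A) (m N : ℕ) (h : m ≤ N) : coeff m (geoP x N) = coeff m (geoP x m) := by
  induction N, h using Nat.le_induction with
  | base => rfl
  | succ N hN ih =>
    rw [← ih, geoP, coeff_mul]
    rw [Finset.sum_eq_single (m, 0)]
    · simp [geo]
    · rintro ⟨i, j⟩ hij hne
      rw [Finset.HasAntidiagonal.mem_antidiagonal] at hij
      have hj : j ≠ 0 := by rintro rfl; apply hne; simpa using hij
      simp only at hij ⊢
      rw [geo, coeff_mk, if_neg, mul_zero]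
      intro hd
      have := Nat.le_of_dvd (by omega) hd
      omega
    · intro h; simp at h

theorem exp_series (x : ℕ → A) : ∃ p : ℕ → A, p 0 = 1 ∧ ∀ n : ℕ, (n : A) * p n =
    ∑ ij ∈ Finset.HasAntidiagonal.antidiagonal n, p ij.1 * (if ij.2 = 0 then 0 else ∑ d ∈ ij.2.divisors, (d : A) * x d ^ (ij.2 / d)) := by
  refine ⟨fun m => coeff m (geoP x m), by simp [geoP], fun n => ?_⟩
  have h := congrArg (coeff n) (geoP_deriv x n)
  have h1 : coeff n (X * derivative A (geoP x n)) = n * coeff n (geoP x n) := by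
    rcases n with _ | n
    · simp
    · rw [coeff_succ_X_mul, coeff_derivative]; push_cast; ring
  rw [h1, coeff_mul] at h
  refine h.trans ?_
  refine Finset.sum_congr rfl ?_
  rintro ⟨i, j⟩ hij
  rw [Finset.HasAntidiagonal.mem_antidiagonal] at hij
  simp only at hij ⊢
  rw [geoP_stable x i n (by omega), map_sum]
  congr 1
  rw [Finset.sum_congr rfl (fun d hd => geo_coeff (x d) d (by simp at hd; omega) j)]
  split_ifs with h0
  · simp
  · rw [← Finset.sum_filter]
    refine Finset.sum_congr ?_ fun _ _ => rfl
    ext d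
    simp only [Finset.mem_filter, Finset.mem_Icc, Nat.mem_divisors]
    constructor
    · rintro ⟨_, h⟩; exact ⟨h, h0⟩
    · rintro ⟨h, _⟩
      have := Nat.le_of_dvd (by omega) h
      exact ⟨⟨Nat.pos_of_dvd_of_pos h (by omega), by omega⟩, h⟩

end part3

section part4
open PowerSeries Finset.HasAntidiagonal

/-- extension of a sequence by zero at 0 -/
def ex {M : Type*} [Zero M] (ξ : ℕ+ → M) (n : ℕ) : M := if h : 0 < n then ξ (n.toPNat h) else 0

theorem ex_zero {M : Type*} [Zero M] (ξ : ℕ+ → M) : ex ξ 0 = 0 := by simp [ex]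
theorem ex_pos {M : Type*} [Zero M] (ξ : ℕ+ → M) {n : ℕ} (h : 0 < n) : ex ξ n = ξ (n.toPNat h) := by simp [ex, h]
theorem ex_pnat {M : Type*} [Zero M] (ξ : ℕ+ → M) (n : ℕ+) : ex ξ n = ξ n := by
  rw [ex_pos ξ n.pos]; rfl

variable {F : Type*} [Field F] [CharZero F]

def psiHom (F : Type*) [Field F] (m : ℕ+) : Wring F →+* Wring F where
  toFun ξ := ⟨fun n => ξ.1 (m * n), IsW.psi ξ.2 m⟩
  map_one' := rfl
  map_mul' _ _ := rfl
  map_zero' := rfl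
  map_add' _ _ := rfl

theorem exp_IsW {ξ : ℕ+ → F} (hξ : IsW ξ) : ∃ p : ℕ → F, p 0 = 1 ∧ (∀ n, IsIntegral ℤ (p n)) ∧
    ∀ n : ℕ, (n : F) * p n = ∑ ij ∈ antidiagonal n, p ij.1 * ex ξ ij.2 := by
  let ψ : ℕ → Wring F →+* Wring F := fun n => if h : 0 < n then psiHom F (n.toPNat h) else RingHom.id _
  let ξ' : ℕ → Wring F := fun n => ψ n ⟨ξ, hξ⟩
  have h1 : ∀ p m : ℕ, p.Prime → 0 < m → ξ' (p * m) = ψ p (ξ' m) := by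
    intro p m hp hm
    have hpm : 0 < p * m := Nat.mul_pos hp.pos hm
    apply Subtype.ext
    funext n
    simp only [ξ', ψ, dif_pos hp.pos, dif_pos hm, dif_pos hpm, psiHom, RingHom.coe_mk, MonoidHom.coe_mk, OneHom.coe_mk]
    congr 1
    apply PNat.eq
    change p * m * (n : ℕ) = m * (p * n)
    ring
  have h2 : ∀ p : ℕ, p.Prime → ∀ x : Wring F, (p : Wring F) ∣ ψ p x - x ^ p := by
    intro p hp x
    obtain ⟨η, hη, h⟩ := x.2.frob p hp
    refine ⟨⟨η, hη⟩, ?_⟩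
    apply Subtype.ext
    funext n
    have := h n
    simp only [ψ, dif_pos hp.pos, psiHom, RingHom.coe_mk, MonoidHom.coe_mk, OneHom.coe_mk]
    change x.1 ((p.toPNat hp.pos) * n) - x.1 n ^ p = (p : F) * η n
    exact sub_eq_of_eq_add' this
  let A := integralClosure ℤ F
  let X := dworkX ξ'
  let x : ℕ → A := fun d => ⟨(X d).1 1, (X d).2.integral 1⟩
  obtain ⟨p, hp0, hp⟩ := exp_series x
  refine ⟨fun n => (p n : F), by simp [hp0], fun n => (p n).2, fun n => ?_⟩
  have h := congrArg (algebraMap A F) (hp n)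
  rw [map_mul, map_natCast, map_sum] at h
  refine h.trans (Finset.sum_congr rfl fun ij _ => ?_)
  rw [map_mul]
  refine congrArg ((p ij.1 : F) * ·) ?_
  by_cases h0 : ij.2 = 0
  · simp [h0, ex_zero]
  · have hpos : 0 < ij.2 := Nat.pos_of_ne_zero h0
    rw [if_neg h0, ex_pos ξ hpos, map_sum]
    have := congrFun (congrArg Subtype.val (dwork ξ' ψ h1 h2 ij.2 hpos)) 1
    have h3 : (ξ' ij.2).1 1 = ξ (ij.2.toPNat hpos) := by
      simp [ξ', ψ, hpos, psiHom]
    rw [← h3, this]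
    rw [AddSubmonoidClass.coe_finsetSum, Finset.sum_apply]
    refine Finset.sum_congr rfl fun d _ => ?_
    rw [map_mul, map_pow, map_natCast]
    rfl

theorem exp_pair {ξ : ℕ+ → F} (hξ : IsW ξ) : ∃ p q : ℕ → F, p 0 = 1 ∧ q 0 = 1 ∧
    (∀ n, IsIntegral ℤ (p n)) ∧ (∀ n, IsIntegral ℤ (q n)) ∧
    (∀ n : ℕ, (n : F) * p n = ∑ ij ∈ antidiagonal n, p ij.1 * ex ξ ij.2) ∧
    (∀ n : ℕ, (n : F) * q n = ∑ ij ∈ antidiagonal n, q ij.1 * -ex ξ ij.2) ∧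
    (∀ n : ℕ, ex ξ n = ∑ ij ∈ antidiagonal n, (ij.1 * p ij.1) * q ij.2) := by
  obtain ⟨p, hp0, hpi, hp⟩ := exp_IsW hξ
  obtain ⟨q, hq0, hqi, hq⟩ := exp_IsW hξ.neg
  have hneg : ∀ n, ex (-ξ) n = - ex ξ n := by
    intro n; unfold ex; split_ifs <;> simp
  simp only [hneg] at hq
  refine ⟨p, q, hp0, hq0, hpi, hqi, hp, hq, fun n => ?_⟩
  let P : F⟦X⟧ := PowerSeries.mk p
  let Q : F⟦X⟧ := PowerSeries.mk q
  let N : F⟦X⟧ := PowerSeries.mk (ex ξ)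
  have hX : ∀ G : F⟦X⟧, ∀ n, coeff n (X * derivative F G) = n * coeff n G := by
    intro G n
    rcases n with _ | n
    · simp
    · rw [coeff_succ_X_mul, coeff_derivative]; push_cast; ring
  have hP : X * derivative F P = P * N := by
    ext n; rw [hX, coeff_mul]; simp only [P, N, coeff_mk]; exact hp n
  have hQ : X * derivative F Q = - (Q * N) := by
    ext n; rw [hX, map_neg, coeff_mul]; simp only [Q, N, coeff_mk]; rw [hq n]; simp
  have hPQ : X * derivative F (P * Q) = 0 := by
    rw [Derivation.leibniz]; simp only [smul_eq_mul]
    linear_combination Q * hP + P * hQ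
  have h1 : P * Q = 1 := by
    ext n
    have := congrArg (coeff n) hPQ
    rw [hX, map_zero] at this
    rw [coeff_one]
    split_ifs with h
    · subst h; simp [P, Q, hp0, hq0]
    · exact (mul_eq_zero.1 this).resolve_left (by exact_mod_cast h)
  have h2 : N = (X * derivative F P) * Q := by
    rw [hP]; linear_combination (-N) * h1
  have := congrArg (coeff n) h2
  rw [coeff_mul] at this
  simp only [hX] at this
  simpa [N, P, Q] using this

end part4

section part5
open Finset

noncomputable def hl (x : ℕ) : ℝ := ∑ n ∈ Ioc 0 x, (1 / n : ℝ)

theorem hl_nonneg (x : ℕ) : 0 ≤ hl x := sum_nonneg fun _ _ => by positivity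

theorem hl_mono {x y : ℕ} (h : x ≤ y) : hl x ≤ hl y :=
  sum_le_sum_of_subset_of_nonneg (Ioc_subset_Ioc_right h) fun _ _ _ => by positivity

theorem hl_tail (X p : ℕ) (hp : 0 < p) : ∑ m ∈ Ioc (X / p) X, (1 / m : ℝ) ≤ p := by
  rcases Nat.eq_zero_or_pos X with rfl | hX
  · simp
  have hX' : (0 : ℝ) < X := by exact_mod_cast hX
  calc ∑ m ∈ Ioc (X / p) X, (1 / m : ℝ) ≤ ∑ m ∈ Ioc (X / p) X, (p / X : ℝ) := by
        refine sum_le_sum fun m hm => ?_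
        rw [mem_Ioc] at hm
        have h1 : X < m * p := (Nat.div_lt_iff_lt_mul hp).1 hm.1
        have hm0 : (0 : ℝ) < m := by exact_mod_cast (Nat.pos_of_ne_zero (by rintro rfl; simp at h1) : 0 < m)
        rw [div_le_div_iff₀ hm0 hX']
        have : (X : ℝ) ≤ m * p := by exact_mod_cast h1.le
        linarith
    _ = ((X - X / p : ℕ) : ℝ) * (p / X) := by simp
    _ ≤ X * (p / X) := by
        gcongr
        exact_mod_cast Nat.sub_le _ _
    _ = p := by field_simp

theorem hl_div (x p : ℕ) (hp : 0 < p) : hl x - p ≤ hl (x / p) := by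
  have h1 : hl x = hl (x / p) + ∑ m ∈ Ioc (x / p) x, (1 / m : ℝ) := by
    unfold hl
    rw [Finset.sum_Ioc_consecutive _ (Nat.zero_le _) (Nat.div_le_self _ _)]
  linarith [hl_tail x p hp]

theorem sum_dvd {M : Type*} [AddCommMonoid M] (f : ℕ → M) (X x d : ℕ) (hd : 0 < d) :
    ∑ n ∈ Ioc X x, (if d ∣ n then f n else 0) = ∑ m ∈ Ioc (X / d) (x / d), f (d * m) := by
  rw [← sum_filter]
  symm
  refine sum_bij (fun m _ => d * m) ?_ ?_ ?_ ?_
  · intro m hm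
    rw [mem_Ioc, Nat.div_lt_iff_lt_mul hd, Nat.le_div_iff_mul_le hd] at hm
    rw [mem_filter, mem_Ioc]
    refine ⟨⟨by nlinarith, by nlinarith⟩, Dvd.intro _ rfl⟩
  · intro a _ b _ h; exact Nat.eq_of_mul_eq_mul_left hd h
  · intro n hn
    rw [mem_filter, mem_Ioc] at hn
    obtain ⟨⟨h1, h2⟩, m, rfl⟩ := hn
    refine ⟨m, ?_, rfl⟩
    rw [mem_Ioc, Nat.div_lt_iff_lt_mul hd, Nat.le_div_iff_mul_le hd]
    exact ⟨by nlinarith, by nlinarith⟩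
  · intros; rfl

theorem sum_dvd_hl (x d : ℕ) (hd : 0 < d) :
    ∑ n ∈ Ioc 0 x, (if d ∣ n then (1 / n : ℝ) else 0) = (1 / d) * hl (x / d) := by
  rw [sum_dvd _ _ _ _ hd, Nat.zero_div, hl, mul_sum]
  refine sum_congr rfl fun m _ => ?_
  push_cast
  rw [one_div_mul_one_div]

theorem pair_bound (p q x : ℕ) (hp : p.Prime) (hq : q.Prime) :
    ∑ n ∈ Ioc 0 x, ((if p ∣ n then (1:ℝ) else 0) - 1 / p) * ((if q ∣ n then (1:ℝ) else 0) - 1 / q) * (1 / n)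
      ≤ (if p = q then hl x / p else 0) + 2 := by
  have hp0 : (1 : ℝ) ≤ p := by exact_mod_cast hp.one_le
  have hq0 : (1 : ℝ) ≤ q := by exact_mod_cast hq.one_le
  have e : ∀ n : ℕ, ((if p ∣ n then (1:ℝ) else 0) - 1 / p) * ((if q ∣ n then (1:ℝ) else 0) - 1 / q) * (1 / n)
    = (if p ∣ n ∧ q ∣ n then (1 / n : ℝ) else 0) - (1 / q) * (if p ∣ n then (1 / n : ℝ) else 0)
      - (1 / p) * (if q ∣ n then (1 / n : ℝ) else 0) + (1 / p) * (1 / q) * (1 / n) := by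
    intro n
    by_cases h1 : p ∣ n <;> by_cases h2 : q ∣ n <;> simp [h1, h2] <;> ring
  simp only [e]
  rw [sum_add_distrib, sum_sub_distrib, sum_sub_distrib, ← mul_sum, ← mul_sum, ← mul_sum,
    sum_dvd_hl _ _ hp.pos, sum_dvd_hl _ _ hq.pos]
  change _ + _ * hl x ≤ _
  have b1 := hl_div x p hp.pos
  have b2 := hl_div x q hq.pos
  have h0 := hl_nonneg x
  have c1 : (1 / (q:ℝ)) * ((1 / p) * hl (x / p)) ≥ (1 / q) * (1 / p) * hl x - 1 := by
    have : (1 / (q:ℝ)) * ((1 / p) * hl (x / p)) ≥ (1 / q) * ((1 / p) * (hl x - p)) := by gcongr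
    have h3 : (1 / (q:ℝ)) * ((1 / p) * (hl x - p)) = (1 / q) * (1 / p) * hl x - 1 / q := by field_simp
    have h4 : 1 / (q:ℝ) ≤ 1 := by rw [div_le_one (by linarith)]; exact hq0
    linarith
  have c2 : (1 / (p:ℝ)) * ((1 / q) * hl (x / q)) ≥ (1 / q) * (1 / p) * hl x - 1 := by
    have : (1 / (p:ℝ)) * ((1 / q) * hl (x / q)) ≥ (1 / p) * ((1 / q) * (hl x - q)) := by gcongr
    have h3 : (1 / (p:ℝ)) * ((1 / q) * (hl x - q)) = (1 / q) * (1 / p) * hl x - 1 / p := by field_simp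
    have h4 : 1 / (p:ℝ) ≤ 1 := by rw [div_le_one (by linarith)]; exact hp0
    linarith
  have c3 : ∑ n ∈ Ioc 0 x, (if p ∣ n ∧ q ∣ n then (1 / n : ℝ) else 0) ≤
      (if p = q then hl x / p else 0) + (1 / q) * (1 / p) * hl x := by
    by_cases hpq : p = q
    · subst hpq
      simp only [and_self, if_true]
      rw [sum_dvd_hl _ _ hp.pos]
      have : (1 / (p:ℝ)) * hl (x / p) ≤ (1 / p) * hl x := by gcongr; exact hl_mono (Nat.div_le_self _ _)
      have h3 : 0 ≤ (1 / (p:ℝ)) * (1 / p) * hl x := by positivity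
      have h4 : (1 / (p:ℝ)) * hl x = hl x / p := by ring
      linarith
    · rw [if_neg hpq, zero_add]
      have hc : Nat.Coprime p q := (Nat.coprime_primes hp hq).2 hpq
      have : ∀ n, (p ∣ n ∧ q ∣ n) ↔ p * q ∣ n := fun n =>
        ⟨fun h => hc.mul_dvd_of_dvd_of_dvd h.1 h.2, fun h => ⟨(Dvd.intro _ rfl).trans h, (Dvd.intro_left _ rfl).trans h⟩⟩
      simp only [this]
      rw [sum_dvd_hl _ _ (Nat.mul_pos hp.pos hq.pos)]
      push_cast
      have h3 : (1 / (q:ℝ)) * (1 / p) = 1 / (p * q) := by field_simp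
      rw [h3]
      gcongr
      exact hl_mono (Nat.div_le_self _ _)
  have h5 : (1 / (p:ℝ)) * (1 / q) * hl x = (1 / q) * (1 / p) * hl x := by ring
  linarith

theorem tk_var (P : Finset ℕ) (hP : ∀ p ∈ P, p.Prime) (x : ℕ) :
    ∑ n ∈ Ioc 0 x, (∑ p ∈ P, ((if p ∣ n then (1:ℝ) else 0) - 1 / p)) ^ 2 * (1 / n) ≤
      (∑ p ∈ P, (1 / p : ℝ)) * hl x + 2 * (#P) ^ 2 := by
  simp only [sq (∑ p ∈ P, _), sum_mul_sum]
  simp only [sum_mul]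
  rw [sum_comm]
  calc _ ≤ ∑ p ∈ P, ∑ q ∈ P, ((if p = q then hl x / p else 0) + 2) := by
        refine sum_le_sum fun p hp => ?_
        rw [sum_comm]
        exact sum_le_sum fun q hq => pair_bound p q x (hP p hp) (hP q hq)
    _ = _ := by
        simp only [sum_add_distrib, sum_const, sum_ite_eq, nsmul_eq_mul]
        rw [sum_congr rfl (fun p hp => if_pos hp)]
        have : ∑ p ∈ P, hl x / p = ∑ p ∈ P, 1 / (p : ℝ) * hl x := sum_congr rfl fun p _ => by ring
        rw [this]
        ring

theorem tk (P : Finset ℕ) (hP : ∀ p ∈ P, p.Prime) : ∃ C : ℝ, ∀ (X x : ℕ) (a : ℕ → ℂ), (∀ n, ‖a n‖ ≤ 1) →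
    ‖(∑ p ∈ P, (1 / p : ℂ)) * ∑ n ∈ Ioc X x, a n / n - ∑ p ∈ P, (1 / p : ℂ) * ∑ m ∈ Ioc X x, a (p * m) / m‖
      ≤ √(∑ p ∈ P, (1 / p : ℝ)) * hl x + C := by
  rcases P.eq_empty_or_nonempty with rfl | hne
  · exact ⟨0, fun X x a _ => by simp⟩
  set W : ℝ := ∑ p ∈ P, (1 / p : ℝ) with hW
  have hWpos : 0 < W := sum_pos (fun p hp => by have := (hP p hp).pos; positivity) hne
  set D : ℝ := 2 * (#P) ^ 2
  refine ⟨D / (2 * √W) + 2 * #P, fun X x a ha => ?_⟩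
  have hx0 := hl_nonneg x
  -- first part
  have h1 : ‖∑ n ∈ Ioc X x, (∑ p ∈ P, ((if p ∣ n then (1:ℂ) else 0) - 1 / p)) * (a n / n)‖ ≤ √W * hl x + D / (2 * √W) := by
    have s1 : ‖∑ n ∈ Ioc X x, (∑ p ∈ P, ((if p ∣ n then (1:ℂ) else 0) - 1 / p)) * (a n / n)‖ ≤
        ∑ n ∈ Ioc 0 x, |∑ p ∈ P, ((if p ∣ n then (1:ℝ) else 0) - 1 / p)| * (1 / n) := by
      refine (norm_sum_le _ _).trans ?_
      refine (sum_le_sum (fun n hn => ?_)).trans (sum_le_sum_of_subset_of_nonneg (Ioc_subset_Ioc_left (Nat.zero_le X)) fun _ _ _ => by positivity)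
      rw [norm_mul, norm_div, Complex.norm_natCast]
      have : (∑ p ∈ P, ((if p ∣ n then (1:ℂ) else 0) - 1 / p)) = ((∑ p ∈ P, ((if p ∣ n then (1:ℝ) else 0) - 1 / p) : ℝ) : ℂ) := by
        push_cast
        refine sum_congr rfl fun p _ => ?_
        split_ifs <;> simp
      rw [this, Complex.norm_real, Real.norm_eq_abs]
      gcongr
      exact ha n
    refine s1.trans ?_
    refine abs_le_of_sq_le_sq' ?_ (by positivity) |>.2
    have s2 : ∀ n : ℕ, |∑ p ∈ P, ((if p ∣ n then (1:ℝ) else 0) - 1 / p)| * (1 / n) =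
      (|∑ p ∈ P, ((if p ∣ n then (1:ℝ) else 0) - 1 / p)| * √(1 / n)) * √(1/n) := by
      intro n
      rw [mul_assoc, Real.mul_self_sqrt (by positivity)]
    simp only [s2]
    refine (sum_mul_sq_le_sq_mul_sq _ _ _).trans ?_
    simp only [mul_pow, sq_abs]
    have s3 : ∀ n : ℕ, √(1 / n : ℝ) ^ 2 = 1 / n := fun n => Real.sq_sqrt (by positivity)
    simp only [s3]
    refine (mul_le_mul_of_nonneg_right (tk_var P hP x) (hl_nonneg x)).trans ?_
    have hs : √W ^ 2 = W := Real.sq_sqrt hWpos.le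
    have hs0 : 0 < √W := Real.sqrt_pos.2 hWpos
    have : (√W * hl x + D / (2 * √W)) ^ 2 = √W ^ 2 * hl x ^ 2 + D * hl x + (D / (2 * √W)) ^ 2 := by
      field_simp; ring
    rw [this, hs]
    have h6 : 0 ≤ (D / (2 * √W)) ^ 2 := by positivity
    have h7 : (W * hl x + 2 * (#P) ^ 2) * hl x = W * hl x ^ 2 + D * hl x := by ring
    change (W * hl x + 2 * (#P) ^ 2) * hl x ≤ _
    linarith
  -- second part
  have h2 : ∀ p ∈ P, ‖∑ n ∈ Ioc X x, (if p ∣ n then a n / n else 0) - (1 / p : ℂ) * ∑ m ∈ Ioc X x, a (p * m) / m‖ ≤ 2 := by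
    intro p hp
    have hp0 := (hP p hp).pos
    have hpR : (0 : ℝ) < p := by exact_mod_cast hp0
    rw [sum_dvd _ _ _ _ hp0]
    have e1 : ∑ m ∈ Ioc (X / p) (x / p), a (p * m) / ((p * m : ℕ) : ℂ) = (1 / p : ℂ) * ∑ m ∈ Ioc (X / p) (x / p), a (p * m) / m := by
      rw [mul_sum]
      refine sum_congr rfl fun m _ => ?_
      push_cast
      rw [div_mul_div_comm, one_mul]
    rw [e1, ← mul_sub, norm_mul]
    set f : ℕ → ℂ := fun m => a (p * m) / m
    have hf : ∀ Y, ‖∑ m ∈ Ioc (Y / p) Y, f m‖ ≤ p := by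
      intro Y
      refine (norm_sum_le _ _).trans ((sum_le_sum fun m _ => ?_).trans (hl_tail Y p hp0))
      simp only [f, norm_div, Complex.norm_natCast]
      gcongr
      exact ha _
    have e2 : ‖∑ m ∈ Ioc (X / p) (x / p), f m - ∑ m ∈ Ioc X x, f m‖ ≤ 2 * p := by
      by_cases hXx : X ≤ x
      · have i1 : ∑ m ∈ Ioc (X / p) (x / p), f m + ∑ m ∈ Ioc (x / p) x, f m = ∑ m ∈ Ioc (X / p) X, f m + ∑ m ∈ Ioc X x, f m := by
          rw [sum_Ioc_consecutive _ (Nat.div_le_div_right hXx) (Nat.div_le_self _ _),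
            sum_Ioc_consecutive _ (Nat.div_le_self _ _) hXx]
        have : ∑ m ∈ Ioc (X / p) (x / p), f m - ∑ m ∈ Ioc X x, f m = ∑ m ∈ Ioc (X / p) X, f m - ∑ m ∈ Ioc (x / p) x, f m := by
          linear_combination i1
        rw [this]
        refine (norm_sub_le _ _).trans ?_
        linarith [hf X, hf x]
      · push Not at hXx
        rw [Ioc_eq_empty_of_le hXx.le, Ioc_eq_empty_of_le (Nat.div_le_div_right hXx.le)]
        simp
    calc ‖(1 / p : ℂ)‖ * _ ≤ ‖(1 / p : ℂ)‖ * (2 * p) := by gcongr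
      _ = 2 := by simp; field_simp
  have e3 : (∑ p ∈ P, (1 / p : ℂ)) * ∑ n ∈ Ioc X x, a n / n - ∑ p ∈ P, (1 / p : ℂ) * ∑ m ∈ Ioc X x, a (p * m) / m
      = -(∑ n ∈ Ioc X x, (∑ p ∈ P, ((if p ∣ n then (1:ℂ) else 0) - 1 / p)) * (a n / n))
        + ∑ p ∈ P, (∑ n ∈ Ioc X x, (if p ∣ n then a n / n else 0) - (1 / p : ℂ) * ∑ m ∈ Ioc X x, a (p * m) / m) := by
    have : ∀ n : ℕ, (∑ p ∈ P, ((if p ∣ n then (1:ℂ) else 0) - 1 / p)) * (a n / n)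
       = (∑ p ∈ P, (if p ∣ n then a n / n else 0)) - (∑ p ∈ P, (1 / p : ℂ)) * (a n / n) := by
      intro n
      rw [sum_sub_distrib, sub_mul, sum_mul]
      congr 1
      refine sum_congr rfl fun p _ => ?_
      split_ifs <;> simp
    simp only [this]
    rw [sum_sub_distrib, sum_sub_distrib, ← mul_sum, sum_comm]
    ring
  rw [e3]
  refine (norm_add_le _ _).trans ?_
  rw [norm_neg]
  have h3 : ‖∑ p ∈ P, (∑ n ∈ Ioc X x, (if p ∣ n then a n / n else 0) - (1 / p : ℂ) * ∑ m ∈ Ioc X x, a (p * m) / m)‖ ≤ 2 * #P := by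
    refine (norm_sum_le _ _).trans ((sum_le_sum h2).trans ?_)
    simp [mul_comm]
  linarith

end part5

section part6
open Finset

theorem hl_le_log (x : ℕ) : hl x ≤ 1 + Real.log x := by
  have := harmonic_le_one_add_log x
  rw [harmonic_eq_sum_Icc] at this
  have e : hl x = ((∑ i ∈ Icc 1 x, (i : ℚ)⁻¹ : ℚ) : ℝ) := by
    unfold hl; push_cast; exact sum_congr (by ext; simp; omega) fun _ _ => by simp
  rw [e]; exact this

theorem log_le_hl (x : ℕ) : Real.log (x + 1) ≤ hl x := by
  have := log_add_one_le_harmonic x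
  rw [harmonic_eq_sum_Icc] at this
  have e : hl x = ((∑ i ∈ Icc 1 x, (i : ℚ)⁻¹ : ℚ) : ℝ) := by
    unfold hl; push_cast; exact sum_congr (by ext; simp; omega) fun _ _ => by simp
  rw [e]; exact_mod_cast this

theorem hl_tendsto : Filter.Tendsto hl Filter.atTop Filter.atTop := by
  refine Filter.tendsto_atTop_mono log_le_hl ?_
  exact Real.tendsto_log_atTop.comp (Filter.tendsto_atTop_add_const_right _ _ tendsto_natCast_atTop_atTop)

open Classical in
theorem sieve_finite (S : Finset ℕ) (hS : ∀ p ∈ S, p.Prime) (y : ℕ) :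
    (∏ p ∈ S, (1 - 1 / p : ℝ)) * hl y ≤ ∑ m ∈ (Ioc 0 y).filter (fun m => ∀ p ∈ S, ¬ p ∣ m), (1 / m : ℝ) := by
  induction S using Finset.induction_on generalizing y with
  | empty => simp [hl]
  | insert p S hpS ih =>
    have hp : p.Prime := hS p (mem_insert_self _ _)
    have ih' := ih (fun q hq => hS q (mem_insert_of_mem hq)) y
    rw [prod_insert hpS, mul_assoc]
    have hp1 : (0 : ℝ) ≤ 1 - 1 / p := by
      have : (1 : ℝ) ≤ p := by exact_mod_cast hp.one_le
      rw [sub_nonneg, div_le_one (by linarith)]; exact this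
    refine (mul_le_mul_of_nonneg_left ih' hp1).trans ?_
    set D := ∑ m ∈ (Ioc 0 y).filter (fun m => ∀ p ∈ S, ¬ p ∣ m), (1 / m : ℝ) with hD
    have key : D ≤ ∑ m ∈ (Ioc 0 y).filter (fun m => ∀ q ∈ insert p S, ¬ q ∣ m), (1 / m : ℝ) + (1 / p) * D := by
      have h1 : D = ∑ m ∈ (Ioc 0 y).filter (fun m => ∀ q ∈ insert p S, ¬ q ∣ m), (1 / m : ℝ) +
          ∑ n ∈ Ioc 0 y, (if p ∣ n then (if ∀ q ∈ S, ¬ q ∣ n then (1 / n : ℝ) else 0) else 0) := by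
        rw [hD, sum_filter, sum_filter, ← sum_add_distrib]
        refine sum_congr rfl fun n _ => ?_
        simp only [mem_insert, forall_eq_or_imp]
        by_cases h1 : p ∣ n <;> by_cases h2 : ∀ q ∈ S, ¬ q ∣ n <;> simp [h1, h2]
      rw [sum_dvd _ _ _ _ hp.pos] at h1
      have h2 : ∑ m ∈ Ioc (0 / p) (y / p), (if ∀ q ∈ S, ¬ q ∣ p * m then (1 / ((p * m : ℕ) : ℝ)) else 0) ≤ (1 / p) * D := by
        rw [hD, sum_filter, mul_sum]
        rw [Nat.zero_div]
        refine (sum_le_sum (fun m _ => ?_)).trans (sum_le_sum_of_subset_of_nonneg (Ioc_subset_Ioc_right (Nat.div_le_self y p)) fun m _ _ => ?_)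
        · by_cases h : ∀ q ∈ S, ¬ q ∣ p * m
          · rw [if_pos h, if_pos (fun q hq hd => h q hq (hd.mul_left _))]
            push_cast
            rw [one_div_mul_one_div]
          · rw [if_neg h]
            split_ifs <;> positivity
        · split_ifs <;> positivity
      linarith
    linarith

open Classical in
theorem sieve_lower (E : Set ℕ) (hE : ∀ p ∈ E, p.Prime) (hs : Summable (fun p : ℕ => if p ∈ E then (1 / p : ℝ) else 0)) :
    ∃ c : ℝ, 0 < c ∧ ∀ y : ℕ, c * hl y ≤ ∑ m ∈ (Ioc 0 y).filter (fun m => ∀ p ∈ E, ¬ p ∣ m), (1 / m : ℝ) := by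
  refine ⟨Real.exp (-(2 * ∑' p : ℕ, if p ∈ E then (1 / p : ℝ) else 0)), Real.exp_pos _, fun y => ?_⟩
  set S := (Ioc 0 y).filter (· ∈ E)
  have hSp : ∀ p ∈ S, p.Prime := fun p hp => hE p (mem_filter.1 hp).2
  have h1 := sieve_finite S hSp y
  have e : (Ioc 0 y).filter (fun m => ∀ p ∈ E, ¬ p ∣ m) = (Ioc 0 y).filter (fun m => ∀ p ∈ S, ¬ p ∣ m) := by
    refine filter_congr fun m hm => ?_
    rw [mem_Ioc] at hm
    refine ⟨fun h p hp => h p (mem_filter.1 hp).2, fun h p hp hd => ?_⟩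
    refine h p (mem_filter.2 ⟨mem_Ioc.2 ⟨(hE p hp).pos, (Nat.le_of_dvd hm.1 hd).trans hm.2⟩, hp⟩) hd
  rw [e]
  refine le_trans (mul_le_mul_of_nonneg_right ?_ (hl_nonneg y)) h1
  have h2 : ∑ p ∈ S, (1 / p : ℝ) ≤ ∑' p : ℕ, if p ∈ E then (1 / p : ℝ) else 0 := by
    rw [show ∑ p ∈ S, (1 / p : ℝ) = ∑ p ∈ S, if p ∈ E then (1 / p : ℝ) else 0 from
      sum_congr rfl fun p hp => by rw [if_pos (mem_filter.1 hp).2]]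
    exact hs.sum_le_tsum _ fun p _ => by split_ifs <;> positivity
  calc _ ≤ Real.exp (∑ p ∈ S, -(2 * (1 / p : ℝ))) := by
        rw [Real.exp_le_exp, sum_neg_distrib, ← mul_sum]; linarith
    _ = ∏ p ∈ S, Real.exp (-(2 * (1 / p : ℝ))) := Real.exp_sum _ _
    _ ≤ _ := by
        refine prod_le_prod (fun _ _ => (Real.exp_pos _).le) fun p hp => ?_
        have h2p : (2 : ℝ) ≤ p := by exact_mod_cast (hSp p hp).two_le
        set t : ℝ := 1 / p
        have ht0 : 0 < t := by positivity
        have ht : t ≤ 1 / 2 := by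
          apply one_div_le_one_div_of_le <;> linarith
        rw [Real.exp_neg, inv_le_comm₀ (Real.exp_pos _) (by linarith)]
        have h3 := Real.add_one_le_exp (2 * t)
        refine le_trans ?_ h3
        rw [inv_le_comm₀ (by linarith) (by linarith), inv_eq_one_div, div_le_iff₀ (by linarith)]
        nlinarith

theorem abel_bound (a : ℕ → ℝ) (ha : ∀ n, 0 ≤ a n) (C : ℝ) (h : ∀ x : ℕ, ∑ n ∈ Ioc 0 x, a n ≤ C * x) (x : ℕ) :
    ∑ n ∈ Ioc 0 x, a n / n ≤ C * (1 + hl x) := by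
  have hC : 0 ≤ C := by
    have := h 1
    have h2 : 0 ≤ ∑ n ∈ Ioc 0 1, a n := sum_nonneg fun n _ => ha n
    push_cast at this; linarith
  have key : ∑ n ∈ Ioc 0 x, a n / n = (∑ n ∈ Ioc 0 x, a n) / (x + 1) + ∑ n ∈ Ioc 0 x, (∑ k ∈ Ioc 0 n, a k) / (n * (n + 1)) := by
    induction x with
    | zero => simp
    | succ x ih =>
      rw [sum_Ioc_succ_top (Nat.zero_le _), ih, sum_Ioc_succ_top (Nat.zero_le _), sum_Ioc_succ_top (Nat.zero_le _), sum_Ioc_succ_top (Nat.zero_le _)]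
      push_cast
      field_simp
      ring
  rw [key]
  have h1 : (∑ n ∈ Ioc 0 x, a n) / (x + 1) ≤ C := by
    rw [div_le_iff₀ (by positivity)]
    nlinarith [h x]
  have h2 : ∑ n ∈ Ioc 0 x, (∑ k ∈ Ioc 0 n, a k) / (n * (n + 1) : ℝ) ≤ C * hl x := by
    rw [hl, mul_sum]
    refine sum_le_sum fun n hn => ?_
    have hn0 : (0 : ℝ) < n := by exact_mod_cast (mem_Ioc.1 hn).1
    calc _ ≤ C * n / (n * (n + 1) : ℝ) := by gcongr; exact h n
      _ ≤ C * n / (n * n) := by gcongr; linarith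
      _ = C * (1 / n) := by field_simp
  linarith

open Classical in
/-- no-go for two primes of norm `p` for almost all `p` -/
theorem pairs_contra (E : Set ℕ) (hE : ∀ p ∈ E, p.Prime)
    (hs : Summable (fun p : ℕ => if p ∈ E then (1 / p : ℝ) else 0)) (C : ℝ)
    (h : ∀ x : ℕ, (#((Ioc 0 x ×ˢ Ioc 0 x).filter (fun mn => (∀ p ∈ E, ¬ p ∣ mn.1) ∧ (∀ p ∈ E, ¬ p ∣ mn.2) ∧ mn.1 * mn.2 ≤ x)) : ℝ) ≤ C * x) :
    False := by
  obtain ⟨c, hc, hlow⟩ := sieve_lower E hE hs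
  let fr : ℕ → Prop := fun m => ∀ p ∈ E, ¬ p ∣ m
  let a : ℕ → ℝ := fun n => #((Ioc 0 n ×ˢ Ioc 0 n).filter (fun mn => fr mn.1 ∧ fr mn.2 ∧ mn.1 * mn.2 = n))
  have hmem : ∀ x n : ℕ, n ∈ Ioc 0 x → (Ioc 0 n ×ˢ Ioc 0 n).filter (fun mn => fr mn.1 ∧ fr mn.2 ∧ mn.1 * mn.2 = n)
     = ((Ioc 0 x ×ˢ Ioc 0 x).filter (fun mn => fr mn.1 ∧ fr mn.2 ∧ mn.1 * mn.2 ≤ x)).filter (fun mn => mn.1 * mn.2 = n) := by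
    intro x n hn
    ext ⟨m1, m2⟩
    simp only [mem_filter, mem_product, mem_Ioc] at hn ⊢
    constructor
    · rintro ⟨⟨⟨h1, h2⟩, h3, h4⟩, h5, h6, h7⟩
      exact ⟨⟨⟨⟨h1, by omega⟩, h3, by omega⟩, h5, h6, by omega⟩, h7⟩
    · rintro ⟨⟨⟨⟨h1, h2⟩, h3, h4⟩, h5, h6, h7⟩, rfl⟩
      exact ⟨⟨⟨h1, Nat.le_mul_of_pos_right _ h3⟩, h3, Nat.le_mul_of_pos_left _ h1⟩, h5, h6, rfl⟩
  have hA : ∀ x : ℕ, ∑ n ∈ Ioc 0 x, a n ≤ C * x := by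
    intro x
    refine le_trans (le_of_eq ?_) (h x)
    rw [card_eq_sum_card_fiberwise (f := fun mn : ℕ × ℕ => mn.1 * mn.2) (t := Ioc 0 x)]
    · push_cast
      refine sum_congr rfl fun n hn => ?_
      simp only [a]
      rw [hmem x n hn]
    · intro mn hmn
      simp only [coe_filter, mem_product, mem_Ioc, Set.mem_ofPred_eq] at hmn
      simp only [coe_Ioc, Set.mem_Ioc]
      exact ⟨Nat.mul_pos hmn.1.1.1 hmn.1.2.1, hmn.2.2.2⟩
  have hab := abel_bound a (fun n => Nat.cast_nonneg _) C hA
  have hsq : ∀ y : ℕ, (c * hl y) ^ 2 ≤ C * (1 + hl (y * y)) := by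
    intro y
    refine le_trans ?_ (hab (y * y))
    refine (pow_le_pow_left₀ (by have := hl_nonneg y; positivity) (hlow y) 2).trans ?_
    rw [sq, sum_mul_sum, ← sum_product', ]
    have e : ∑ n ∈ Ioc 0 (y * y), a n / n = ∑ mn ∈ (Ioc 0 (y*y) ×ˢ Ioc 0 (y*y)).filter (fun mn => fr mn.1 ∧ fr mn.2 ∧ mn.1 * mn.2 ≤ y*y), (1 / mn.1 : ℝ) * (1 / mn.2) := by
      rw [← sum_fiberwise_of_maps_to (g := fun mn : ℕ × ℕ => mn.1 * mn.2) (t := Ioc 0 (y*y))]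
      · refine sum_congr rfl fun n hn => ?_
        simp only [a]
        rw [hmem _ n hn, card_eq_sum_ones]
        push_cast
        rw [sum_div]
        refine sum_congr rfl fun mn hmn => ?_
        rw [← (mem_filter.1 hmn).2]
        push_cast
        rw [one_div_mul_one_div]
      · intro mn hmn
        simp only [mem_filter, mem_product, mem_Ioc] at hmn
        simp only [mem_Ioc]
        exact ⟨Nat.mul_pos hmn.1.1.1 hmn.1.2.1, hmn.2.2.2⟩
    rw [e]
    refine sum_le_sum_of_subset_of_nonneg ?_ fun _ _ _ => by positivity
    intro mn hmn
    simp only [mem_filter, mem_product, mem_Ioc] at hmn ⊢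
    obtain ⟨⟨⟨h1, h2⟩, h3⟩, ⟨h4, h5⟩, h6⟩ := hmn
    exact ⟨⟨⟨h1, by nlinarith⟩, h4, by nlinarith⟩, h3, h6, Nat.mul_le_mul h2 h5⟩
  have hC : 0 ≤ C := by
    have := hA 1
    have h2 : 0 ≤ ∑ n ∈ Ioc 0 1, a n := sum_nonneg fun n _ => Nat.cast_nonneg _
    push_cast at this; linarith
  have hsq2 : ∀ y : ℕ, 0 < y → hl (y * y) ≤ 1 + 2 * hl y := by
    intro y hy
    have h1 := hl_le_log (y * y)
    have h2 := log_le_hl y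
    push_cast at h1
    have hy' : (0:ℝ) < y := by exact_mod_cast hy
    rw [Real.log_mul hy'.ne' hy'.ne'] at h1
    have h3 : Real.log y ≤ Real.log (y + 1) := Real.log_le_log hy' (by linarith)
    linarith
  have := hl_tendsto.eventually_ge_atTop (max 1 (4 * C / c ^ 2 + 1))
  obtain ⟨y, hy, hy0⟩ := (this.and (Filter.eventually_gt_atTop 0)).exists
  have hy1 : 1 ≤ hl y := (le_max_left _ _).trans hy
  have hy2 : 4 * C / c ^ 2 + 1 ≤ hl y := (le_max_right _ _).trans hy
  have h1 := hsq y
  have h2 := hsq2 y hy0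
  have h3 : C * (1 + hl (y * y)) ≤ C * (4 * hl y) := by gcongr; linarith
  have h4 : 4 * C + c ^ 2 ≤ c ^ 2 * hl y := by
    have : c ^ 2 * (4 * C / c ^ 2 + 1) ≤ c ^ 2 * hl y := by gcongr
    have e : c ^ 2 * (4 * C / c ^ 2 + 1) = 4 * C + c ^ 2 := by field_simp
    linarith
  have h5 : c ^ 2 * hl y * hl y ≥ (4 * C + c ^ 2) * hl y := by gcongr
  have h6 : 0 < c ^ 2 * hl y := by positivity
  nlinarith

end part6

section part7
open NumberField

variable {L : Type*} [Field L] [NumberField L]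

theorem bad_dvd (t : 𝓞 L) (ht : t ≠ 0) : ∃ N : ℕ, 0 < N ∧ ∀ p : ℕ, p.Prime → ∀ P : Ideal (𝓞 L),
    P.IsPrime → (p : 𝓞 L) ∈ P → t ∈ P → p ∣ N := by
  refine ⟨Ideal.absNorm (Ideal.span {t}), ?_, fun p hp P hP hpP htP => ?_⟩
  · rw [Nat.pos_iff_ne_zero, Ne, Ideal.absNorm_eq_zero_iff, Ideal.span_singleton_eq_bot]
    exact ht
  · by_contra hd
    have h1 : ((Ideal.absNorm (Ideal.span {t}) : ℕ) : 𝓞 L) ∈ P :=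
      (Ideal.span_singleton_le_iff_mem P).2 htP (Ideal.absNorm_mem _)
    have hc := (Nat.isCoprime_iff_coprime.2 ((hp.coprime_iff_not_dvd).2 hd)).map (Int.castRingHom (𝓞 L))
    obtain ⟨a, b, hab⟩ := hc
    apply hP.ne_top
    rw [Ideal.eq_top_iff_one, ← hab]
    refine P.add_mem (P.mul_mem_left _ (by simpa using hpP)) (P.mul_mem_left _ (by simpa using h1))

def IsFrob (p : ℕ) (σ : L ≃ₐ[ℚ] L) : Prop :=
  ∃ P : Ideal (𝓞 L), P.IsPrime ∧ (p : 𝓞 L) ∈ P ∧ ∀ x : 𝓞 L, σ • x - x ^ p ∈ P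

theorem frob_conj {p : ℕ} {σ : L ≃ₐ[ℚ] L} (h : IsFrob p σ) (τ : L ≃ₐ[ℚ] L) : IsFrob p (τ * σ * τ⁻¹) := by
  obtain ⟨P, hP, hpP, h⟩ := h
  refine ⟨P.comap (MulSemiringAction.toRingHom (L ≃ₐ[ℚ] L) (𝓞 L) τ⁻¹), inferInstance, ?_, fun x => ?_⟩
  · rw [Ideal.mem_comap, map_natCast]; exact hpP
  · rw [Ideal.mem_comap, map_sub, map_pow]
    have := h (τ⁻¹ • x)
    simpa [MulSemiringAction.toRingHom_apply, mul_smul] using this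

theorem exists_prime_over (p : ℕ) (hp : p.Prime) : ∃ P : Ideal (𝓞 L), P.IsPrime ∧ (p : 𝓞 L) ∈ P := by
  have : ¬ IsUnit (p : 𝓞 L) := by
    intro h
    have h2 := Ideal.absNorm_eq_one_iff.2 (Ideal.span_singleton_eq_top.2 h)
    rw [Ideal.absNorm_span_natCast] at h2
    have := Module.finrank_pos (R := ℤ) (M := 𝓞 L)
    have := Nat.one_lt_pow this.ne' hp.one_lt
    omega
  obtain ⟨P, hP, h⟩ := exists_max_ideal_of_mem_nonunits this
  exact ⟨P, hP.isPrime, h⟩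

theorem frob_exists [IsGalois ℚ L] (p : ℕ) (hp : p.Prime) (P : Ideal (𝓞 L)) (hP : P.IsPrime) (hpP : (p : 𝓞 L) ∈ P) :
    ∃ σ : L ≃ₐ[ℚ] L, ∀ x : 𝓞 L, σ • x - x ^ p ∈ P := by
  have hP0 : P ≠ ⊥ := by
    rintro rfl
    rw [Ideal.mem_bot] at hpP
    exact hp.ne_zero (by exact_mod_cast hpP)
  have : Finite (𝓞 L ⧸ P) := Ring.HasFiniteQuotients.finiteQuotient hP0
  have : Algebra.IsInvariant ℤ (𝓞 L) (L ≃ₐ[ℚ] L) := inferInstance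
  obtain ⟨σ, hσ⟩ := IsArithFrobAt.exists_of_isInvariant ℤ (L ≃ₐ[ℚ] L) P
  refine ⟨σ, fun x => ?_⟩
  have hu : P.under ℤ = Ideal.span {(p : ℤ)} := by
    have : (Ideal.span {(p : ℤ)}).IsMaximal :=
      PrincipalIdealRing.isMaximal_of_irreducible (Nat.prime_iff_prime_int.1 hp).irreducible
    refine (this.eq_of_le (Ideal.IsPrime.under ℤ P).ne_top ?_).symm
    rw [Ideal.span_singleton_le_iff_mem, Ideal.mem_comap]
    simpa using hpP
  have hc : Nat.card (ℤ ⧸ P.under ℤ) = p := by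
    rw [hu]
    simpa using Int.card_ideal_quot p
  have := hσ x
  rw [hc] at this
  exact this

theorem eta_frob [IsGalois ℚ L] (η : ℕ+ → L) (hW : IsW η) (hf : (Set.range η).Finite) :
    ∃ M : ℕ, ∀ (p : ℕ) (hp : p.Prime), M < p → ∀ σ : L ≃ₐ[ℚ] L, IsFrob p σ →
      ∀ n, η (p.toPNat hp.pos * n) = σ (η n) := by
  let η' : ℕ+ → 𝓞 L := fun n => ⟨η n, hW.integral n⟩
  have hf' : (Set.range η').Finite := by
    have : Set.range η = (fun x : 𝓞 L => (x : L)) '' Set.range η' := by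
      rw [← Set.range_comp]; rfl
    rw [this] at hf
    exact hf.of_finite_image RingOfIntegers.coe_injective.injOn
  let T : Set (𝓞 L) := (fun x : (L ≃ₐ[ℚ] L) × (𝓞 L × 𝓞 L) => x.1 • x.2.1 - x.2.2) '' (Set.univ ×ˢ (Set.range η' ×ˢ Set.range η'))
  have hT : T.Finite := (Set.finite_univ.prod (hf'.prod hf')).image _
  choose N hN0 hN using fun (t : 𝓞 L) (ht : t ≠ 0) => bad_dvd t ht
  classical
  let N' : 𝓞 L → ℕ := fun t => if ht : t ≠ 0 then N t ht else 0
  refine ⟨hT.toFinset.sup N', fun p hp hM σ hσ n => ?_⟩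
  obtain ⟨P, hP, hpP, h⟩ := hσ
  have h1 : σ • η' n - η' (p.toPNat hp.pos * n) ∈ P := by
    obtain ⟨e, he, hne⟩ := hW.frob p hp
    obtain ⟨e', he'⟩ : ∃ e' : 𝓞 L, algebraMap (𝓞 L) L e' = e n := ⟨⟨e n, he.integral n⟩, rfl⟩
    have h2 : η' (p.toPNat hp.pos * n) = η' n ^ p + (p : 𝓞 L) * e' := by
      apply RingOfIntegers.coe_injective
      exact (hne n).trans (by rw [map_add, map_pow, map_mul, map_natCast, he']; rfl)
    rw [h2, ← sub_sub]
    exact P.sub_mem (h _) (P.mul_mem_right _ hpP)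
  have h3 : σ • η' n - η' (p.toPNat hp.pos * n) = 0 := by
    by_contra hne
    have hmem : σ • η' n - η' (p.toPNat hp.pos * n) ∈ T := ⟨(σ, η' n, η' (p.toPNat hp.pos * n)), by simp, rfl⟩
    have h4 := hN _ hne p hp P hP hpP h1
    have h5 := Finset.le_sup (f := N') (hT.mem_toFinset.2 hmem)
    have h6 : N' (σ • η' n - η' (p.toPNat hp.pos * n)) = N _ hne := dif_pos hne
    have h7 := Nat.le_of_dvd (hN0 _ hne) h4
    omega
  have := congrArg (fun x : 𝓞 L => (x : L)) (sub_eq_zero.1 h3)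
  exact this.symm

open Ideal in
theorem ideal_count : ∃ C : ℝ, ∀ x : ℕ, 0 < x → (Nat.card {I : Ideal (𝓞 L) // absNorm I ≤ x} : ℝ) ≤ C * x := by
  obtain ⟨l, hl⟩ : ∃ l, Filter.Tendsto (fun s : ℝ => (Nat.card {I : Ideal (𝓞 L) // absNorm I ≤ s} : ℝ) / s) Filter.atTop (nhds l) :=
    ⟨_, NumberField.Ideal.tendsto_norm_le_div_atTop L⟩
  have h1 := (hl.comp tendsto_natCast_atTop_atTop).bddAbove_range
  obtain ⟨C, hC⟩ := h1
  refine ⟨C, fun x hx => ?_⟩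
  have := hC ⟨x, rfl⟩
  simp only [Function.comp, Nat.cast_le] at this
  rwa [div_le_iff₀ (by exact_mod_cast hx)] at this

open Ideal in
theorem two_primes_contra (E : Set ℕ) (hE : ∀ p ∈ E, p.Prime)
    [DecidablePred (· ∈ E)]
    (hs : Summable (fun p : ℕ => if p ∈ E then (1 / p : ℝ) else 0)) (𝔭 𝔮 : ℕ → Ideal (𝓞 L))
    (h : ∀ p : ℕ, p.Prime → p ∉ E → (𝔭 p).IsPrime ∧ (𝔮 p).IsPrime ∧ absNorm (𝔭 p) = p ∧ absNorm (𝔮 p) = p ∧ 𝔭 p ≠ 𝔮 p) :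
    False := by
  classical
  obtain ⟨C, hC⟩ := ideal_count (L := L)
  refine pairs_contra E hE (by convert hs) C fun x => ?_
  rcases Nat.eq_zero_or_pos x with rfl | hx
  · simp
  refine le_trans ?_ (hC x hx)
  have : Finite {I : Ideal (𝓞 L) // absNorm I ≤ x} := Ideal.finite_setOfPred_absNorm_le x
  let Fm : ℕ → Multiset ℕ := fun m => (m.primeFactorsList : Multiset ℕ)
  have good : ∀ m : ℕ, (∀ p ∈ E, ¬ p ∣ m) → ∀ p ∈ Fm m, p.Prime ∧ p ∉ E := by
    intro m hm p hp
    have hp' : p ∈ m.primeFactorsList := hp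
    exact ⟨Nat.prime_of_mem_primeFactorsList hp', fun hpE => hm p hpE (Nat.dvd_of_mem_primeFactorsList hp')⟩
  let J : ℕ × ℕ → Multiset (Ideal (𝓞 L)) := fun mn => (Fm mn.1).map 𝔭 + (Fm mn.2).map 𝔮
  have hJn : ∀ mn : ℕ × ℕ, mn.1 ≠ 0 → mn.2 ≠ 0 → (∀ p ∈ E, ¬ p ∣ mn.1) → (∀ p ∈ E, ¬ p ∣ mn.2) → absNorm (J mn).prod = mn.1 * mn.2 := by
    intro mn h1 h2 h3 h4
    rw [Multiset.prod_add, map_mul, map_multiset_prod, map_multiset_prod, Multiset.map_map, Multiset.map_map]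
    have e1 : Multiset.map (absNorm ∘ 𝔭) (Fm mn.1) = Fm mn.1 :=
      (Multiset.map_congr (f := absNorm ∘ 𝔭) (g := id) rfl (fun p hp => (h p (good _ h3 p hp).1 (good _ h3 p hp).2).2.2.1)).trans (Multiset.map_id _)
    have e2 : Multiset.map (absNorm ∘ 𝔮) (Fm mn.2) = Fm mn.2 :=
      (Multiset.map_congr (f := absNorm ∘ 𝔮) (g := id) rfl (fun p hp => (h p (good _ h4 p hp).1 (good _ h4 p hp).2).2.2.2.1)).trans (Multiset.map_id _)
    rw [e1, e2]
    simp [Fm, Nat.prod_primeFactorsList h1, Nat.prod_primeFactorsList h2]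
  have hne : ∀ p : ℕ, p.Prime → ∀ I : Ideal (𝓞 L), absNorm I = p → I ≠ ⊥ := by
    rintro p hp I hI rfl
    simp at hI; exact hp.ne_zero hI.symm
  have hJp : ∀ mn : ℕ × ℕ, (∀ p ∈ E, ¬ p ∣ mn.1) → (∀ p ∈ E, ¬ p ∣ mn.2) → ∀ I ∈ J mn, Prime I := by
    intro mn h3 h4 I hI
    simp only [J, Multiset.mem_add, Multiset.mem_map] at hI
    rcases hI with ⟨p, hp, rfl⟩ | ⟨p, hp, rfl⟩
    · have hg := good _ h3 p hp
      have := h p hg.1 hg.2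
      exact (Ideal.prime_iff_isPrime (hne p hg.1 _ this.2.2.1)).2 this.1
    · have hg := good _ h4 p hp
      have := h p hg.1 hg.2
      exact (Ideal.prime_iff_isPrime (hne p hg.1 _ this.2.2.2.1)).2 this.2.1
  have hJ1 : ∀ mn : ℕ × ℕ, (∀ p ∈ E, ¬ p ∣ mn.1) → (∀ p ∈ E, ¬ p ∣ mn.2) →
      ((J mn).filter (fun I => I = 𝔭 (absNorm I))).map absNorm = Fm mn.1 := by
    intro mn h3 h4
    have e1 : ((Fm mn.1).map 𝔭).filter (fun I => I = 𝔭 (absNorm I)) = (Fm mn.1).map 𝔭 := by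
      rw [Multiset.filter_eq_self]
      intro I hI
      obtain ⟨p, hp, rfl⟩ := Multiset.mem_map.1 hI
      rw [(h p (good _ h3 p hp).1 (good _ h3 p hp).2).2.2.1]
    have e2 : ((Fm mn.2).map 𝔮).filter (fun I => I = 𝔭 (absNorm I)) = 0 := by
      rw [Multiset.filter_eq_nil]
      intro I hI
      obtain ⟨p, hp, rfl⟩ := Multiset.mem_map.1 hI
      have := h p (good _ h4 p hp).1 (good _ h4 p hp).2
      rw [this.2.2.2.1]
      exact this.2.2.2.2.symm
    simp only [J]
    have e3 : Multiset.map (absNorm ∘ 𝔭) (Fm mn.1) = Fm mn.1 :=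
      (Multiset.map_congr (f := absNorm ∘ 𝔭) (g := id) rfl (fun p hp => (h p (good _ h3 p hp).1 (good _ h3 p hp).2).2.2.1)).trans (Multiset.map_id _)
    rw [Multiset.filter_add, e1, e2, add_zero, Multiset.map_map, e3]
  rw [← Fintype.card_coe, ← Nat.card_eq_fintype_card, Nat.cast_le]
  refine Nat.card_le_card_of_injective (fun mn => ⟨(J mn.1).prod, ?_⟩) ?_
  · have := mn.2
    simp only [Finset.mem_filter, Finset.mem_product, Finset.mem_Ioc] at this
    rw [hJn _ (by omega) (by omega) this.2.1 this.2.2.1]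
    exact_mod_cast this.2.2.2
  · rintro ⟨mn, hmn⟩ ⟨mn', hmn'⟩ heq
    simp only [Finset.mem_filter, Finset.mem_product, Finset.mem_Ioc] at hmn hmn'
    have h0 : (J mn).prod = (J mn').prod := congrArg Subtype.val heq
    have h1 : J mn = J mn' := by
      have := congrArg UniqueFactorizationMonoid.normalizedFactors h0
      rwa [UniqueFactorizationMonoid.normalizedFactors_prod_of_prime (hJp _ hmn.2.1 hmn.2.2.1),
        UniqueFactorizationMonoid.normalizedFactors_prod_of_prime (hJp _ hmn'.2.1 hmn'.2.2.1)] at this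
    have h2 : Fm mn.1 = Fm mn'.1 := by
      rw [← hJ1 _ hmn.2.1 hmn.2.2.1, ← hJ1 _ hmn'.2.1 hmn'.2.2.1, h1]
    have h3 : mn.1 = mn'.1 := by
      have := congrArg Multiset.prod h2
      simpa [Fm, Nat.prod_primeFactorsList (by omega : mn.1 ≠ 0), Nat.prod_primeFactorsList (by omega : mn'.1 ≠ 0)] using this
    have h4 : mn.1 * mn.2 = mn'.1 * mn'.2 := by
      rw [← hJn _ (by omega) (by omega) hmn.2.1 hmn.2.2.1, ← hJn _ (by omega) (by omega) hmn'.2.1 hmn'.2.2.1, h1]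
    have h5 : mn.2 = mn'.2 := by
      rw [h3] at h4
      exact Nat.eq_of_mul_eq_mul_left (by omega) h4
    exact Subtype.ext (Prod.ext h3 h5)

end part7

section part8
open NumberField

theorem prime_res {F : Type*} [Field F] [NumberField F] (p : ℕ) (hp : p.Prime) (P : Ideal (𝓞 F)) (hP : P.IsPrime) (hpP : (p : 𝓞 F) ∈ P)
    (h : ∀ x : 𝓞 F, x - x ^ p ∈ P) : (∀ x : 𝓞 F, ∃ a : ℤ, x - (a : 𝓞 F) ∈ P) ∧ Ideal.absNorm P = p := by
  have : Fact p.Prime := ⟨hp⟩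
  have h0 : ((p : ℕ) : 𝓞 F ⧸ P) = 0 := by
    have := Ideal.Quotient.eq_zero_iff_mem.2 hpP
    simpa using this
  have : CharP (𝓞 F ⧸ P) p := by
    have h1 := ringChar.dvd h0
    rcases (Nat.dvd_prime hp).1 h1 with h2 | h2
    · have := CharP.ringChar_ne_one (R := 𝓞 F ⧸ P)
      exact absurd h2 this
    · rw [← h2]; infer_instance
  let f : ZMod p →+* 𝓞 F ⧸ P := ZMod.castHom dvd_rfl _
  have hs : Function.Surjective f := by
    intro x
    have hx : x - x ^ p = 0 := by
      obtain ⟨y, rfl⟩ := Ideal.Quotient.mk_surjective x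
      have := Ideal.Quotient.eq_zero_iff_mem.2 (h y)
      simpa using this
    have h1 := Polynomial.Splits.mem_range_of_isRoot (i := f) (GaloisField.splits_zmod_X_pow_sub_X p) (FiniteField.X_pow_card_sub_X_ne_zero _ hp.one_lt) (x := x)
      (by simp [Polynomial.IsRoot, ← neg_sub x, hx])
    exact h1
  constructor
  · intro x
    obtain ⟨a, ha⟩ := hs (Ideal.Quotient.mk P x)
    obtain ⟨b, rfl⟩ := ZMod.intCast_surjective a
    refine ⟨b, ?_⟩
    rw [← Ideal.Quotient.eq_zero_iff_mem, map_sub, ← ha]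
    simp
  · have e := Nat.card_congr (Equiv.ofBijective f ⟨f.injective, hs⟩)
    rw [Nat.card_zmod] at e
    rw [e]
    rfl

theorem cheb {L : Type*} [Field L] [NumberField L] [IsGalois ℚ L] (N : Subgroup (L ≃ₐ[ℚ] L)) [hN : N.Normal]
    (E : Set ℕ) (hE : ∀ p ∈ E, p.Prime) [DecidablePred (· ∈ E)]
    (hs : Summable (fun p : ℕ => if p ∈ E then (1 / p : ℝ) else 0))
    (h : ∀ p : ℕ, p.Prime → p ∉ E → ∀ σ : L ≃ₐ[ℚ] L, IsFrob p σ → σ ∈ N) : N = ⊤ := by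
  classical
  by_contra hne
  obtain ⟨τ, hτ⟩ : ∃ τ, τ ∉ N := by
    by_contra hh; push Not at hh; exact hne ((Subgroup.eq_top_iff' N).2 hh)
  let F := IntermediateField.fixedField N
  have hfix : ∀ σ ∈ N, ∀ x : F, σ (x : L) = x := fun σ hσ x => x.2 ⟨σ, hσ⟩
  obtain ⟨α, hα⟩ : ∃ α : 𝓞 F, τ (α : F) ≠ ((α : F) : L) := by
    by_contra hh
    push Not at hh
    apply hτ
    rw [← IntermediateField.fixingSubgroup_fixedField N]
    rw [IntermediateField.mem_fixingSubgroup_iff]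
    intro x hx
    obtain ⟨a, b, hb, hab⟩ := IsFractionRing.div_surjective (A := 𝓞 F) (⟨x, hx⟩ : F)
    have h1 := congrArg (algebraMap F L) hab
    rw [map_div₀] at h1
    have h2 : x = algebraMap F L (algebraMap (𝓞 F) F a) / algebraMap F L (algebraMap (𝓞 F) F b) := h1.symm
    rw [h2, map_div₀]
    exact congrArg₂ _ (hh a) (hh b)
  let i1 : 𝓞 F →+* 𝓞 L := algebraMap (𝓞 F) (𝓞 L)
  let i2 : 𝓞 F →+* 𝓞 L := (MulSemiringAction.toRingHom (L ≃ₐ[ℚ] L) (𝓞 L) τ).comp i1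
  have hi1 : ∀ x, ((i1 x : 𝓞 L) : L) = ((x : F) : L) := fun x => rfl
  have hi2 : ∀ x, ((i2 x : 𝓞 L) : L) = τ ((x : F) : L) := fun x => rfl
  have ht : i2 α - i1 α ≠ 0 := by
    intro h0
    apply hα
    have := congrArg (fun x : 𝓞 L => (x : L)) (sub_eq_zero.1 h0)
    exact this
  have f1 : ∀ σ ∈ N, ∀ x, σ • i1 x = i1 x := fun σ hσ x => RingOfIntegers.coe_injective (hfix σ hσ x)
  have f2 : ∀ σ ∈ N, ∀ x, σ • i2 x = i2 x := fun σ hσ x => by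
    have h1 := hfix (τ⁻¹ * σ * τ) (by simpa using hN.conj_mem σ hσ τ⁻¹) x
    apply RingOfIntegers.coe_injective
    have h2 : σ (τ (x : F)) = τ ((τ⁻¹ * σ * τ) (x : F)) := by
      simp only [AlgEquiv.mul_apply]
      exact (AlgEquiv.apply_symm_apply τ _).symm
    exact h2.trans (by rw [h1]; rfl)
  obtain ⟨D, hD0, hD⟩ := bad_dvd _ ht
  choose P hP hpP using fun (p : ℕ) (hp : p.Prime) => exists_prime_over (L := L) p hp
  let PP : ℕ → Ideal (𝓞 L) := fun p => if hp : p.Prime then P p hp else ⊥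
  have key : ∀ p : ℕ, p.Prime → p ∉ E → ∀ i : 𝓞 F →+* 𝓞 L, (∀ σ ∈ N, ∀ x, σ • i x = i x) →
      ((PP p).comap i).IsPrime ∧ (∀ x : 𝓞 F, ∃ a : ℤ, x - (a : 𝓞 F) ∈ (PP p).comap i) ∧ Ideal.absNorm ((PP p).comap i) = p := by
    intro p hp hpE i hi
    have e : PP p = P p hp := dif_pos hp
    rw [e]
    have := hP p hp
    have hpr : ((P p hp).comap i).IsPrime := inferInstance
    refine ⟨hpr, prime_res p hp _ hpr ?_ ?_⟩
    · rw [Ideal.mem_comap, map_natCast]; exact hpP p hp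
    · intro x
      obtain ⟨σ, hσ⟩ := frob_exists p hp _ this (hpP p hp)
      have hσN := h p hp hpE σ ⟨_, this, hpP p hp, hσ⟩
      rw [Ideal.mem_comap, map_sub, map_pow]
      have := hσ (i x)
      rwa [hi σ hσN] at this
  refine two_primes_contra (L := F) (E ∪ {p | p.Prime ∧ p ∣ D}) ?_ ?_ (fun p => (PP p).comap i1) (fun p => (PP p).comap i2) ?_
  · rintro p (hp | hp)
    exacts [hE p hp, hp.1]
  · have hfin : Set.Finite {p | p.Prime ∧ p ∣ D} := (Set.finite_Iic D).subset (fun p hp => Nat.le_of_dvd hD0 hp.2)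
    have h2 : Summable (fun p : ℕ => if p ∈ {p | p.Prime ∧ p ∣ D} then (1 / p : ℝ) else 0) := by
      refine summable_of_hasFiniteSupport (hfin.subset ?_)
      intro p hp
      by_contra hh
      exact hp (if_neg hh)
    refine Summable.of_nonneg_of_le (fun p => ?_) (fun p => ?_) (hs.add h2)
    · split_ifs <;> positivity
    · have h0 : (0 : ℝ) ≤ 1 / p := by positivity
      by_cases a : p ∈ E <;> by_cases b : p ∈ {p | p.Prime ∧ p ∣ D} <;> simp only [a, b, Set.mem_union, if_true, if_false, true_or, or_true, or_self] <;> linarith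
  · intro p hp hpE
    simp only [Set.mem_union, not_or] at hpE
    have k1 := key p hp hpE.1 i1 f1
    have k2 := key p hp hpE.1 i2 f2
    refine ⟨k1.1, k2.1, k1.2.2, k2.2.2, fun heq => hpE.2 ⟨hp, ?_⟩⟩
    obtain ⟨a, ha⟩ := k1.2.1 α
    have ha2 : α - (a : 𝓞 F) ∈ (PP p).comap i2 := heq ▸ ha
    rw [Ideal.mem_comap, map_sub, map_intCast] at ha ha2
    have e : PP p = P p hp := dif_pos hp
    refine hD p hp (PP p) (e ▸ hP p hp) (e ▸ hpP p hp) ?_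
    simpa using (PP p).sub_mem ha2 ha

end part8

section part9
open NumberField

def oh (f : ℕ → ℂ) : Prop := ∀ ε : ℝ, 0 < ε → ∃ x0 : ℕ, ∀ x, x0 ≤ x → ‖f x‖ ≤ ε * hl x

theorem oh.add {f g : ℕ → ℂ} (hf : oh f) (hg : oh g) : oh (f + g) := by
  intro ε hε
  obtain ⟨x, hx⟩ := hf (ε / 2) (by positivity)
  obtain ⟨y, hy⟩ := hg (ε / 2) (by positivity)
  refine ⟨max x y, fun z hz => (norm_add_le _ _).trans ?_⟩
  have h1 := hx z (le_trans (le_max_left _ _) hz)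
  have h2 := hy z (le_trans (le_max_right _ _) hz)
  linarith

theorem oh.neg {f : ℕ → ℂ} (hf : oh f) : oh (-f) := by
  intro ε hε
  obtain ⟨x, hx⟩ := hf ε hε
  exact ⟨x, fun z hz => by rw [Pi.neg_apply, norm_neg]; exact hx z hz⟩

theorem hl_ge (K : ℝ) : ∃ x0 : ℕ, ∀ x, x0 ≤ x → K ≤ hl x :=
  Filter.eventually_atTop.1 (hl_tendsto.eventually_ge_atTop K)

noncomputable def Sg {L : Type*} [Field L] (ι : L →+* ℂ) (η : ℕ+ → L) (x : ℕ) : ℂ :=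
  ∑ n ∈ Finset.Ioc 0 x, ι (ex η n) / n

theorem ex_comp {L L' : Type*} [AddCommMonoid L] [AddCommMonoid L'] (σ : L →+ L') (η : ℕ+ → L) (n : ℕ) :
    ex (fun n => σ (η n)) n = σ (ex η n) := by
  rcases Nat.eq_zero_or_pos n with rfl | h
  · rw [ex_zero, ex_zero, map_zero]
  · simp [ex_pos, h]

theorem ex_mul {L : Type*} [AddCommMonoid L] (η : ℕ+ → L) (p : ℕ) (hp : 0 < p) (n : ℕ) :
    ex η (p * n) = ex (fun n => η (p.toPNat hp * n)) n := by
  rcases Nat.eq_zero_or_pos n with rfl | h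
  · rw [mul_zero, ex_zero, ex_zero]
  · rw [ex_pos _ (Nat.mul_pos hp h), ex_pos _ h]
    rfl

theorem ex_bound {L : Type*} [Field L] (ι : L →+* ℂ) (η : ℕ+ → L) (hf : (Set.range η).Finite) :
    ∃ B : ℝ, 1 ≤ B ∧ ∀ n, ‖ι (ex η n)‖ ≤ B := by
  obtain ⟨B, hB⟩ := (hf.image (fun x => ‖ι x‖)).bddAbove
  refine ⟨max B 1, le_max_right _ _, fun n => ?_⟩
  rcases Nat.eq_zero_or_pos n with rfl | h
  · rw [ex_zero]; simp
  · rw [ex_pos _ h]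
    exact (hB ⟨_, ⟨_, rfl⟩, rfl⟩).trans (le_max_left _ _)

theorem big_finset (p : ℕ → Prop) [DecidablePred p] (hs : ¬ Summable (fun n : ℕ => if p n then (1 / n : ℝ) else 0)) (M : ℕ) (W : ℝ) :
    ∃ P : Finset ℕ, (∀ n ∈ P, p n ∧ M < n) ∧ W ≤ ∑ n ∈ P, (1 / n : ℝ) := by
  by_contra hh
  push Not at hh
  apply hs
  refine summable_of_sum_le (c := W + ∑ n ∈ Finset.Iic M, (1 / n : ℝ)) (fun n => ?_) (fun u => ?_)
  · dsimp only; split_ifs <;> simp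
  · rw [← Finset.sum_filter]
    have h1 := hh ((u.filter p).filter (fun n => M < n)) (fun n hn => by simp at hn; tauto)
    have h2 : ∑ n ∈ (u.filter p).filter (fun n => ¬ M < n), (1 / n : ℝ) ≤ ∑ n ∈ Finset.Iic M, (1 / n : ℝ) := by
      refine Finset.sum_le_sum_of_subset_of_nonneg (fun n hn => ?_) (fun _ _ _ => by positivity)
      simp at hn ⊢; omega
    rw [← Finset.sum_filter_add_sum_filter_not (u.filter p) (fun n => M < n)]
    linarith

variable {L : Type*} [Field L] [NumberField L] [IsGalois ℚ L]

theorem ess_oh (ι : L →+* ℂ) (η : ℕ+ → L) (hW : IsW η) (hf : (Set.range η).Finite) (g : L ≃ₐ[ℚ] L)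
    [DecidablePred (fun p : ℕ => p.Prime ∧ IsFrob p g)]
    (hg : ¬ Summable (fun p : ℕ => if p.Prime ∧ IsFrob p g then (1 / p : ℝ) else 0)) (σ : L ≃ₐ[ℚ] L) :
    oh (Sg ι (fun n => σ (η n)) - Sg ι (fun n => (σ * g) (η n))) := by
  obtain ⟨M, hM⟩ := eta_frob η hW hf
  obtain ⟨B, hB1, hB⟩ := ex_bound ι (fun n => σ (η n)) (by
    have := hf.image σ
    rwa [← Set.range_comp] at this)
  intro ε hε
  obtain ⟨P, hP, hPW⟩ := big_finset (fun p : ℕ => p.Prime ∧ IsFrob p g) hg M (max 1 ((2 * B / ε) ^ 2))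
  obtain ⟨C, hC⟩ := tk P (fun p hp => (hP p hp).1.1)
  set W := ∑ n ∈ P, (1 / n : ℝ) with hW'
  have hW1 : 1 ≤ W := (le_max_left _ _).trans hPW
  have hW2 : 2 * B / ε ≤ √W := Real.le_sqrt_of_sq_le ((le_max_right _ _).trans hPW)
  obtain ⟨x0, hx0⟩ := hl_ge (2 * B * C / ε)
  refine ⟨x0, fun x hx => ?_⟩
  have h1 := hC 0 x (fun n => ι (ex (fun n => σ (η n)) n) / B) (fun n => by
    rw [norm_div, Complex.norm_real, Real.norm_of_nonneg (by linarith), div_le_one (by linarith)]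
    exact hB n)
  have h2 : ∑ n ∈ Finset.Ioc 0 x, ι (ex (fun n => σ (η n)) n) / B / n = Sg ι (fun n => σ (η n)) x / B := by
    rw [Sg, Finset.sum_div]
    exact Finset.sum_congr rfl fun n _ => by ring
  have h3 : ∀ p ∈ P, ∑ n ∈ Finset.Ioc 0 x, ι (ex (fun n => σ (η n)) (p * n)) / B / n = Sg ι (fun n => (σ * g) (η n)) x / B := by
    intro p hp
    rw [Sg, Finset.sum_div]
    refine Finset.sum_congr rfl fun n _ => ?_
    rw [ex_mul _ p (hP p hp).1.1.pos]
    have : (fun n => σ (η (p.toPNat (hP p hp).1.1.pos * n))) = fun n => (σ * g) (η n) := by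
      funext n
      rw [hM p (hP p hp).1.1 (hP p hp).2 g (hP p hp).1.2 n]; rfl
    rw [this]
    ring
  have h3' : ∑ p ∈ P, (1 / p : ℂ) * ∑ n ∈ Finset.Ioc 0 x, ι (ex (fun n => σ (η n)) (p * n)) / B / n
      = ∑ p ∈ P, (1 / p : ℂ) * (Sg ι (fun n => (σ * g) (η n)) x / B) :=
    Finset.sum_congr rfl (fun p hp => by rw [h3 p hp])
  rw [h2, h3', ← Finset.sum_mul, ← mul_sub, ← sub_div] at h1
  have h4 : (∑ p ∈ P, (1 / p : ℂ)) = (W : ℂ) := by rw [hW']; push_cast; rfl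
  rw [h4, norm_mul, norm_div, Complex.norm_real, Complex.norm_real, Real.norm_of_nonneg (by linarith), Real.norm_of_nonneg (by linarith)] at h1
  rw [Pi.sub_apply]
  set D := ‖Sg ι (fun n => σ (η n)) x - Sg ι (fun n => (σ * g) (η n)) x‖
  have hsq : √W * √W = W := Real.mul_self_sqrt (by linarith)
  have hs1 : 1 ≤ √W := Real.one_le_sqrt.2 hW1
  have hx1 := hx0 x hx
  rw [div_le_iff₀ hε] at hx1 hW2
  have h5 : W * D ≤ B * (√W * hl x + C) := by
    have := mul_le_mul_of_nonneg_left h1 (by linarith : 0 ≤ B)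
    calc W * D = B * (W * (D / B)) := by field_simp
      _ ≤ _ := this
  have hh := hl_nonneg x
  have h6 : 2 * B * √W * hl x ≤ W * ε * hl x := by
    have := mul_le_mul_of_nonneg_right hW2 (by positivity : 0 ≤ √W * hl x)
    calc 2 * B * √W * hl x = 2 * B * (√W * hl x) := by ring
      _ ≤ _ := this
      _ = (√W * √W) * ε * hl x := by ring
      _ = _ := by rw [hsq]
  have h7 : 2 * B * C ≤ W * ε * hl x := hx1.trans (by
    have := mul_le_mul_of_nonneg_right hW1 (by positivity : 0 ≤ ε * hl x)
    nlinarith)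
  have h8 : W * D ≤ W * (ε * hl x) := by nlinarith
  exact le_of_mul_le_mul_left h8 (by linarith)

theorem star (ι : L →+* ℂ) (η : ℕ+ → L) (hW : IsW η) (hf : (Set.range η).Finite) (g : L ≃ₐ[ℚ] L) :
    oh (Sg ι η - Sg ι (fun n => g (η n))) := by
  classical
  let S : (L ≃ₐ[ℚ] L) → ℕ → ℂ := fun σ => Sg ι (fun n => σ (η n))
  let H : Subgroup (L ≃ₐ[ℚ] L) :=
    { carrier := {g | ∀ σ, oh (S σ - S (σ * g))}
      one_mem' := fun σ ε hε => ⟨0, fun x _ => by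
        simp only [mul_one, sub_self, Pi.zero_apply, norm_zero]
        exact mul_nonneg hε.le (hl_nonneg x)⟩
      mul_mem' := fun {a b} ha hb σ => by
        have := (ha σ).add (hb (σ * a))
        rwa [sub_add_sub_cancel, mul_assoc] at this
      inv_mem' := fun {a} ha σ => by
        have := (ha (σ * a⁻¹)).neg
        rwa [neg_sub, inv_mul_cancel_right] at this }
  let ess : Set (L ≃ₐ[ℚ] L) := {g | ¬ Summable (fun p : ℕ => if p.Prime ∧ IsFrob p g then (1 / p : ℝ) else 0)}
  have h1 : Group.conjugatesOfSet ess ⊆ ess := by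
    intro x hx
    obtain ⟨a, ha, hc⟩ := Group.mem_conjugatesOfSet_iff.1 hx
    obtain ⟨c, rfl⟩ := isConj_iff.1 hc
    intro hsum
    apply ha
    convert hsum using 4 with p
    refine ⟨fun h => frob_conj h c, fun h => ?_⟩
    have := frob_conj h c⁻¹
    simpa [mul_assoc] using this
  have h2 : Subgroup.normalClosure ess ≤ H := by
    rw [Subgroup.normalClosure, Subgroup.closure_le]
    exact fun x hx σ => ess_oh ι η hW hf x (h1 hx) σ
  have h3 : Subgroup.normalClosure ess = ⊤ := by
    refine cheb _ {p | p.Prime ∧ ∃ g, g ∉ Subgroup.normalClosure ess ∧ IsFrob p g} (fun p hp => hp.1) ?_ ?_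
    · have hs : Summable (fun p : ℕ => ∑ g ∈ (Finset.univ : Finset (L ≃ₐ[ℚ] L)).filter (fun g => g ∉ Subgroup.normalClosure ess),
          if p.Prime ∧ IsFrob p g then (1 / p : ℝ) else 0) := by
        refine summable_sum fun g hg => ?_
        by_contra hh
        exact (Finset.mem_filter.1 hg).2 (Subgroup.subset_normalClosure hh)
      refine Summable.of_nonneg_of_le (fun p => ?_) (fun p => ?_) hs
      · split_ifs <;> positivity
      · have hnn : ∀ g : L ≃ₐ[ℚ] L, (0 : ℝ) ≤ if p.Prime ∧ IsFrob p g then (1 / p : ℝ) else 0 := fun g => by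
          split_ifs <;> positivity
        split_ifs with hp
        · obtain ⟨hp, g, hg, hpg⟩ := hp
          refine le_trans ?_ (Finset.single_le_sum (fun g _ => hnn g) (Finset.mem_filter.2 ⟨Finset.mem_univ g, hg⟩))
          rw [if_pos ⟨hp, hpg⟩]
        · exact Finset.sum_nonneg fun g _ => hnn g
    · intro p hp hpE σ hσ
      by_contra hh
      exact hpE ⟨hp, σ, hh, hσ⟩
  have h4 : g ∈ H := h2 (h3 ▸ Subgroup.mem_top g)
  have := h4 1
  rw [one_mul] at this
  exact this

end part9

section part10
open NumberField

abbrev Om := AlgebraicClosure ℚ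
abbrev Gam := Om ≃ₐ[ℚ] Om

instance Om_alg : Algebra.IsAlgebraic ℚ Om := by
  have h : (AlgebraicClosure.instAlgebra ℚ : Algebra ℚ Om) = DivisionRing.toRatAlgebra := Subsingleton.elim _ _
  have := AlgebraicClosure.isAlgebraic ℚ
  rwa [h] at this

instance Om_normal : Normal ℚ Om := normal_iff.2 fun x =>
  ⟨(Algebra.IsAlgebraic.isAlgebraic x).isIntegral, IsAlgClosed.splits _⟩

theorem exists_L (η : ℕ+ → Om) (hf : (Set.range η).Finite) :
    ∃ L : IntermediateField ℚ Om, FiniteDimensional ℚ L ∧ Normal ℚ L ∧ ∀ n, η n ∈ L := by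
  have h1 : FiniteDimensional ℚ (IntermediateField.adjoin ℚ (Set.range η)) := by
    have := hf.to_subtype
    exact IntermediateField.finiteDimensional_adjoin (fun x _ => (Algebra.IsAlgebraic.isAlgebraic x).isIntegral)
  refine ⟨IntermediateField.normalClosure ℚ (IntermediateField.adjoin ℚ (Set.range η)) Om, inferInstance, ?_, fun n => ?_⟩
  · have := normalClosure.normal ℚ (IntermediateField.adjoin ℚ (Set.range η)) Om
    convert this
    exact Subsingleton.elim _ _
  exact IntermediateField.le_normalClosure _ (IntermediateField.subset_adjoin _ _ ⟨n, rfl⟩)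

theorem starO (ι : Om →+* ℂ) (η : ℕ+ → Om) (hW : IsW η) (hf : (Set.range η).Finite) (g : Gam) :
    oh (Sg ι η - Sg ι (fun n => g (η n))) := by
  obtain ⟨L, h1, h2, h3⟩ := exists_L η hf
  have : NumberField L := ⟨⟩
  have : IsGalois ℚ L := ⟨⟩
  let η' : ℕ+ → L := fun n => ⟨η n, h3 n⟩
  have hf' : (Set.range η').Finite := by
    have e : Set.range η = (fun x : L => (x : Om)) '' Set.range η' := by
      rw [← Set.range_comp]; rfl
    rw [e] at hf
    exact hf.of_finite_image Subtype.val_injective.injOn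
  have hW' : IsW η' := (IsW_map (algebraMap L Om) η').1 hW
  have key := star (ι.comp (algebraMap L Om)) η' hW' hf' (g.restrictNormal L)
  have e1 : Sg (ι.comp (algebraMap L Om)) η' = Sg ι η := by
    funext x
    refine Finset.sum_congr rfl fun n _ => ?_
    rw [RingHom.comp_apply, ← AddMonoidHom.coe_coe (algebraMap L Om), ← ex_comp]; rfl
  have e2 : Sg (ι.comp (algebraMap L Om)) (fun n => g.restrictNormal L (η' n)) = Sg ι (fun n => g (η n)) := by
    funext x
    refine Finset.sum_congr rfl fun n _ => ?_
    rw [RingHom.comp_apply, ← AddMonoidHom.coe_coe (algebraMap L Om), ← ex_comp]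
    congr 3
    funext m
    exact AlgEquiv.restrictNormal_commutes g L (η' m)
  rwa [e1, e2] at key

theorem frobO (η : ℕ+ → Om) (hW : IsW η) (hf : (Set.range η).Finite) :
    ∃ M : ℕ, ∀ (p : ℕ) (hp : p.Prime), M < p → ∃ φ : Gam, ∀ n, η (p.toPNat hp.pos * n) = φ (η n) := by
  obtain ⟨L, h1, h2, h3⟩ := exists_L η hf
  have : NumberField L := ⟨⟩
  have : IsGalois ℚ L := ⟨⟩
  let η' : ℕ+ → L := fun n => ⟨η n, h3 n⟩
  have hf' : (Set.range η').Finite := by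
    have e : Set.range η = (fun x : L => (x : Om)) '' Set.range η' := by
      rw [← Set.range_comp]; rfl
    rw [e] at hf
    exact hf.of_finite_image Subtype.val_injective.injOn
  have hW' : IsW η' := (IsW_map (algebraMap L Om) η').1 hW
  obtain ⟨M, hM⟩ := eta_frob η' hW' hf'
  refine ⟨M, fun p hp hpM => ?_⟩
  obtain ⟨P, hP, hpP⟩ := exists_prime_over (L := L) p hp
  obtain ⟨σ, hσ⟩ := frob_exists p hp P hP hpP
  refine ⟨σ.liftNormal Om, fun n => ?_⟩
  have := congrArg (algebraMap L Om) (hM p hp hpM σ ⟨P, hP, hpP, hσ⟩ n)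
  rw [← AlgEquiv.liftNormal_commutes] at this
  exact this

end part10

section part11
open Finset

theorem near_root (u : ℂ) (hu : ‖u‖ = 1) (d : ℕ) (hd : 0 < d) : ∃ w : ℂ, w ^ d = 1 ∧ ‖u - w‖ ≤ 2 * ‖1 - u ^ d‖ := by
  set v := u ^ d with hv
  have hv1 : ‖v‖ = 1 := by rw [hv, norm_pow, hu, one_pow]
  have hv0 : v ≠ 0 := by rw [← norm_ne_zero_iff, hv1]; norm_num
  set t : ℝ := v.arg / d with ht
  have hd' : (d : ℝ) ≠ 0 := by positivity
  have hs : Complex.exp (Complex.I * t) ^ d = v := by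
    rw [← Complex.exp_nat_mul]
    have : (d : ℂ) * (Complex.I * t) = v.arg * Complex.I := by
      have hd2 : (d : ℂ) ≠ 0 := by exact_mod_cast hd.ne'
      rw [ht]; push_cast; field_simp
    rw [this]
    have := Complex.norm_mul_exp_arg_mul_I v
    rwa [hv1, Complex.ofReal_one, one_mul] at this
  have hsn : ‖Complex.exp (Complex.I * t)‖ = 1 := by
    rw [mul_comm]; exact Complex.norm_exp_ofReal_mul_I t
  have hs0 : Complex.exp (Complex.I * t) ≠ 0 := Complex.exp_ne_zero _
  refine ⟨u / Complex.exp (Complex.I * t), ?_, ?_⟩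
  · rw [div_pow, hs, ← hv, div_self hv0]
  · have h1 : u - u / Complex.exp (Complex.I * t) = u / Complex.exp (Complex.I * t) * (Complex.exp (Complex.I * t) - 1) := by
      field_simp
    rw [h1, norm_mul, norm_div, hu, hsn, div_one, one_mul]
    have h2 := Real.norm_exp_I_mul_ofReal_sub_one_le (x := t)
    have h3 : |t| ≤ |v.arg| := by
      rw [ht, abs_div, Nat.abs_cast]
      exact div_le_self (abs_nonneg _) (by exact_mod_cast hd)
    have h4 := Complex.angle_le_mul_norm_sub (x := 1) (y := v) (by simp) hv1
    rw [Complex.angle_one_left hv0] at h4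
    have h5 := Real.pi_le_four
    rw [Real.norm_eq_abs] at h2
    nlinarith [norm_nonneg (1 - v)]

theorem abel_geom (v : ℂ) (hv : ‖v‖ = 1) (X x : ℕ) :
    ‖1 - v‖ * ‖∑ m ∈ Ioc X x, v ^ m / m‖ ≤ 2 / (X + 1) := by
  rcases le_total x X with hxX | hxX
  · rw [Finset.Ioc_eq_empty (by omega), sum_empty]; simp; positivity
  have key : ‖∑ m ∈ Ioc X x, (v ^ m - v ^ (m + 1)) / m + v ^ (x + 1) / (x + 1)‖ ≤ 2 / (X + 1) - 1 / (x + 1) := by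
    induction x, hxX using Nat.le_induction with
    | base =>
      rw [Finset.Ioc_self, sum_empty, zero_add, norm_div, norm_pow, hv, one_pow]
      have : ‖(X + 1 : ℂ)‖ = X + 1 := by exact_mod_cast Complex.norm_natCast (X + 1)
      rw [this]; apply le_of_eq; ring
    | succ x hx ih =>
      rw [Finset.sum_Ioc_succ_top hx]
      have h1 : (x + 1 : ℂ) ≠ 0 := by exact_mod_cast Nat.succ_ne_zero x
      have h2 : (x + 1 + 1 : ℂ) ≠ 0 := by exact_mod_cast Nat.succ_ne_zero (x + 1)
      have e : ∑ m ∈ Ioc X x, (v ^ m - v ^ (m + 1)) / m + (v ^ (x + 1) - v ^ (x + 1 + 1)) / ((x + 1 : ℕ) : ℂ) + v ^ (x + 1 + 1) / (((x + 1 : ℕ) : ℂ) + 1)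
        = (∑ m ∈ Ioc X x, (v ^ m - v ^ (m + 1)) / m + v ^ (x + 1) / (x + 1)) + -(((1 / (x + 1) - 1 / (x + 1 + 1) : ℝ) : ℂ) * v ^ (x + 1 + 1)) := by
        push_cast; field_simp; ring
      rw [e]
      refine (norm_add_le _ _).trans ?_
      rw [norm_neg, norm_mul, norm_pow, hv, one_pow, mul_one, Complex.norm_real, Real.norm_of_nonneg]
      · push_cast; linarith
      · rw [sub_nonneg]; apply one_div_le_one_div_of_le <;> first | positivity | linarith
  rw [← norm_mul, mul_sum]
  have e : ∑ m ∈ Ioc X x, (1 - v) * (v ^ m / m) = (∑ m ∈ Ioc X x, (v ^ m - v ^ (m + 1)) / m + v ^ (x + 1) / (x + 1)) - v ^ (x + 1) / (x + 1) := by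
    rw [add_sub_cancel_right]
    exact sum_congr rfl fun m _ => by ring
  rw [e]
  refine (norm_sub_le _ _).trans ?_
  have : ‖v ^ (x + 1) / (x + 1)‖ = 1 / (x + 1) := by
    rw [norm_div, norm_pow, hv, one_pow]
    have : ‖(x + 1 : ℂ)‖ = x + 1 := by exact_mod_cast Complex.norm_natCast (x + 1)
    rw [this]
  linarith

/-- Bilinear estimate. -/
theorem bilin (P : Finset ℕ) (u : ℂ) (hu : ‖u‖ = 1) (X x y : ℕ) (hy : ∀ p ∈ P, p ≤ y)
    (hX : ∀ d : ℕ, 0 < d → d ≤ y → 1 ≤ (X + 1) * ‖1 - u ^ d‖) (b : ℕ → ℂ) (hb : ∀ m, ‖b m‖ ≤ 1) (W : ℝ)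
    (hW : ∑ p ∈ P, (1 / p : ℝ) ≤ W) :
    ‖∑ p ∈ P, (1 / p : ℂ) * ∑ m ∈ Ioc X x, b m * u ^ (p * m) / m‖ ≤ √W * (hl x + W) := by
  have hW0 : 0 ≤ W := (sum_nonneg fun _ _ => by positivity).trans hW
  have hh := hl_nonneg x
  let T : ℕ → ℂ := fun m => ∑ p ∈ P, (1 / p : ℂ) * u ^ (p * m)
  have e1 : ∑ p ∈ P, (1 / p : ℂ) * ∑ m ∈ Ioc X x, b m * u ^ (p * m) / m = ∑ m ∈ Ioc X x, b m / m * T m := by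
    simp only [T, mul_sum]
    rw [sum_comm]
    exact sum_congr rfl fun m _ => sum_congr rfl fun p _ => by ring
  have h1 : ‖∑ m ∈ Ioc X x, b m / m * T m‖ ≤ ∑ m ∈ Ioc X x, √(1 / m) * (√(1 / m) * ‖T m‖) := by
    refine norm_sum_le_of_le _ fun m _ => ?_
    rw [← mul_assoc, Real.mul_self_sqrt (by positivity), norm_mul, norm_div, Complex.norm_natCast]
    gcongr
    exact hb m
  have h2 := sum_mul_sq_le_sq_mul_sq (Ioc X x) (fun m : ℕ => √(1 / m : ℝ)) (fun m => √(1 / m : ℝ) * ‖T m‖)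
  have h3 : ∑ m ∈ Ioc X x, √(1 / m : ℝ) ^ 2 ≤ hl x := by
    refine (sum_le_sum_of_subset_of_nonneg (Ioc_subset_Ioc_left (Nat.zero_le X)) (fun _ _ _ => by positivity)).trans (le_of_eq ?_)
    exact sum_congr rfl fun m _ => Real.sq_sqrt (by positivity)
  have h4 : ∑ m ∈ Ioc X x, (√(1 / m : ℝ) * ‖T m‖) ^ 2 ≤ W * hl x + 2 * W ^ 2 := by
    have e : ((∑ m ∈ Ioc X x, (√(1 / m : ℝ) * ‖T m‖) ^ 2 : ℝ) : ℂ) =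
        ∑ p ∈ P, ∑ q ∈ P, (1 / p : ℂ) * (1 / q : ℂ) * ∑ m ∈ Ioc X x, (u ^ p * (starRingEnd ℂ) (u ^ q)) ^ m / m := by
      simp only [mul_sum]
      rw [sum_congr rfl fun p _ => sum_comm, sum_comm]
      push_cast
      refine sum_congr rfl fun m _ => ?_
      rw [mul_pow, ← Complex.ofReal_pow, Real.sq_sqrt (by positivity), ← Complex.mul_conj']
      simp only [T, map_sum]
      rw [sum_mul_sum]
      simp only [mul_sum]
      refine sum_congr rfl fun p _ => sum_congr rfl fun q _ => ?_
      simp only [map_mul, map_div₀, map_one, map_natCast, map_pow, pow_mul, mul_pow]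
      push_cast; ring
    have hn : ∑ m ∈ Ioc X x, (√(1 / m : ℝ) * ‖T m‖) ^ 2 = ‖((∑ m ∈ Ioc X x, (√(1 / m : ℝ) * ‖T m‖) ^ 2 : ℝ) : ℂ)‖ := by
      rw [Complex.norm_real, Real.norm_of_nonneg (sum_nonneg fun _ _ => by positivity)]
    rw [hn, e]
    calc _ ≤ ∑ p ∈ P, ∑ q ∈ P, ((if p = q then hl x * (1 / p) else 0) + (1 / p) * (1 / q) * 2 : ℝ) := by
          refine norm_sum_le_of_le _ fun p hp => norm_sum_le_of_le _ fun q hq => ?_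
          rw [norm_mul, norm_mul, norm_div, norm_div, norm_one, Complex.norm_natCast, Complex.norm_natCast]
          split_ifs with hpq
          · subst hpq
            have h6 : ‖∑ m ∈ Ioc X x, (u ^ p * (starRingEnd ℂ) (u ^ p)) ^ m / m‖ ≤ hl x := by
              refine le_trans ?_ (sum_le_sum_of_subset_of_nonneg (Ioc_subset_Ioc_left (Nat.zero_le X)) (fun _ _ _ => by positivity) : ∑ m ∈ Ioc X x, (1 / m : ℝ) ≤ _)
              refine norm_sum_le_of_le _ fun m _ => ?_
              rw [norm_div, norm_pow, norm_mul, RCLike.norm_conj, norm_pow, hu, Complex.norm_natCast]; simp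
            have hp1 : (1 / p : ℝ) * (1 / p) ≤ 1 / p := by
              have : (1 / p : ℝ) ≤ 1 := by
                rcases Nat.eq_zero_or_pos p with rfl | h
                · simp
                · rw [div_le_one (by exact_mod_cast h)]; exact_mod_cast h
              exact mul_le_of_le_one_left (by positivity) this
            have : (1 / p : ℝ) * (1 / p) * ‖∑ m ∈ Ioc X x, (u ^ p * (starRingEnd ℂ) (u ^ p)) ^ m / m‖ ≤ 1 / p * hl x :=
              mul_le_mul hp1 h6 (norm_nonneg _) (by positivity)
            have h7 : (0 : ℝ) ≤ 1 / p * (1 / p) * 2 := by positivity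
            linarith
          · rw [zero_add]
            gcongr
            set v := u ^ p * (starRingEnd ℂ) (u ^ q) with hv
            have hv1 : ‖v‖ = 1 := by rw [hv, norm_mul, RCLike.norm_conj, norm_pow, norm_pow, hu]; simp
            have hconj : ∀ n : ℕ, u ^ n * (starRingEnd ℂ) (u ^ n) = 1 := fun n => by
              rw [Complex.mul_conj', norm_pow, hu]; simp
            have h8 : 1 ≤ (X + 1) * ‖1 - v‖ := by
              rcases lt_or_gt_of_ne hpq with hlt | hlt
              · have := hX (q - p) (by omega) (by have := hy q hq; omega)
                have e2 : ‖1 - u ^ (q - p)‖ = ‖1 - v‖ := by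
                  have : 1 - v = -((starRingEnd ℂ) (u ^ q) * u ^ p * (1 - u ^ (q - p))) := by
                    rw [mul_sub, mul_one, mul_assoc, ← pow_add, Nat.add_sub_cancel' hlt.le, mul_comm _ (u ^ q), hconj, hv]
                    ring
                  rw [this, norm_neg, norm_mul, norm_mul, RCLike.norm_conj, norm_pow, norm_pow, hu]; simp
                rwa [← e2]
              · have := hX (p - q) (by omega) (by have := hy p hp; omega)
                have e2 : 1 - u ^ (p - q) = 1 - v := by
                  rw [hv]
                  nth_rw 2 [← Nat.sub_add_cancel hlt.le]
                  rw [pow_add, mul_assoc, hconj, mul_one]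
                rwa [← e2]
            have h9 := abel_geom v hv1 X x
            have hX0 : (0 : ℝ) < X + 1 := by positivity
            rw [le_div_iff₀ hX0] at h9
            have hN := norm_nonneg (∑ m ∈ Ioc X x, v ^ m / m)
            nlinarith
      _ = hl x * (∑ p ∈ P, (1 / p : ℝ)) + 2 * (∑ p ∈ P, (1 / p : ℝ)) ^ 2 := by
          simp only [sum_add_distrib, Finset.sum_ite_eq, ← sum_mul, ← mul_sum]
          rw [sum_congr rfl (fun p hp => if_pos hp), ← mul_sum]; ring
      _ ≤ W * hl x + 2 * W ^ 2 := by
          have : 0 ≤ ∑ p ∈ P, (1 / p : ℝ) := sum_nonneg fun _ _ => by positivity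
          rw [mul_comm]; gcongr
  rw [e1]
  refine h1.trans ?_
  refine abs_le_of_sq_le_sq' (h2.trans ?_) (by positivity) |>.2
  rw [mul_pow, Real.sq_sqrt hW0]
  have h5 : (∑ m ∈ Ioc X x, √(1 / m : ℝ) ^ 2) * ∑ m ∈ Ioc X x, (√(1 / m : ℝ) * ‖T m‖) ^ 2 ≤ hl x * (W * hl x + 2 * W ^ 2) :=
    mul_le_mul h3 h4 (sum_nonneg fun _ _ => by positivity) hh
  nlinarith [pow_nonneg hW0 3]

end part11

section part12
open Finset

theorem norm_S_le (a : ℕ → ℂ) (ha : ∀ n, ‖a n‖ ≤ 1) (w : ℂ) (hw : ‖w‖ ≤ 1) (x : ℕ) :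
    ‖∑ n ∈ Ioc 0 x, a n * w ^ n / n‖ ≤ hl x := by
  refine norm_sum_le_of_le _ fun n _ => ?_
  rw [norm_div, norm_mul, norm_pow, Complex.norm_natCast]
  gcongr
  exact mul_le_one₀ (ha n) (by positivity) (pow_le_one₀ (norm_nonneg _) hw)

theorem norm_pow_sub_le (u w : ℂ) (hu : ‖u‖ ≤ 1) (hw : ‖w‖ ≤ 1) (n : ℕ) : ‖u ^ n - w ^ n‖ ≤ n * ‖u - w‖ := by
  induction n with
  | zero => simp
  | succ n ih =>
    have : u ^ (n + 1) - w ^ (n + 1) = u ^ n * (u - w) + (u ^ n - w ^ n) * w := by ring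
    rw [this]
    refine (norm_add_le _ _).trans ?_
    rw [norm_mul, norm_mul, norm_pow]
    have h1 : ‖u‖ ^ n * ‖u - w‖ ≤ ‖u - w‖ := mul_le_of_le_one_left (norm_nonneg _) (pow_le_one₀ (norm_nonneg _) hu)
    have h2 : ‖u ^ n - w ^ n‖ * ‖w‖ ≤ ‖u ^ n - w ^ n‖ := mul_le_of_le_one_right (norm_nonneg _) hw
    push_cast; linarith

theorem unif (a : ℕ → ℂ) (ha : ∀ n, ‖a n‖ ≤ 1) (Bs : Finset (ℕ → ℂ)) (hBs : ∀ b ∈ Bs, ∀ m, ‖b m‖ ≤ 1) (M : ℕ)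
    (hM : ∀ p : ℕ, p.Prime → M < p → ∃ b ∈ Bs, ∀ m, a (p * m) = b m)
    (hmaj : ∀ (w : ℂ) (q : ℕ), 0 < q → w ^ q = 1 → oh (fun x => ∑ n ∈ Ioc 0 x, a n * w ^ n / n)) (ε : ℝ) (hε : 0 < ε) :
    ∃ x0 : ℕ, ∀ x, x0 ≤ x → ∀ u : ℂ, ‖u‖ = 1 → ‖∑ n ∈ Ioc 0 x, a n * u ^ n / n‖ ≤ ε * hl x := by
  classical
  have hns : ¬ Summable (fun n : ℕ => if n.Prime then (1 / n : ℝ) else 0) := by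
    have := not_summable_one_div_on_primes
    convert this using 2
    funext n
    simp [Set.indicator_apply]
  set k : ℝ := (Bs.card : ℝ)
  have hk : 0 ≤ k := by positivity
  obtain ⟨P, hP, hPW⟩ := big_finset Nat.Prime hns M (max 1 ((4 * (1 + k) / ε) ^ 2))
  obtain ⟨C, hC⟩ := tk P (fun p hp => (hP p hp).1)
  set W := ∑ n ∈ P, (1 / n : ℝ) with hW'
  have hW1 : 1 ≤ W := (le_max_left _ _).trans hPW
  have hW2 : 4 * (1 + k) / ε ≤ √W := Real.le_sqrt_of_sq_le ((le_max_right _ _).trans hPW)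
  set y := P.sup id + 1 with hy
  have hyP : ∀ p ∈ P, p ≤ y := fun p hp => (Finset.le_sup (f := id) hp).trans (Nat.le_succ _)
  set R : Finset ℂ := (Polynomial.nthRoots (y.factorial) (1 : ℂ)).toFinset
  have hR : ∀ w, w ∈ R ↔ w ^ y.factorial = 1 := fun w => by
    rw [Multiset.mem_toFinset, Polynomial.mem_nthRoots (Nat.factorial_pos y)]
  have hRn : ∀ w ∈ R, ‖w‖ = 1 := fun w hw => by
    exact Complex.norm_eq_one_of_pow_eq_one ((hR w).1 hw) (Nat.factorial_ne_zero y)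
  choose xw hxw using fun (w : ℂ) (hw : w ∈ R) => hmaj w y.factorial (Nat.factorial_pos y) ((hR w).1 hw) (ε / 4) (by positivity)
  set K : ℝ := ∑ w ∈ R.attach, hl (xw w.1 w.2)
  have hK : ∀ w ∈ R, ∀ x, ‖∑ n ∈ Ioc 0 x, a n * w ^ n / n‖ ≤ ε / 4 * hl x + K := by
    intro w hw x
    have h1 : hl (xw w hw) ≤ K := Finset.single_le_sum (f := fun w : {w // w ∈ R} => hl (xw w.1 w.2)) (fun _ _ => hl_nonneg _) (Finset.mem_attach R ⟨w, hw⟩)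
    have h2 := hl_nonneg x
    rcases le_total (xw w hw) x with h | h
    · have := hxw w hw x h
      have h0 := hl_nonneg (xw w hw)
      linarith
    · have := norm_S_le a ha w (hRn w hw).le x
      have h3 := hl_mono h
      have : 0 ≤ ε / 4 * hl x := by positivity
      linarith
  obtain ⟨x0, hx0⟩ := hl_ge (4 * (K + 2 + |C| + k * √W) / ε)
  refine ⟨x0, fun x hx u hu => ?_⟩
  have hh := hl_nonneg x
  obtain ⟨d, hd, hdmin⟩ := Finset.exists_min_image (Icc 1 y) (fun d => ‖1 - u ^ d‖) ⟨1, by simp [hy]⟩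
  rw [mem_Icc] at hd
  set δ := ‖1 - u ^ d‖
  have hδ : 0 ≤ δ := norm_nonneg _
  obtain ⟨X, hXx, hX1, hX2⟩ : ∃ X : ℕ, X ≤ x ∧ X * δ ≤ 1 ∧ (X = x ∨ 1 ≤ (X + 1) * δ) := by
    rcases hδ.eq_or_lt with h0 | h0
    · exact ⟨x, le_rfl, by rw [← h0]; simp, Or.inl rfl⟩
    · rcases le_total x ⌊1 / δ⌋₊ with h | h
      · refine ⟨x, le_rfl, ?_, Or.inl rfl⟩
        rw [← le_div_iff₀ h0]
        exact (Nat.le_floor_iff (by positivity)).1 h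
      · refine ⟨_, h, ?_, Or.inr ?_⟩
        · rw [← le_div_iff₀ h0]
          exact Nat.floor_le (by positivity)
        · rw [← div_le_iff₀ h0]
          exact (Nat.lt_floor_add_one _).le
  have part1 : ‖∑ n ∈ Ioc 0 X, a n * u ^ n / n‖ ≤ ε / 4 * hl x + K + 2 := by
    obtain ⟨w, hwd, huw⟩ := near_root u hu d hd.1
    have hwR : w ∈ R := by
      rw [hR]
      obtain ⟨c, hc⟩ := Nat.dvd_factorial hd.1 hd.2
      rw [hc, pow_mul, hwd, one_pow]
    have e : ∑ n ∈ Ioc 0 X, a n * u ^ n / n = ∑ n ∈ Ioc 0 X, a n * w ^ n / n + ∑ n ∈ Ioc 0 X, a n * (u ^ n - w ^ n) / n := by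
      rw [← sum_add_distrib]; exact sum_congr rfl fun n _ => by ring
    rw [e]
    have h1 : ‖∑ n ∈ Ioc 0 X, a n * (u ^ n - w ^ n) / n‖ ≤ ∑ n ∈ Ioc 0 X, 2 * δ := by
      refine norm_sum_le_of_le _ fun n hn => ?_
      have hn0 : (0 : ℝ) < n := by exact_mod_cast (mem_Ioc.1 hn).1
      rw [norm_div, norm_mul, Complex.norm_natCast, div_le_iff₀ hn0]
      have := norm_pow_sub_le u w hu.le (hRn w hwR).le n
      calc ‖a n‖ * ‖u ^ n - w ^ n‖ ≤ 1 * (n * (2 * δ)) := by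
            refine mul_le_mul (ha n) (this.trans ?_) (norm_nonneg _) zero_le_one
            gcongr
        _ = _ := by ring
    rw [sum_const, Nat.card_Ioc, nsmul_eq_mul, Nat.sub_zero] at h1
    have h2 := hK w hwR X
    have h3 := mul_le_mul_of_nonneg_left (hl_mono hXx) (by positivity : 0 ≤ ε / 4)
    refine (norm_add_le _ _).trans ?_
    linarith
  have part2 : W * ‖∑ n ∈ Ioc X x, a n * u ^ n / n‖ ≤ √W * hl x + |C| + k * (√W * (hl x + W)) := by
    rcases hX2 with rfl | hX2
    · rw [Ioc_self, sum_empty, norm_zero, mul_zero]; positivity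
    choose! f hfB hf using fun (p : ℕ) (hp : p ∈ P) => hM p (hP p hp).1 (hP p hp).2
    have h1 := hC X x (fun n => a n * u ^ n) (fun n => by rw [norm_mul, norm_pow, hu, one_pow, mul_one]; exact ha n)
    have h2 : ‖∑ p ∈ P, (1 / p : ℂ) * ∑ m ∈ Ioc X x, a (p * m) * u ^ (p * m) / m‖ ≤ k * (√W * (hl x + W)) := by
      rw [← Finset.sum_fiberwise_of_maps_to (t := Bs) (g := f) hfB]
      refine (norm_sum_le_of_le (f := fun b => ∑ p ∈ P.filter (fun p => f p = b), (1 / p : ℂ) * ∑ m ∈ Ioc X x, a (p * m) * u ^ (p * m) / m)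
        _ (n := fun _ => √W * (hl x + W)) fun b hb => ?_).trans ?_
      · have e : ∑ p ∈ P.filter (fun p => f p = b), (1 / p : ℂ) * ∑ m ∈ Ioc X x, a (p * m) * u ^ (p * m) / m =
          ∑ p ∈ P.filter (fun p => f p = b), (1 / p : ℂ) * ∑ m ∈ Ioc X x, b m * u ^ (p * m) / m := by
          refine sum_congr rfl fun p hp => ?_
          obtain ⟨hp1, rfl⟩ := mem_filter.1 hp
          simp only [hf p hp1]
        rw [e]
        refine bilin _ u hu X x y (fun p hp => hyP p (mem_filter.1 hp).1) (fun d' h1 h2 => ?_) b (hBs b hb) W ?_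
        · have := hdmin d' (mem_Icc.2 ⟨h1, h2⟩)
          exact hX2.trans (mul_le_mul_of_nonneg_left this (by positivity))
        · exact sum_le_sum_of_subset_of_nonneg (filter_subset _ _) (fun _ _ _ => by positivity)
      · rw [sum_const, nsmul_eq_mul]
    have h4 : (∑ p ∈ P, (1 / p : ℂ)) = (W : ℂ) := by rw [hW']; push_cast; rfl
    rw [h4] at h1
    have h5 : ‖(W : ℂ) * ∑ n ∈ Ioc X x, a n * u ^ n / n‖ ≤ _ :=
      (norm_le_norm_add_norm_sub' _ (∑ p ∈ P, (1 / p : ℂ) * ∑ m ∈ Ioc X x, a (p * m) * u ^ (p * m) / m)).trans (add_le_add h2 h1)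
    rw [norm_mul, Complex.norm_real, Real.norm_of_nonneg (by linarith)] at h5
    have := le_abs_self C
    linarith
  have hsq : √W * √W = W := Real.mul_self_sqrt (by linarith)
  have hs1 : 1 ≤ √W := Real.one_le_sqrt.2 hW1
  have hx1 := hx0 x hx
  rw [div_le_iff₀ hε] at hx1 hW2
  have part2' : ‖∑ n ∈ Ioc X x, a n * u ^ n / n‖ ≤ ε / 4 * hl x + |C| + k * √W := by
    have h1 : √W * hl x + |C| + k * (√W * (hl x + W)) ≤ W * (ε / 4 * hl x + |C| + k * √W) := by
      have a1 : |C| ≤ W * |C| := le_mul_of_one_le_left (abs_nonneg _) hW1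
      have a2 : (4 * (1 + k)) * (√W * hl x) ≤ √W * ε * (√W * hl x) := mul_le_mul_of_nonneg_right hW2 (by positivity)
      have a3 : √W * ε * (√W * hl x) = W * ε * hl x := by rw [← hsq]; ring_nf; rw [Real.sq_sqrt (by linarith)]
      nlinarith
    exact le_of_mul_le_mul_left (part2.trans h1) (by linarith)
  rw [← Finset.sum_Ioc_consecutive _ (Nat.zero_le X) hXx]
  refine (norm_add_le _ _).trans ?_
  have h0 : 0 ≤ ε * hl x := by positivity
  linarith

end part12

section part13
open Finset

theorem orbit_finite (ν : ℕ+ → Om) (hf : (Set.range ν).Finite) :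
    (Set.range (fun φ : Gam => fun n => φ (ν n))).Finite := by
  obtain ⟨L, h1, h2, h3⟩ := exists_L ν hf
  refine (Set.finite_range (fun s : L ≃ₐ[ℚ] L => fun n => ((s ⟨ν n, h3 n⟩ : L) : Om))).subset ?_
  rintro _ ⟨φ, rfl⟩
  refine ⟨φ.restrictNormal L, funext fun n => ?_⟩
  exact AlgEquiv.restrictNormal_commutes φ L ⟨ν n, h3 n⟩

theorem IsW.alg {ξ : ℕ+ → Om} (h : IsW ξ) (g : Gam) : IsW (fun n => g (ξ n)) :=
  (IsW_map (g : Om →+* Om) ξ).2 h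

theorem range_alg {ξ : ℕ+ → Om} (h : (Set.range ξ).Finite) (g : Gam) : (Set.range (fun n => g (ξ n))).Finite := by
  have := h.image g
  rwa [← Set.range_comp] at this

theorem range_op {A : Type*} {f g : ℕ+ → A} (op : A → A → A) (hf : (Set.range f).Finite) (hg : (Set.range g).Finite) :
    (Set.range (fun n => op (f n) (g n))).Finite := by
  refine ((hf.prod hg).image (fun x => op x.1 x.2)).subset ?_
  rintro _ ⟨n, rfl⟩
  exact ⟨(f n, g n), ⟨⟨n, rfl⟩, ⟨n, rfl⟩⟩, rfl⟩

theorem uniO (ι : Om →+* ℂ) (ξ : ℕ+ → Om) (hW : IsW ξ) (hf : (Set.range ξ).Finite) (h : Gam)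
    (hh : ∀ (z : Om) (q : ℕ), 0 < q → z ^ q = 1 → h z = z) (ε : ℝ) (hε : 0 < ε) :
    ∃ x0 : ℕ, ∀ x, x0 ≤ x → ∀ u : ℂ, ‖u‖ = 1 →
      ‖∑ n ∈ Ioc 0 x, ι (ex (fun n => ξ n - h (ξ n)) n) * u ^ n / n‖ ≤ ε * hl x := by
  classical
  set ν : ℕ+ → Om := fun n => ξ n - h (ξ n) with hν
  have hνW : IsW ν := hW.sub (hW.alg h)
  have hνf : (Set.range ν).Finite := range_op (fun a b => a - b) hf (range_alg hf h)
  have hor := orbit_finite ν hνf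
  have hV : (⋃ f ∈ Set.range (fun φ : Gam => fun n => φ (ν n)), Set.range f).Finite := by
    refine hor.biUnion ?_
    rintro _ ⟨φ, rfl⟩
    exact range_alg hνf φ
  obtain ⟨B0, hB0⟩ := (hV.image (fun x => ‖ι x‖)).bddAbove
  set B := max B0 1
  have hB1 : 1 ≤ B := le_max_right _ _
  have hB : ∀ (φ : Gam) (n : ℕ), ‖ι (ex (fun n => φ (ν n)) n)‖ ≤ B := by
    intro φ n
    rcases Nat.eq_zero_or_pos n with rfl | hn
    · rw [ex_zero, map_zero, norm_zero]; linarith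
    · rw [ex_pos _ hn]
      refine le_trans (hB0 ⟨_, ?_, rfl⟩) (le_max_left _ _)
      exact Set.mem_biUnion ⟨φ, rfl⟩ ⟨_, rfl⟩
  obtain ⟨M, hM⟩ := frobO ν hνW hνf
  have hBfin : (Set.range (fun φ : Gam => fun m : ℕ => ι (ex (fun n => φ (ν n)) m) / B)).Finite := by
    refine (hor.image (fun f => fun m : ℕ => ι (ex f m) / B)).subset ?_
    rintro _ ⟨φ, rfl⟩
    exact ⟨_, ⟨φ, rfl⟩, rfl⟩
  have hnorm : ∀ z : ℂ, ‖z‖ ≤ B → ‖z / B‖ ≤ 1 := fun z hz => by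
    rw [norm_div, Complex.norm_real, Real.norm_of_nonneg (by linarith), div_le_one (by linarith)]; exact hz
  have hmaj : ∀ (w : ℂ) (q : ℕ), 0 < q → w ^ q = 1 → oh (fun x => ∑ n ∈ Ioc 0 x, ι (ex ν n) / B * w ^ n / n) := by
    intro w q hq hw
    obtain ⟨z, rfl⟩ : w ∈ ι.range := by
      refine Polynomial.Splits.mem_range_of_isRoot (f := Polynomial.X ^ q - 1) (IsAlgClosed.splits _) ?_ ?_
      · exact Polynomial.X_pow_sub_C_ne_zero hq 1
      · simp [hw]
    have hz : z ^ q = 1 := ι.injective (by rw [map_pow, hw, map_one])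
    let Z : ℕ+ → Om := fun n => z ^ (n : ℕ)
    have hZW : IsW Z := by
      refine IsW.char (fun n => ?_) (fun p hp n => ?_)
      · refine IsIntegral.of_pow hq ?_
        rw [← pow_mul, mul_comm, pow_mul, hz, one_pow]
        exact isIntegral_one
      · have : z ^ (p * (n : ℕ)) = (z ^ (n : ℕ)) ^ p := by rw [mul_comm, pow_mul]
        exact this
    have hZf : (Set.range Z).Finite := by
      refine (Finset.finite_toSet (Polynomial.nthRoots q (1 : Om)).toFinset).subset ?_
      rintro _ ⟨n, rfl⟩
      simp only [Finset.mem_coe, Multiset.mem_toFinset, Polynomial.mem_nthRoots hq, Z]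
      rw [← pow_mul, mul_comm, pow_mul, hz, one_pow]
    have key := starO ι (ξ * Z) (hW.mul hZW) (range_op (fun a b => a * b) hf hZf) h
    intro ε hε
    obtain ⟨x0, hx0⟩ := key ε hε
    refine ⟨x0, fun x hx => ?_⟩
    have e : ∑ n ∈ Ioc 0 x, ι (ex ν n) / B * (ι z) ^ n / n = (Sg ι (ξ * Z) - Sg ι (fun n => h ((ξ * Z) n))) x / B := by
      rw [Pi.sub_apply, Sg, Sg, ← sum_sub_distrib, sum_div]
      refine sum_congr rfl fun n hn => ?_
      have hn0 := (mem_Ioc.1 hn).1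
      rw [ex_pos _ hn0, ex_pos _ hn0, ex_pos _ hn0]
      simp only [ν, Pi.mul_apply, map_mul, map_sub, Z, map_pow, hh z q hq hz]
      have : ((n.toPNat hn0 : ℕ+) : ℕ) = n := rfl
      rw [this]
      ring
    show ‖∑ n ∈ Ioc 0 x, ι (ex ν n) / B * (ι z) ^ n / n‖ ≤ ε * hl x
    rw [e, norm_div, Complex.norm_real, Real.norm_of_nonneg (by linarith)]
    exact (div_le_self (norm_nonneg _) hB1).trans (hx0 x hx)
  have := unif (fun n => ι (ex ν n) / B) (fun n => hnorm _ (by simpa using hB 1 n)) hBfin.toFinset ?_ M ?_ hmaj (ε / B) (by positivity)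
  · obtain ⟨x0, hx0⟩ := this
    refine ⟨x0, fun x hx u hu => ?_⟩
    have h1 := hx0 x hx u hu
    have e : ∑ n ∈ Ioc 0 x, ι (ex ν n) / B * u ^ n / n = (∑ n ∈ Ioc 0 x, ι (ex ν n) * u ^ n / n) / B := by
      rw [sum_div]; exact sum_congr rfl fun n _ => by ring
    rw [e, norm_div, Complex.norm_real, Real.norm_of_nonneg (by linarith), div_le_iff₀ (by linarith)] at h1
    refine h1.trans (le_of_eq ?_)
    field_simp
  · intro b hb m
    rw [Set.Finite.mem_toFinset] at hb
    obtain ⟨φ, rfl⟩ := hb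
    exact hnorm _ (hB φ m)
  · intro p hp hpM
    obtain ⟨φ, hφ⟩ := hM p hp hpM
    refine ⟨fun m : ℕ => ι (ex (fun n => φ (ν n)) m) / B, ?_, fun m => ?_⟩
    · rw [Set.Finite.mem_toFinset]; exact ⟨φ, rfl⟩
    · rw [ex_mul _ p hp.pos]
      congr 4
      funext n; exact hφ n

end part13

section part14
open Finset

noncomputable def GJ (f : Polynomial ℂ) (J : ℕ) : Polynomial ℂ :=
  ∑ j ∈ range (J+1), Polynomial.C (1 / (j.factorial : ℂ)) * f ^ j

lemma GJ_deriv (f : Polynomial ℂ) (J : ℕ) :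
    Polynomial.derivative (GJ f (J+1)) = Polynomial.derivative f * GJ f J := by
  unfold GJ
  rw [Polynomial.derivative_sum, sum_range_succ', mul_sum]
  simp only [pow_zero, mul_one, Polynomial.derivative_C, add_zero]
  refine sum_congr rfl fun j _ => ?_
  rw [Polynomial.derivative_C_mul, Polynomial.derivative_pow, Nat.factorial_succ]
  simp only [add_tsub_cancel_right]
  have : (Polynomial.C (1 / (((j+1) * j.factorial : ℕ) : ℂ))) * Polynomial.C (((j+1 : ℕ) : ℂ)) = Polynomial.C (1 / (j.factorial : ℂ)) := by
    rw [← Polynomial.C_mul]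
    congr 1
    have : (j.factorial : ℂ) ≠ 0 := by exact_mod_cast j.factorial_ne_zero
    have h2 : ((j : ℂ) + 1) ≠ 0 := by exact_mod_cast j.succ_ne_zero
    push_cast
    field_simp
  rw [← this]
  ring

lemma GJ_coeff (a c : ℕ → ℂ) (ha : a 0 = 0) (hc : c 0 = 1)
    (hr : ∀ n, n * c n = ∑ ij ∈ HasAntidiagonal.antidiagonal n, c ij.1 * a ij.2) (k : ℕ) (f : Polynomial ℂ)
    (hf : ∀ n ≤ k, n * f.coeff n = a n) (hf0 : f.coeff 0 = 0) :
    ∀ n, n ≤ k → ∀ J, n ≤ J → (GJ f J).coeff n = c n := by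
  intro n
  induction n using Nat.strong_induction_on with
  | _ n ih =>
    intro hn J hJ
    cases n with
    | zero =>
      rw [hc, Polynomial.coeff_zero_eq_eval_zero]
      rw [Polynomial.coeff_zero_eq_eval_zero] at hf0
      simp [GJ, Polynomial.eval_finsetSum, hf0, sum_range_succ']
    | succ n =>
      obtain ⟨J, rfl⟩ : ∃ J', J = J' + 1 := ⟨J - 1, by omega⟩
      have h1 := congrArg (fun q => Polynomial.coeff q n) (GJ_deriv f J)
      simp only [Polynomial.coeff_derivative, Polynomial.coeff_mul] at h1
      have h2 := hr (n+1)
      rw [Nat.antidiagonal_succ'] at h2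
      simp only [sum_cons, ha, mul_zero, zero_add, sum_map, Function.Embedding.prodMap,
        Function.Embedding.coeFn_mk, Prod.map, Function.Embedding.refl_apply] at h2
      have h3 : ((n:ℂ)+1) * (GJ f (J+1)).coeff (n+1) = ((n:ℂ)+1) * c (n+1) := by
        rw [mul_comm, h1]
        push_cast at h2
        rw [h2, ← Nat.sum_antidiagonal_swap]
        refine sum_congr rfl fun x hx => ?_
        have hx' := mem_antidiagonal.1 hx
        simp only [Prod.fst_swap, Prod.snd_swap]
        rw [ih x.1 (by omega) (by omega) J (by omega), mul_comm]
        congr 1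
        rw [Nat.succ_eq_add_one, ← hf (x.2+1) (by omega)]
        push_cast; ring
      exact mul_left_cancel₀ (by exact_mod_cast n.succ_ne_zero) h3

lemma parseval_bound (a c : ℕ → ℂ) (ha : a 0 = 0) (hc : c 0 = 1)
    (hr : ∀ n, n * c n = ∑ ij ∈ HasAntidiagonal.antidiagonal n, c ij.1 * a ij.2) (k : ℕ) (R : ℝ)
    (hR : ∀ u : ℂ, ‖u‖ = 1 → ‖∑ n ∈ Ioc 0 k, a n * u ^ n / n‖ ≤ R) :
    ∑ n ∈ range (k+1), ‖c n‖ ^ 2 ≤ Real.exp (2 * R) := by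
  let f : Polynomial ℂ := ∑ n ∈ Ioc 0 k, Polynomial.monomial n (a n / n)
  have hfc : ∀ m, f.coeff m = if m ∈ Ioc 0 k then a m / m else 0 := fun m => by
    simp only [f, Polynomial.finsetSum_coeff, Polynomial.coeff_monomial]
    rw [sum_ite_eq' ]
  have hf0 : f.coeff 0 = 0 := by rw [hfc]; simp
  have hf : ∀ n ≤ k, n * f.coeff n = a n := fun n hn => by
    rcases Nat.eq_zero_or_pos n with rfl | h
    · simp [ha]
    · rw [hfc, if_pos (mem_Ioc.2 ⟨h, hn⟩)]
      have : (n : ℂ) ≠ 0 := by exact_mod_cast h.ne'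
      field_simp
  have hG := GJ_coeff a c ha hc hr k f hf hf0
  have hE : ∀ u : ℂ, ‖u‖ = 1 → ‖(GJ f k).eval u‖ ≤ Real.exp R := fun u hu => by
    have h1 : ‖f.eval u‖ ≤ R := by
      have := hR u hu
      convert this using 2
      simp only [f, Polynomial.eval_finsetSum, Polynomial.eval_monomial]
      exact sum_congr rfl fun n _ => by ring
    have h0 : 0 ≤ R := (norm_nonneg _).trans h1
    unfold GJ
    rw [Polynomial.eval_finsetSum]
    refine (norm_sum_le _ _).trans ?_
    refine le_trans ?_ (Real.sum_le_exp_of_nonneg h0 (k+1))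
    refine sum_le_sum fun j _ => ?_
    rw [Polynomial.eval_mul, Polynomial.eval_C, Polynomial.eval_pow, norm_mul, norm_pow, norm_div, norm_one, Complex.norm_natCast, one_div, mul_comm, ← div_eq_mul_inv]
    gcongr
  have hP := (GJ f k).sum_sq_norm_coeff_eq_circleAverage
  have : ∑ n ∈ range (k+1), ‖c n‖ ^ 2 ≤ ∑ i ∈ (GJ f k).support, ‖(GJ f k).coeff i‖ ^ 2 := by
    have e : ∑ n ∈ range (k+1), ‖c n‖ ^ 2 = ∑ n ∈ range (k+1), ‖(GJ f k).coeff n‖ ^ 2 :=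
      sum_congr rfl fun n hn => by
        have := mem_range.1 hn
        rw [hG n (by omega) k (by omega)]
    rw [e, ← sum_filter_ne_zero]
    refine sum_le_sum_of_subset_of_nonneg (fun x hx => ?_) (fun _ _ _ => by positivity)
    rw [Polynomial.mem_support_iff]
    intro h; apply (mem_filter.1 hx).2; simp [h]
  refine this.trans ?_
  rw [hP]
  refine Real.circleAverage_mono_on_of_le_circle ?_ ?_
  · refine ContinuousOn.circleIntegrable' ?_
    fun_prop
  · intro u hu
    have hu : ‖u‖ = 1 := by simpa using hu
    calc ‖(GJ f k).eval u‖ ^ 2 ≤ Real.exp R ^ 2 := by gcongr; exact hE u hu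
      _ = _ := by rw [← Real.exp_nat_mul]; norm_num

end part14

section part15
open Finset

lemma exists_big (ι : Om →+* ℂ) (L : IntermediateField ℚ Om) [FiniteDimensional ℚ L] [Normal ℚ L] :
    ∃ S : Finset Gam, ∀ z ∈ L, z ≠ 0 → IsIntegral ℤ z → ∃ φ ∈ S, 1 ≤ ‖ι (φ z)‖ := by
  classical
  have : IsGalois ℚ L := { }
  refine ⟨(Finset.univ : Finset (L ≃ₐ[ℚ] L)).image (fun σ => σ.liftNormal Om), fun z hz h0 hi => ?_⟩
  by_contra hcon
  push Not at hcon
  let z' : L := ⟨z, hz⟩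
  have hz'i : IsIntegral ℤ z' := by
    have : IsIntegral ℤ (algebraMap L Om z') := hi
    exact (isIntegral_algHom_iff ((algebraMap L Om).toIntAlgHom) (algebraMap L Om).injective).1 this
  have hN : IsIntegral ℤ (Algebra.norm ℚ z') := Algebra.isIntegral_norm ℚ hz'i
  obtain ⟨m, hm⟩ := IsIntegrallyClosed.isIntegral_iff.1 hN
  have hN0 : Algebra.norm ℚ z' ≠ 0 := by
    rw [Ne, Algebra.norm_eq_zero_iff]
    intro h; exact h0 (congrArg Subtype.val h)
  have hm0 : m ≠ 0 := by rintro rfl; exact hN0 (by rw [← hm]; simp)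
  have h1 := Algebra.norm_eq_prod_automorphisms ℚ z'
  have h2 : ((m : ℤ) : ℂ) = ∏ σ : L ≃ₐ[ℚ] L, ι (σ.liftNormal Om z) := by
    have := congrArg (fun t : L => ι (algebraMap L Om t)) h1
    simp only [map_prod] at this
    rw [← hm] at this
    have e : ∀ σ : L ≃ₐ[ℚ] L, algebraMap L Om (σ z') = σ.liftNormal Om z := fun σ =>
      (AlgEquiv.liftNormal_commutes σ Om z').symm
    simp only [e] at this
    rw [← this]
    simp
  have h3 : ‖((m : ℤ) : ℂ)‖ < 1 := by
    rw [h2, norm_prod]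
    have := Finset.prod_lt_prod_of_nonempty (s := (Finset.univ : Finset (L ≃ₐ[ℚ] L)))
      (f := fun σ => ‖ι (σ.liftNormal Om z)‖) (g := fun _ => (1:ℝ)) (fun σ _ => ?_) (fun σ _ => ?_) ⟨1, mem_univ _⟩
    · simpa using this
    · simpa using h0
    · exact hcon _ (mem_image_of_mem _ (mem_univ σ))
  rw [Complex.norm_intCast] at h3
  have : (1:ℤ) ≤ |m| := Int.one_le_abs hm0
  have : (1:ℝ) ≤ |(m:ℝ)| := by exact_mod_cast this
  linarith

open Classical in
lemma sparse (ι : Om →+* ℂ) (L : IntermediateField ℚ Om) [FiniteDimensional ℚ L] [Normal ℚ L]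
    (a p : ℕ → Om) (ha0 : a 0 = 0) (haL : ∀ n, a n ∈ L) (hp0 : p 0 = 1) (hpi : ∀ n, IsIntegral ℤ (p n))
    (hr : ∀ n : ℕ, n * p n = ∑ ij ∈ HasAntidiagonal.antidiagonal n, p ij.1 * a ij.2)
    (hu : ∀ φ : Gam, ∀ ε > 0, ∃ x0 : ℕ, ∀ x, x0 ≤ x → ∀ u : ℂ, ‖u‖ = 1 →
      ‖∑ n ∈ Ioc 0 x, ι (φ (a n)) * u ^ n / n‖ ≤ ε * hl x) (ε : ℝ) (hε : 0 < ε) :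
    ∃ C : ℝ, 0 ≤ C ∧ ∃ x0 : ℕ, ∀ k, x0 ≤ k →
      (((range (k+1)).filter (fun n => p n ≠ 0)).card : ℝ) ≤ C * Real.exp (ε * hl k) := by
  have hpL : ∀ n, p n ∈ L := by
    intro n
    induction n using Nat.strong_induction_on with
    | _ n ih =>
      rcases Nat.eq_zero_or_pos n with rfl | hn
      · rw [hp0]; exact one_mem L
      · have h1 : (n : Om) * p n ∈ L := by
          rw [hr n]
          refine sum_mem fun ij hij => ?_
          have hij := mem_antidiagonal.1 hij
          rcases Nat.eq_zero_or_pos ij.2 with h | h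
          · rw [h, ha0, mul_zero]; exact zero_mem L
          · exact mul_mem (ih _ (by omega)) (haL _)
        have hn0 : (n : Om) ≠ 0 := by exact_mod_cast hn.ne'
        have : p n = (n : Om)⁻¹ * (n * p n) := by field_simp
        rw [this]
        exact mul_mem (inv_mem (natCast_mem L n)) h1
  obtain ⟨S, hS⟩ := exists_big ι L
  choose x0 hx0 using fun φ => hu φ (ε/2) (by positivity)
  refine ⟨S.card, by positivity, S.sup x0, fun k hk => ?_⟩
  have hb : ∀ φ ∈ S, ∑ n ∈ range (k+1), ‖ι (φ (p n))‖ ^ 2 ≤ Real.exp (ε * hl k) := fun φ hφ => by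
    have := parseval_bound (fun n => ι (φ (a n))) (fun n => ι (φ (p n))) (by simp [ha0]) (by simp [hp0]) ?_ k (ε/2 * hl k)
      (fun u hu => hx0 φ k ((Finset.le_sup hφ).trans hk) u hu)
    · refine this.trans (le_of_eq ?_)
      congr 1; ring
    · intro n
      have := congrArg (fun t => ι (φ t)) (hr n)
      simpa using this
  calc (((range (k+1)).filter (fun n => p n ≠ 0)).card : ℝ) = ∑ n ∈ (range (k+1)).filter (fun n => p n ≠ 0), (1:ℝ) := by simp
    _ ≤ ∑ n ∈ (range (k+1)).filter (fun n => p n ≠ 0), ∑ φ ∈ S, ‖ι (φ (p n))‖ ^ 2 := by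
        refine sum_le_sum fun n hn => ?_
        obtain ⟨φ, hφ, h1⟩ := hS (p n) (hpL n) (mem_filter.1 hn).2 (hpi n)
        refine le_trans ?_ (single_le_sum (f := fun φ : Gam => ‖ι (φ (p n))‖ ^ 2) (fun _ _ => by positivity) hφ)
        exact one_le_pow₀ h1
    _ ≤ ∑ n ∈ range (k+1), ∑ φ ∈ S, ‖ι (φ (p n))‖ ^ 2 :=
        sum_le_sum_of_subset_of_nonneg (filter_subset _ _) (fun _ _ _ => sum_nonneg fun _ _ => by positivity)
    _ = ∑ φ ∈ S, ∑ n ∈ range (k+1), ‖ι (φ (p n))‖ ^ 2 := sum_comm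
    _ ≤ ∑ φ ∈ S, Real.exp (ε * hl k) := sum_le_sum hb
    _ = _ := by simp

lemma frob_ne (ν : ℕ+ → Om) (M : ℕ) (hM : ∀ (p : ℕ) (hp : p.Prime), M < p → ∃ φ : Gam, ∀ n, ν (p.toPNat hp.pos * n) = φ (ν n))
    (m : ℕ+) (hm : ν m ≠ 0) (n : ℕ) : ∀ hn : 0 < n, (∀ p : ℕ, p.Prime → p ∣ n → M < p) → ν (n.toPNat hn * m) ≠ 0 := by
  induction n using induction_on_primes with
  | zero => intro hn; omega
  | one => intro hn _; 
           have : Nat.toPNat 1 hn = 1 := rfl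
           rwa [this, one_mul]
  | prime_mul p a hp ih =>
    intro hn h
    have ha : 0 < a := Nat.pos_of_mul_pos_left hn
    have h1 := ih ha (fun q hq hqa => h q hq (hqa.mul_left p))
    obtain ⟨φ, hφ⟩ := hM p hp (h p hp (dvd_mul_right _ _))
    have e : Nat.toPNat (p * a) hn * m = p.toPNat hp.pos * (a.toPNat ha * m) := by
      rw [← mul_assoc]; rfl
    rw [e, hφ]
    simpa using h1

theorem fix_cyc (ι : Om →+* ℂ) (ξ : ℕ+ → Om) (hW : IsW ξ) (hf : (Set.range ξ).Finite) (h : Gam)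
    (hh : ∀ (z : Om) (q : ℕ), 0 < q → z ^ q = 1 → h z = z) (m : ℕ+) : h (ξ m) = ξ m := by
  classical
  set ν : ℕ+ → Om := fun n => ξ n - h (ξ n) with hν
  have hνW : IsW ν := hW.sub (hW.alg h)
  have hνf : (Set.range ν).Finite := range_op (fun a b => a - b) hf (range_alg hf h)
  by_contra hcon
  have hm : ν m ≠ 0 := by simp only [hν]; intro h; exact hcon (sub_eq_zero.1 h).symm
  obtain ⟨L, hL1, hL2, hL⟩ := exists_L ν hνf
  obtain ⟨M, hM⟩ := frobO ν hνW hνf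
  obtain ⟨p, q, hp0, hq0, hpi, hqi, hpr, hqr, hpq⟩ := exp_pair hνW
  have hexL : ∀ n, ex ν n ∈ L := fun n => by
    rcases Nat.eq_zero_or_pos n with rfl | hn
    · rw [ex_zero]; exact zero_mem L
    · rw [ex_pos _ hn]; exact hL _
  have hu : ∀ φ : Gam, ∀ ε > 0, ∃ x0 : ℕ, ∀ x, x0 ≤ x → ∀ u : ℂ, ‖u‖ = 1 →
      ‖∑ n ∈ Ioc 0 x, ι (φ (ex ν n)) * u ^ n / n‖ ≤ ε * hl x := fun φ ε hε =>
    uniO (ι.comp (φ : Om →+* Om)) ξ hW hf h hh ε hε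
  obtain ⟨C1, hC1, x1, h1⟩ := sparse ι L (ex ν) p (ex_zero ν) hexL hp0 hpi hpr hu (1/4) (by norm_num)
  obtain ⟨C2, hC2, x2, h2⟩ := sparse ι L (fun n => -ex ν n) q (by simp [ex_zero]) (fun n => neg_mem (hexL n)) hq0 hqi hqr
    (fun φ ε hε => by
      obtain ⟨x0, hx0⟩ := hu φ ε hε
      refine ⟨x0, fun x hx u hu => ?_⟩
      have := hx0 x hx u hu
      rw [← norm_neg, ← sum_neg_distrib] at this
      refine le_trans (le_of_eq (congrArg norm (sum_congr rfl fun n _ => ?_))) this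
      rw [map_neg, map_neg]; ring) (1/4) (by norm_num)
  have hcount : ∀ k, max x1 x2 ≤ k → 0 < k → (((range (k+1)).filter (fun n => ex ν n ≠ 0)).card : ℝ) ≤ C1 * C2 * Real.exp (1/2) * Real.sqrt k := by
    intro k hk hk0
    have hsub : (range (k+1)).filter (fun n => ex ν n ≠ 0) ⊆
        (((range (k+1)).filter (fun n => p n ≠ 0)) ×ˢ ((range (k+1)).filter (fun n => q n ≠ 0))).image (fun x => x.1 + x.2) := by
      intro n hn
      obtain ⟨hn1, hn2⟩ := mem_filter.1 hn
      rw [hpq n] at hn2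
      obtain ⟨ij, hij, h0⟩ := exists_ne_zero_of_sum_ne_zero hn2
      have hij := mem_antidiagonal.1 hij
      have hn1 := mem_range.1 hn1
      refine mem_image.2 ⟨ij, mem_product.2 ⟨mem_filter.2 ⟨mem_range.2 (by omega), fun h => h0 (by simp [h])⟩,
        mem_filter.2 ⟨mem_range.2 (by omega), fun h => h0 (by simp [h])⟩⟩, hij⟩
    have hc := (card_le_card hsub).trans card_image_le
    rw [card_product] at hc
    have hc' : (((range (k+1)).filter (fun n => ex ν n ≠ 0)).card : ℝ) ≤ (C1 * Real.exp (1/4 * hl k)) * (C2 * Real.exp (1/4 * hl k)) := by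
      refine le_trans (Nat.cast_le.2 hc) ?_
      rw [Nat.cast_mul]
      exact mul_le_mul (h1 k (le_of_max_le_left hk)) (h2 k (le_of_max_le_right hk)) (Nat.cast_nonneg _) (mul_nonneg hC1 (Real.exp_pos _).le)
    refine hc'.trans ?_
    have e : (C1 * Real.exp (1/4 * hl k)) * (C2 * Real.exp (1/4 * hl k)) = C1 * C2 * Real.exp (1/2 * hl k) := by
      have : Real.exp (1/2 * hl k) = Real.exp (1/4 * hl k) * Real.exp (1/4 * hl k) := by rw [← Real.exp_add]; congr 1; ring
      rw [this]; ring
    rw [e, mul_assoc (C1 * C2)]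
    refine mul_le_mul_of_nonneg_left ?_ (by positivity)
    have hk' : (0:ℝ) < k := by exact_mod_cast hk0
    rw [Real.sqrt_eq_rpow, Real.rpow_def_of_pos hk', ← Real.exp_add]
    apply Real.exp_le_exp.2
    have := hl_le_log k
    linarith
  set Q := M.factorial with hQ
  have hQ0 : 0 < Q := M.factorial_pos
  have hlow : ∀ J : ℕ, J + 1 ≤ ((range (m * (1 + J * Q) + 1)).filter (fun n => ex ν n ≠ 0)).card := by
    intro J
    have : (range (J+1)).card ≤ ((range (m * (1 + J * Q) + 1)).filter (fun n => ex ν n ≠ 0)).card := by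
      refine card_le_card_of_injOn (fun j => m * (1 + j * Q)) ?_ ?_
      · intro j hj
        have hj := mem_range.1 hj
        simp only [coe_filter, mem_range, Set.mem_ofPred_eq]
        have hle : (m:ℕ) * (1 + j * Q) ≤ m * (1 + J * Q) := by gcongr; omega
        refine ⟨by omega, ?_⟩
        have hpos : 0 < 1 + j * Q := by omega
        have := frob_ne ν M hM m hm (1 + j * Q) hpos (fun p hp hd => by
          by_contra hle
          have h1 : p ∣ Q := hp.dvd_factorial.2 (by omega)
          have h2 : p ∣ 1 := (Nat.dvd_add_left (h1.mul_left j)).1 hd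
          exact hp.one_lt.ne' (Nat.dvd_one.1 h2))
        rw [ex_pos ν (Nat.mul_pos m.pos hpos)]
        convert this using 2
        apply PNat.eq
        show (m:ℕ) * (1 + j * Q) = (1 + j * Q) * m
        ring
      · intro i _ j _ hij
        have := Nat.eq_of_mul_eq_mul_left m.pos hij
        have : i * Q = j * Q := by omega
        exact Nat.eq_of_mul_eq_mul_right hQ0 this
    simpa using this
  set D := C1 * C2 * Real.exp (1/2) with hD
  have hD0 : 0 ≤ D := by positivity
  obtain ⟨J0, hJ0⟩ := exists_nat_gt (D ^ 2 * (m * (1 + Q)))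
  set J := max J0 (max x1 x2) with hJ
  have hmp : 1 ≤ (m : ℕ) := m.pos
  have hk : J ≤ m * (1 + J * Q) := by
    calc J ≤ 1 * (1 + J * Q) := by nlinarith
      _ ≤ _ := by gcongr
  have h3 := hcount (m * (1 + J * Q)) ((le_max_right _ _).trans hk) (by positivity)
  have h4 : ((J:ℝ) + 1) ≤ D * Real.sqrt ((m * (1 + J * Q) : ℕ) : ℝ) :=
    le_trans (by exact_mod_cast hlow J) h3
  have h5 : ((J:ℝ) + 1)^2 ≤ D ^ 2 * ((m * (1 + J * Q) : ℕ) : ℝ) := by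
    have := pow_le_pow_left₀ (by positivity) h4 2
    rwa [mul_pow, Real.sq_sqrt (by positivity)] at this
  have h6 : ((m * (1 + J * Q) : ℕ) : ℝ) ≤ m * (1 + Q) * (J + 1) := by
    push_cast
    have : (0:ℝ) ≤ m := by positivity
    have hq : (0:ℝ) ≤ Q := by positivity
    have hj : (0:ℝ) ≤ J := by positivity
    have : (1 + J * Q : ℝ) ≤ (1 + Q) * (J + 1) := by nlinarith
    calc (m:ℝ) * (1 + J * Q) ≤ m * ((1 + Q) * (J + 1)) := by gcongr
      _ = _ := by ring
  have h7 : ((J:ℝ) + 1)^2 ≤ (D ^ 2 * (m * (1 + Q))) * (J + 1) := by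
    calc _ ≤ _ := h5
      _ ≤ D ^ 2 * (m * (1 + Q) * (J + 1)) := by gcongr
      _ = _ := by ring
  have h8 : (J0 : ℝ) ≤ J := by exact_mod_cast le_max_left _ _
  have hj : (0:ℝ) ≤ J := by positivity
  nlinarith

end part15

section part16
open Finset

lemma exists_iota : Nonempty (Om →+* ℂ) :=
  ⟨(IsAlgClosed.lift (R := ℚ) (S := Om) (M := ℂ) : Om →ₐ[ℚ] ℂ).toRingHom⟩

/-- Congruence modulo `m` in the ring of algebraic integers. -/
def Cg (m : ℕ) (x y : Om) : Prop := ∃ w, IsIntegral ℤ w ∧ x - y = (m : Om) * w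

lemma Cg.refl (m : ℕ) (x : Om) : Cg m x x := ⟨0, isIntegral_zero, by simp⟩
lemma Cg.symm {m : ℕ} {x y : Om} (h : Cg m x y) : Cg m y x := by
  obtain ⟨w, hw, h⟩ := h
  exact ⟨-w, hw.neg, by rw [← neg_sub, h]; ring⟩
lemma Cg.trans {m : ℕ} {x y z : Om} (h : Cg m x y) (h' : Cg m y z) : Cg m x z := by
  obtain ⟨w, hw, h⟩ := h
  obtain ⟨w', hw', h'⟩ := h'
  exact ⟨w + w', hw.add hw', by rw [mul_add, ← h, ← h']; ring⟩
lemma Cg.add {m : ℕ} {x y z t : Om} (h : Cg m x y) (h' : Cg m z t) : Cg m (x + z) (y + t) := by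
  obtain ⟨w, hw, h⟩ := h
  obtain ⟨w', hw', h'⟩ := h'
  exact ⟨w + w', hw.add hw', by rw [mul_add, ← h, ← h']; ring⟩
lemma Cg.alg {m : ℕ} {x y : Om} (h : Cg m x y) (g : Gam) : Cg m (g x) (g y) := by
  obtain ⟨w, hw, h⟩ := h
  refine ⟨g w, ?_, by rw [← map_sub, h]; simp⟩
  exact hw.map ((g : Om →+* Om).toIntAlgHom)
lemma Cg.mul_p {m : ℕ} (p : ℕ) {x y : Om} (h : Cg m x y) : Cg (p * m) (p * x) (p * y) := by
  obtain ⟨w, hw, h⟩ := h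
  exact ⟨w, hw, by rw [← mul_sub, h]; push_cast; ring⟩

lemma Cg.pow_p {p : ℕ} (hp : p.Prime) {j : ℕ} (hj : 1 ≤ j) {x y : Om} (hx : IsIntegral ℤ x) (hy : IsIntegral ℤ y)
    (h : Cg (p ^ j) x y) : Cg (p ^ (j+1)) (x ^ p) (y ^ p) := by
  obtain ⟨w, hw, h⟩ := h
  let O := integralClosure ℤ Om
  let y' : O := ⟨y, hy⟩
  let w' : O := ⟨w, hw⟩
  obtain ⟨r, hr⟩ := exists_add_pow_prime_eq hp y' ((p : O) ^ j * w')
  have hr' : (y + (p : Om) ^ j * w) ^ p = y ^ p + ((p : Om) ^ j * w) ^ p + p * y * ((p : Om) ^ j * w) * (r : Om) := by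
    have := congrArg (fun t : O => (t : Om)) hr
    simpa [y', w'] using this
  have hx' : x = y + (p : Om) ^ j * w := by
    rw [← sub_eq_iff_eq_add', h]; push_cast; rfl
  obtain ⟨t, ht⟩ : ∃ t, j * p = j + 1 + t := by
    have h1 := hp.two_le
    have : j * 2 ≤ j * p := Nat.mul_le_mul_left j h1
    exact ⟨j * p - (j + 1), by omega⟩
  refine ⟨(p : Om) ^ t * w ^ p + y * w * r, ?_, ?_⟩
  · have hpi : IsIntegral ℤ (p : Om) := by
      have := (isIntegral_algebraMap (R := ℤ) (A := Om) (x := (p : ℤ)))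
      simpa using this
    exact ((hpi.pow _).mul (hw.pow _)).add ((hy.mul hw).mul r.2)
  · rw [hx', hr', mul_pow, ← pow_mul, ht]
    push_cast
    ring

lemma dvd_bound1 (d : Om) (hd : d ≠ 0) : ∃ B : ℕ, ∀ m : ℕ, B < m → ¬ Cg m d 0 := by
  obtain ⟨ι⟩ := exists_iota
  obtain ⟨L, h1, h2, h3⟩ := exists_L (fun _ => d) (Set.finite_range_const)
  obtain ⟨S, hS⟩ := exists_big ι L
  obtain ⟨B, hB⟩ := exists_nat_gt (∑ φ ∈ S, ‖ι (φ d)‖)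
  refine ⟨B, fun m hm ⟨w, hw, h⟩ => ?_⟩
  rw [sub_zero] at h
  have hm0 : (m : Om) ≠ 0 := by rintro h'; apply hd; rw [h, h', zero_mul]
  have hw0 : w ≠ 0 := by rintro rfl; exact hd (by simpa using h)
  have hwL : w ∈ L := by
    have : w = (m : Om)⁻¹ * d := by rw [h]; field_simp
    rw [this]
    exact mul_mem (inv_mem (natCast_mem L m)) (h3 1)
  obtain ⟨φ, hφ, hw1⟩ := hS w hwL hw0 hw
  have h5 : ‖ι (φ d)‖ ≤ ∑ φ ∈ S, ‖ι (φ d)‖ := single_le_sum (f := fun φ : Gam => ‖ι (φ d)‖) (fun _ _ => norm_nonneg _) hφ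
  rw [h] at h5
  simp only [map_mul, map_natCast, norm_mul, Complex.norm_natCast] at h5
  simp only [h, map_mul, map_natCast, norm_mul, Complex.norm_natCast] at hB
  have : (B:ℝ) < m := by exact_mod_cast hm
  nlinarith

lemma dvd_bound (V : Set Om) (hV : V.Finite) : ∃ B : ℕ, ∀ m : ℕ, B < m → ∀ x ∈ V, ∀ y ∈ V, Cg m x y → x = y := by
  classical
  have hD : ((fun q : Om × Om => q.1 - q.2) '' (V ×ˢ V)).Finite := (hV.prod hV).image _
  choose! B hB using dvd_bound1
  refine ⟨hD.toFinset.sup B, fun m hm x hx y hy h => ?_⟩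
  by_contra hne
  refine hB (x - y) (sub_ne_zero.2 hne) m ?_ ?_
  · refine lt_of_le_of_lt (Finset.le_sup (f := B) ?_) hm
    rw [Set.Finite.mem_toFinset]
    exact ⟨(x, y), ⟨hx, hy⟩, rfl⟩
  · obtain ⟨w, hw, h⟩ := h
    exact ⟨w, hw, by rw [sub_zero, h]⟩

lemma poly_frob (p : ℕ) (hp : p.Prime) (f : Polynomial ℤ) :
    ∃ g : Polynomial ℤ, f ^ p = Polynomial.expand ℤ p f + Polynomial.C (p : ℤ) * g := by
  have := Fact.mk hp
  have h : Polynomial.C (p : ℤ) ∣ f ^ p - Polynomial.expand ℤ p f := by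
    rw [Polynomial.C_dvd_iff_dvd_coeff]
    intro i
    rw [← ZMod.intCast_zmod_eq_zero_iff_dvd]
    have e : (f ^ p - Polynomial.expand ℤ p f).map (Int.castRingHom (ZMod p)) = 0 := by
      rw [Polynomial.map_sub, Polynomial.map_pow, Polynomial.map_expand, ZMod.expand_card, sub_self]
    have := congrArg (fun q => q.coeff i) e
    simp only [Polynomial.coeff_map, Polynomial.coeff_zero] at this
    exact this
  obtain ⟨g, hg⟩ := h
  exact ⟨g, by rw [← hg]; ring⟩

lemma aeval_integral {ζ : Om} (hζ : IsIntegral ℤ ζ) (f : Polynomial ℤ) : IsIntegral ℤ (Polynomial.aeval ζ f) :=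
  by
  rw [Polynomial.aeval_eq_sum_range]
  exact IsIntegral.sum _ fun i _ => (hζ.pow i).smul _

lemma cg_frob (p : ℕ) (hp : p.Prime) (ζ : Om) (hζ : IsIntegral ℤ ζ) (f : Polynomial ℤ) :
    Cg p ((Polynomial.aeval ζ f) ^ p) (Polynomial.aeval (ζ ^ p) f) := by
  obtain ⟨g, hg⟩ := poly_frob p hp f
  refine ⟨Polynomial.aeval ζ g, aeval_integral hζ g, ?_⟩
  rw [← map_pow, hg]
  simp [Polynomial.expand_aeval]

lemma cg_frob_iter (p : ℕ) (hp : p.Prime) (ζ : Om) (hζ : IsIntegral ℤ ζ) (f : Polynomial ℤ) (k : ℕ) :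
    Cg p ((Polynomial.aeval ζ f) ^ p ^ k) (Polynomial.aeval (ζ ^ p ^ k) f) := by
  induction k with
  | zero => simpa using Cg.refl p _
  | succ k ih =>
    have h1 := cg_frob p hp (ζ ^ p ^ k) (hζ.pow _) f
    rw [← pow_mul, ← pow_succ] at h1
    refine Cg.trans ?_ h1
    rw [pow_succ, pow_mul]
    have := Cg.pow_p hp le_rfl ((aeval_integral hζ f).pow _) (aeval_integral (hζ.pow _) f) (j := 1) (by simpa using ih)
    obtain ⟨w, hw, h⟩ := this
    refine ⟨p * w, ?_, by rw [h]; push_cast; ring⟩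
    have := (isIntegral_algebraMap (R := ℤ) (A := Om) (x := (p : ℤ)))
    exact IsIntegral.mul (by simpa using this) hw

open IntermediateField in
lemma int_mem {N : ℕ} [NeZero N] {ζ : Om} (hζ : IsPrimitiveRoot ζ N) {x : Om} (hx : IsIntegral ℤ x) (hm : x ∈ ℚ⟮ζ⟯) :
    ∃ f : Polynomial ℤ, x = Polynomial.aeval ζ f := by
  have hc : IsCyclotomicExtension {N} ℚ ℚ⟮ζ⟯ := by
    have := hζ.intermediateField_adjoin_isCyclotomicExtension ℚ
    have e : (ℚ⟮ζ⟯.algebra' : Algebra ℚ ℚ⟮ζ⟯) = DivisionRing.toRatAlgebra := Subsingleton.elim _ _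
    rw [e] at this
    exact this
  let ζ' : ℚ⟮ζ⟯ := ⟨ζ, mem_adjoin_simple_self ℚ ζ⟩
  have hζ' : IsPrimitiveRoot ζ' N := IsPrimitiveRoot.of_map_of_injective (f := algebraMap ℚ⟮ζ⟯ Om) hζ (algebraMap ℚ⟮ζ⟯ Om).injective
  have hI := IsCyclotomicExtension.Rat.isIntegralClosure_adjoin_singleton hζ'
  let x' : ℚ⟮ζ⟯ := ⟨x, hm⟩
  have hx' : IsIntegral ℤ x' :=
    (isIntegral_algHom_iff ((algebraMap ℚ⟮ζ⟯ Om).toIntAlgHom) (algebraMap ℚ⟮ζ⟯ Om).injective).1 hx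
  obtain ⟨y, hy⟩ := hI.isIntegral_iff.1 hx'
  have h2 : algebraMap _ ℚ⟮ζ⟯ y ∈ Algebra.adjoin ℤ {ζ'} := y.2
  rw [hy] at h2
  rw [Algebra.adjoin_singleton_eq_range_aeval] at h2
  obtain ⟨f, hf⟩ := h2
  refine ⟨f, ?_⟩
  have h3 : Polynomial.aeval ζ' f = x' := hf
  have h4 := Polynomial.aeval_algHom_apply (algebraMap ℚ⟮ζ⟯ Om).toIntAlgHom ζ' f
  rw [h3] at h4
  exact h4.symm

lemma exists_sigma {N : ℕ} [NeZero N] {ζ : Om} (hζ : IsPrimitiveRoot ζ N) (a : ℕ) (ha : a.Coprime N) :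
    ∃ σ : Gam, σ ζ = ζ ^ a := by
  have h1 : IsConjRoot ℚ (ζ ^ a) ζ := by
    have h := hζ.minpoly_eq_pow_coprime ha
    have hi : IsIntegral ℤ ζ := hζ.isIntegral (NeZero.pos N)
    show minpoly ℚ (ζ ^ a) = minpoly ℚ ζ
    rw [minpoly.isIntegrallyClosed_eq_field_fractions' ℚ hi, minpoly.isIntegrallyClosed_eq_field_fractions' ℚ (hi.pow a)]
    exact congrArg _ h.symm
  exact isConjRoot_iff_exists_algEquiv.1 h1

end part16

section part17
open Finset IntermediateField

lemma cyc_one (x : Om) (hx : ∀ h : Gam, (∀ (z : Om) (q : ℕ), 0 < q → z ^ q = 1 → h z = z) → h x = x) :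
    ∃ N : ℕ, 0 < N ∧ ∀ m : ℕ, 0 < m → N ∣ m → ∀ ζ : Om, IsPrimitiveRoot ζ m → x ∈ ℚ⟮ζ⟯ := by
  classical
  let S : Set Om := {z | ∃ q : ℕ, 0 < q ∧ z ^ q = 1}
  have : IsGalois ℚ Om := ⟨⟩
  have h1 : x ∈ IntermediateField.adjoin ℚ S := by
    rw [← InfiniteGalois.fixedField_fixingSubgroup (IntermediateField.adjoin ℚ S)]
    rintro ⟨g, hg⟩
    refine hx g fun z q hq hz => ?_
    exact (IntermediateField.mem_fixingSubgroup_iff _ g).1 hg z (subset_adjoin ℚ S ⟨q, hq, hz⟩)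
  obtain ⟨T, hT, hxT⟩ := IntermediateField.exists_finset_of_mem_adjoin h1
  have hT' : ∀ z, z ∈ T → ∃ q : ℕ, 0 < q ∧ z ^ q = 1 := fun z hz => hT hz
  choose! q hq0 hq using hT'
  refine ⟨∏ z ∈ T, q z, Finset.prod_pos fun z hz => hq0 z hz, fun m hm hd ζ hζ => ?_⟩
  have : NeZero m := ⟨hm.ne'⟩
  refine (adjoin_le_iff.2 ?_ : IntermediateField.adjoin ℚ (T : Set Om) ≤ ℚ⟮ζ⟯) hxT
  intro z hz
  have hzm : z ^ m = 1 := by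
    obtain ⟨c, hc⟩ := (Finset.dvd_prod_of_mem q hz).trans hd
    rw [hc, pow_mul, hq z hz, one_pow]
  obtain ⟨i, _, rfl⟩ := hζ.eq_pow_of_pow_eq_one hzm
  exact pow_mem (mem_adjoin_simple_self ℚ ζ) i

lemma cyc_field (ξ : ℕ+ → Om) (hW : IsW ξ) (hf : (Set.range ξ).Finite) :
    ∃ N : ℕ, 0 < N ∧ ∀ m : ℕ, 0 < m → N ∣ m → ∀ ζ : Om, IsPrimitiveRoot ζ m → ∀ n, ξ n ∈ ℚ⟮ζ⟯ := by
  classical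
  obtain ⟨ι⟩ := exists_iota
  have h : ∀ x ∈ Set.range ξ, ∃ N : ℕ, 0 < N ∧ ∀ m : ℕ, 0 < m → N ∣ m → ∀ ζ : Om, IsPrimitiveRoot ζ m → x ∈ ℚ⟮ζ⟯ := by
    rintro _ ⟨n, rfl⟩
    exact cyc_one _ fun g hg => fix_cyc ι ξ hW hf g hg n
  choose! N hN0 hN using h
  refine ⟨∏ x ∈ hf.toFinset, N x, Finset.prod_pos fun x hx => hN0 x (hf.mem_toFinset.1 hx), fun m hm hd ζ hζ n => ?_⟩
  exact hN (ξ n) ⟨n, rfl⟩ m hm ((Finset.dvd_prod_of_mem N (hf.mem_toFinset.2 ⟨n, rfl⟩)).trans hd) ζ hζ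

lemma pow_modEq {N : ℕ} {ζ : Om} (hζ : ζ ^ N = 1) {a b : ℕ} (h : a ≡ b [MOD N]) : ζ ^ a = ζ ^ b := by
  have : ∀ c : ℕ, ζ ^ c = ζ ^ (c % N) := fun c => by
    conv_lhs => rw [← Nat.div_add_mod c N, pow_add, pow_mul, hζ, one_pow, one_mul]
  rw [this a, this b, h]

lemma aeval_alg (g : Gam) (ζ : Om) (f : Polynomial ℤ) : g (Polynomial.aeval ζ f) = Polynomial.aeval (g ζ) f :=
  (Polynomial.aeval_algHom_apply ((g : Om →+* Om).toIntAlgHom) ζ f).symm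

lemma alg_ext {ζ : Om} {g h : Gam} (hgh : g ζ = h ζ) {x : Om} (hx : x ∈ ℚ⟮ζ⟯) : g x = h x := by
  refine IntermediateField.adjoin_induction ℚ (s := {ζ}) (p := fun y _ => g y = h y) ?_ ?_ ?_ ?_ ?_ hx
  · intro y hy
    rw [Set.mem_singleton_iff.1 hy, hgh]
  · intro y; simp
  · intro y z _ _ h1 h2; rw [map_add, map_add, h1, h2]
  · intro y _ h1; rw [map_inv₀, map_inv₀, h1]
  · intro y z _ _ h1 h2; rw [map_mul, map_mul, h1, h2]

lemma E1 {N : ℕ} [NeZero N] {ζ : Om} (hζ : IsPrimitiveRoot ζ N) (η : ℕ+ → Om) (hW : IsW η)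
    (hm : ∀ n, η n ∈ ℚ⟮ζ⟯) (V : Set Om) (hV : ∀ (g : Gam) n, g (η n) ∈ V) (B : ℕ)
    (hB : ∀ m : ℕ, B < m → ∀ x ∈ V, ∀ y ∈ V, Cg m x y → x = y) (hN : ∀ p : ℕ, p.Prime → p ≤ B → p ∣ N) (a : ℕ) :
    ∀ (ha : 0 < a), a.Coprime N → ∀ σ : Gam, σ ζ = ζ ^ a → ∀ n, η (a.toPNat ha * n) = σ (η n) := by
  have hζi : IsIntegral ℤ ζ := hζ.isIntegral (NeZero.pos N)
  induction a using induction_on_primes with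
  | zero => intro ha; omega
  | one => 
    intro ha _ σ hσ n
    rw [pow_one] at hσ
    have : Nat.toPNat 1 ha = 1 := rfl
    rw [this, one_mul]
    exact (alg_ext (g := σ) (h := 1) hσ (hm n)).symm
  | prime_mul p a hp ih =>
    intro hpa hco σ hσ n
    have ha : 0 < a := Nat.pos_of_mul_pos_left hpa
    have hca : a.Coprime N := Nat.Coprime.coprime_mul_left hco
    have hcp : p.Coprime N := Nat.Coprime.coprime_mul_right hco
    obtain ⟨τ, hτ⟩ := exists_sigma hζ p hcp
    obtain ⟨ρ, hρ⟩ := exists_sigma hζ a hca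
    have hpB : B < p := by
      by_contra h
      have := hN p hp (by omega)
      exact (hp.coprime_iff_not_dvd.1 hcp) this
    have key : ∀ n, η (p.toPNat hp.pos * n) = τ (η n) := fun n => by
      refine hB p hpB _ (hV 1 (p.toPNat hp.pos * n)) _ (hV τ n) ?_
      obtain ⟨e, he, h⟩ := hW.frob p hp
      obtain ⟨f, hf⟩ := int_mem hζ (hW.integral n) (hm n)
      have h1 := cg_frob p hp ζ hζi f
      rw [← hf, ← hτ, ← aeval_alg, ← hf] at h1
      refine Cg.trans ?_ h1
      exact ⟨e n, he.integral n, sub_eq_iff_eq_add'.2 (h n)⟩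
    have e : Nat.toPNat (p * a) hpa * n = p.toPNat hp.pos * (a.toPNat ha * n) := by
      rw [← mul_assoc]; rfl
    rw [e, key, ih ha hca ρ hρ]
    refine alg_ext (g := τ * ρ) (h := σ) ?_ (hm n)
    rw [AlgEquiv.mul_apply, hρ, map_pow, hτ, hσ, pow_mul]

/-- Iterated shift congruence. -/
lemma psi_pow (p : ℕ) (hp : p.Prime) (i : ℕ) (η : ℕ+ → Om) (hW : IsW η) (n : ℕ+) :
    Cg p (η (p.toPNat hp.pos ^ i * n)) (η n ^ p ^ i) := by
  induction i generalizing n with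
  | zero => simpa using Cg.refl p _
  | succ i ih =>
    have h1 := ih (p.toPNat hp.pos * n)
    rw [← mul_assoc, ← pow_succ] at h1
    refine h1.trans ?_
    obtain ⟨e, he, h⟩ := hW.frob p hp
    have h2 : Cg p (η (p.toPNat hp.pos * n)) (η n ^ p) := ⟨e n, he.integral n, sub_eq_iff_eq_add'.2 (h n)⟩
    rw [pow_succ', pow_mul]
    have h3 : ∀ (k : ℕ) (x y : Om), IsIntegral ℤ x → IsIntegral ℤ y → Cg p x y → Cg p (x ^ k) (y ^ k) := by
      intro k x y hx hy h
      induction k with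
      | zero => simpa using Cg.refl p _
      | succ k ihk =>
        obtain ⟨w, hw, h⟩ := h
        obtain ⟨w', hw', h'⟩ := ihk
        refine ⟨w' * x + y ^ k * w, (hw'.mul hx).add ((hy.pow _).mul hw), ?_⟩
        linear_combination x * h' + y ^ k * h
    exact h3 _ _ _ (hW.integral _) ((hW.integral _).pow _) h2

lemma E2cong {N : ℕ} [NeZero N] {ζ : Om} (hζ : IsPrimitiveRoot ζ N) (p : ℕ) (hp : p.Prime) (e N' : ℕ)
    (hN : N = p ^ e * N') (b : ℕ) (hb : b ≡ p [MOD N']) (ρ : Gam) (hρ : ρ ζ = ζ ^ b) (j : ℕ) :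
    ∀ (η : ℕ+ → Om), IsW η → (∀ n, η n ∈ ℚ⟮ζ⟯) → ∀ n,
      Cg (p ^ (j+1)) (η (p.toPNat hp.pos ^ (e+j+1) * n)) (ρ (η (p.toPNat hp.pos ^ (e+j) * n))) := by
  have hζi : IsIntegral ℤ ζ := hζ.isIntegral (NeZero.pos N)
  induction j with
  | zero =>
    intro η hW hm n
    rw [zero_add, pow_one]
    refine (psi_pow p hp _ η hW n).trans ?_
    refine Cg.trans ?_ ((psi_pow p hp _ η hW n).alg ρ).symm
    obtain ⟨f, hf⟩ := int_mem hζ (hW.integral n) (hm n)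
    rw [hf]
    refine (cg_frob_iter p hp ζ hζi f _).trans ?_
    refine Cg.trans ?_ ((cg_frob_iter p hp ζ hζi f _).alg ρ).symm
    rw [aeval_alg, map_pow, hρ, ← pow_mul]
    have : ζ ^ p ^ (e + 0 + 1) = ζ ^ (b * p ^ (e + 0)) := by
      have hmod : p ^ (e + 0 + 1) ≡ b * p ^ (e + 0) [MOD N] := by
        rw [hN, mul_comm (p ^ e) N', pow_succ', add_zero]
        exact (Nat.ModEq.mul_right' (p ^ e) hb).symm
      exact pow_modEq hζ.pow_eq_one hmod
    rw [this]
    exact Cg.refl _ _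
  | succ j ih =>
    intro η hW hm n
    obtain ⟨η1, hη1, h⟩ := hW.frob p hp
    have h' : ∀ n, η (p.toPNat hp.pos * n) = η n ^ p + (p : Om) * η1 n := h
    have hm1 : ∀ n, η1 n ∈ ℚ⟮ζ⟯ := fun n => by
      have hp0 : (p : Om) ≠ 0 := by exact_mod_cast hp.ne_zero
      have : η1 n = (p : Om)⁻¹ * (η (p.toPNat hp.pos * n) - η n ^ p) := by rw [h']; field_simp; ring
      rw [this]
      exact mul_mem (inv_mem (_root_.natCast_mem _ p)) (sub_mem (hm _) (pow_mem (hm _) _))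
    have e1 : η (p.toPNat hp.pos ^ (e+(j+1)+1) * n) = η (p.toPNat hp.pos ^ (e+j+1) * n) ^ p + p * η1 (p.toPNat hp.pos ^ (e+j+1) * n) := by
      rw [← h', ← mul_assoc, ← pow_succ']; rfl
    have e2 : ρ (η (p.toPNat hp.pos ^ (e+(j+1)) * n)) = (ρ (η (p.toPNat hp.pos ^ (e+j) * n))) ^ p + p * ρ (η1 (p.toPNat hp.pos ^ (e+j) * n)) := by
      have : η (p.toPNat hp.pos ^ (e+(j+1)) * n) = η (p.toPNat hp.pos ^ (e+j) * n) ^ p + p * η1 (p.toPNat hp.pos ^ (e+j) * n) := by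
        rw [← add_assoc, pow_succ', mul_assoc, h']
      rw [this]; simp
    rw [e1, e2]
    refine Cg.add ?_ ?_
    · exact Cg.pow_p hp (by omega) (hW.integral _) ((hW.alg ρ).integral _) (ih η hW hm n)
    · rw [pow_succ' p (j+1)]
      exact Cg.mul_p p (ih η1 hη1 hm1 n)

end part17

section part18
open Finset IntermediateField

lemma inv_ex {b N : ℕ} (hN : 0 < N) (h : b.Coprime N) : ∃ B, B.Coprime N ∧ b * B ≡ 1 [MOD N] := by
  refine ⟨b ^ (N.totient - 1), h.pow_left _, ?_⟩
  rw [← pow_succ', Nat.sub_add_cancel (Nat.totient_pos.2 hN)]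
  exact Nat.ModEq.pow_totient h

lemma coprime_modEq {a b N : ℕ} (h : a ≡ b [MOD N]) (hb : b.Coprime N) : a.Coprime N := by
  have := h.gcd_eq
  rw [Nat.Coprime, this]; exact hb

variable {α : Type*}

lemma X0 (f : ℕ → α) (N i0 : ℕ) (hN : 0 < N)
    (hA : ∀ a a' : ℕ, a.Coprime N → a'.Coprime N → a ≡ a' [MOD N] → ∀ n, f (a * n) = f (a' * n))
    (hB : ∀ p e N' : ℕ, p.Prime → N = p ^ e * N' → ∀ b : ℕ, b.Coprime N → b ≡ p [MOD N'] → ∀ n, p ^ i0 ∣ n → f (p * n) = f (b * n))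
    (S : ℕ) : ∀ R, N = S * R → S.Coprime R → ∀ d, (∀ p : ℕ, p.Prime → p ∣ S → p ^ i0 ∣ d) →
      ∀ w w', 0 < w → 0 < w' → w.Coprime R → w'.Coprime R → w ≡ w' [MOD R] → f (d * w) = f (d * w') := by
  induction S using Nat.strong_induction_on with
  | _ S ih =>
    intro R hSR hco d hd w w' hw0 hw0' hw hw' hww
    have hS0 : S ≠ 0 := by rintro rfl; simp at hSR; omega
    by_cases hS1 : S = 1
    · subst hS1
      rw [one_mul] at hSR
      subst hSR
      rw [mul_comm d, mul_comm d]
      exact hA w w' hw hw' hww d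
    · obtain ⟨p, hp, hpS⟩ := Nat.exists_prime_and_dvd hS1
      obtain ⟨e, S', hpS', hS⟩ := Nat.exists_eq_pow_mul_and_not_dvd hS0 p hp.ne_one
      have he : e ≠ 0 := by
        rintro rfl
        rw [pow_zero, one_mul] at hS
        exact hpS' (hS ▸ hpS)
      have hR0 : 0 < R := Nat.pos_of_ne_zero (by rintro rfl; simp at hSR; omega)
      have hS'0 : 0 < S' := Nat.pos_of_ne_zero (by rintro rfl; simp at hpS')
      have hpR : p.Coprime R := Nat.Coprime.coprime_dvd_left hpS hco
      have hpS'c : p.Coprime S' := hp.coprime_iff_not_dvd.2 hpS'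
      have hpN' : p.Coprime (S' * R) := Nat.Coprime.mul_right hpS'c hpR
      have hNe : N = p ^ e * (S' * R) := by rw [hSR, hS]; ring
      have hcrt : (p ^ e).Coprime (S' * R) := hpN'.pow_left e
      have hpi : p ^ i0 ∣ d := hd p hp hpS
      have hex : ∀ t : ℕ, t.Coprime (p ^ e) → ∃ b : ℕ, b.Coprime N ∧ b ≡ p [MOD (S' * R)] ∧ b ≡ t [MOD p ^ e] := by
        intro t ht
        obtain ⟨b, hb1, hb2⟩ := Nat.chineseRemainder hcrt t p
        refine ⟨b, ?_, hb2, hb1⟩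
        rw [hNe]
        exact Nat.Coprime.mul_right (coprime_modEq hb1 ht) (coprime_modEq hb2 hpN')
      obtain ⟨b, hbN, hbp, hb1⟩ := hex 1 (Nat.coprime_one_left _)
      have hbR : b ≡ p [MOD R] := hbp.of_mul_left S'
      have hbRc : b.Coprime R := Nat.Coprime.coprime_dvd_right ⟨S, by rw [hSR, mul_comm]⟩ hbN
      have hbpc : b.Coprime p := Nat.Coprime.coprime_dvd_right (hpS.trans ⟨R, hSR⟩) hbN
      have hb0 : 0 < b := Nat.pos_of_ne_zero (by
        rintro rfl
        exact hp.ne_one ((Nat.coprime_zero_left _).1 hbpc))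
      have hit : ∀ s n, p ^ i0 ∣ n → f (p ^ s * n) = f (b ^ s * n) := by
        intro s
        induction s with
        | zero => intro n _; simp
        | succ s ihs =>
          intro n hn
          rw [pow_succ, mul_assoc, ihs _ (hn.mul_left _), mul_left_comm, hB p e _ hp hNe b hbN hbp _ (hn.mul_left _), ← mul_assoc, pow_succ']
      have hcl : ∀ w, 0 < w → w.Coprime R → ∃ w1, 0 < w1 ∧ w1.Coprime p ∧ w1.Coprime R ∧ w1 ≡ w [MOD R] ∧ f (d * w) = f (d * w1) := by
        intro w hw0 hw
        obtain ⟨s, v, hpv, hv⟩ := Nat.exists_eq_pow_mul_and_not_dvd hw0.ne' p hp.ne_one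
        have hv0 : 0 < v := Nat.pos_of_ne_zero (by rintro rfl; simp at hpv)
        refine ⟨b ^ s * v, by positivity, ?_, ?_, ?_, ?_⟩
        · exact Nat.Coprime.mul_left (hbpc.pow_left _) ((hp.coprime_iff_not_dvd.2 hpv).symm)
        · exact Nat.Coprime.mul_left (hbRc.pow_left _) (Nat.Coprime.coprime_dvd_left ⟨p ^ s, by rw [hv, mul_comm]⟩ hw)
        · rw [hv]
          exact (hbR.pow s).mul_right v
        · have := hit s (d * v) (hpi.mul_right _)
          rw [hv, mul_left_comm, this, mul_left_comm]
      obtain ⟨w1, hw10, hw1p, hw1R, hw1w, hw1⟩ := hcl w hw0 hw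
      obtain ⟨w2, hw20, hw2p, hw2R, hw2w, hw2⟩ := hcl w' hw0' hw'
      rw [hw1, hw2]
      have h12 : w1 ≡ w2 [MOD R] := hw1w.trans (hww.trans hw2w.symm)
      obtain ⟨B, hBN, hB1⟩ := inv_ex hN hbN
      have hBR : B.Coprime R := Nat.Coprime.coprime_dvd_right ⟨S, by rw [hSR, mul_comm]⟩ hBN
      have hpN : p ∣ N := (hpS.trans ⟨R, hSR⟩)
      have hBp : B.Coprime p := Nat.Coprime.coprime_dvd_right hpN hBN
      have hB0 : 0 < B := Nat.pos_of_ne_zero (by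
        rintro rfl
        exact hp.ne_one ((Nat.coprime_zero_left _).1 hBp))
      obtain ⟨u, huc, hu⟩ := inv_ex (pow_pos hp.pos e) (hw1p.pow_right e)
      obtain ⟨b', hbN', hbp', hb1'⟩ := hex (b * w2 * u) (Nat.Coprime.mul_left (Nat.Coprime.mul_left (hbpc.pow_right e) (hw2p.pow_right e)) huc)
      have hbR' : b' ≡ p [MOD R] := hbp'.of_mul_left S'
      have hbRc' : b'.Coprime R := Nat.Coprime.coprime_dvd_right ⟨S, by rw [hSR, mul_comm]⟩ hbN'
      have hbpc' : b'.Coprime p := Nat.Coprime.coprime_dvd_right hpN hbN'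
      have hb0' : 0 < b' := Nat.pos_of_ne_zero (by
        rintro rfl
        exact hp.ne_one ((Nat.coprime_zero_left _).1 hbpc'))
      have hlt : S' < S := by
        rw [hS]
        have : 1 < p ^ e := Nat.one_lt_pow he hp.one_lt
        nlinarith
      have IH := ih S' hlt (p ^ e * R) (by rw [hNe]; ring) (Nat.Coprime.mul_right (hpS'c.symm.pow_right e)
        (Nat.Coprime.coprime_dvd_left ⟨p ^ e, by rw [hS, mul_comm]⟩ hco)) d
        (fun q hq hqS => hd q hq (by rw [hS]; exact hqS.mul_left _))
      have hc1 : w1.Coprime (p ^ e * R) := Nat.Coprime.mul_right (hw1p.pow_right e) hw1R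
      have hc2 : w2.Coprime (p ^ e * R) := Nat.Coprime.mul_right (hw2p.pow_right e) hw2R
      have hcb : b.Coprime (p ^ e * R) := Nat.Coprime.mul_right (hbpc.pow_right e) hbRc
      have hcb' : b'.Coprime (p ^ e * R) := Nat.Coprime.mul_right (hbpc'.pow_right e) hbRc'
      have hcB : B.Coprime (p ^ e * R) := Nat.Coprime.mul_right (hBp.pow_right e) hBR
      have hR1N : (p ^ e * R) ∣ N := ⟨S', by rw [hNe]; ring⟩
      have hbB : b * B ≡ 1 [MOD p ^ e * R] := hB1.of_dvd hR1N
      have s1 : f (d * w1) = f (d * (b * (B * w1))) := by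
        refine IH _ _ hw10 (by positivity) hc1 (Nat.Coprime.mul_left hcb (Nat.Coprime.mul_left hcB hc1)) ?_
        rw [← mul_assoc]
        simpa using (hbB.mul_right w1).symm
      have s2 : f (d * (b * (B * w1))) = f (d * (b' * (B * w1))) := by
        rw [mul_left_comm, mul_left_comm d b']
        rw [← hB p e _ hp hNe b hbN hbp _ (hpi.mul_right _), ← hB p e _ hp hNe b' hbN' hbp' _ (hpi.mul_right _)]
      rw [s1, s2]
      refine IH _ _ (by positivity) hw20 (Nat.Coprime.mul_left hcb' (Nat.Coprime.mul_left hcB hc1)) hc2 ?_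
      rw [← Nat.modEq_and_modEq_iff_modEq_mul (hpR.pow_left e)]
      constructor
      · have hbBp : b * B ≡ 1 [MOD p ^ e] := hbB.of_mul_right R
        calc b' * (B * w1) ≡ (b * w2 * u) * (B * w1) [MOD p ^ e] := hb1'.mul_right _
          _ = (b * B) * (w1 * u) * w2 := by ring
          _ ≡ 1 * 1 * w2 [MOD p ^ e] := (hbBp.mul hu).mul_right _
          _ = w2 := by ring
      · have hbBR : b * B ≡ 1 [MOD R] := hbB.of_mul_left (p ^ e)
        calc b' * (B * w1) ≡ b * (B * w1) [MOD R] := (hbR'.trans hbR.symm).mul_right _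
          _ = (b * B) * w1 := by ring
          _ ≡ 1 * w1 [MOD R] := hbBR.mul_right _
          _ = w1 := one_mul _
          _ ≡ w2 [MOD R] := h12

lemma split_N {N w : ℕ} (hN : 0 < N) : ∃ S R, N = S * R ∧ S.Coprime R ∧ w.Coprime R ∧ ∀ p : ℕ, p.Prime → p ∣ S → p ∣ w := by
  have hd := Nat.gcd_dvd_left N (w ^ N)
  obtain ⟨R, hR⟩ := hd
  have hS : ∀ p : ℕ, p.Prime → p ∣ Nat.gcd N (w ^ N) → p ∣ w := fun p hp h =>
    hp.dvd_of_dvd_pow (h.trans (Nat.gcd_dvd_right _ _))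
  have hwR : w.Coprime R := by
    refine Nat.Coprime.symm (Nat.coprime_of_dvd fun p hp hpR hpw => ?_)
    obtain ⟨e, N', hN', he⟩ := Nat.exists_eq_pow_mul_and_not_dvd hN.ne' p hp.ne_one
    have hle : e ≤ N := by
      have h1 : e < p ^ e := Nat.lt_pow_self hp.one_lt
      have h2 : p ^ e ≤ N := Nat.le_of_dvd hN ⟨N', he⟩
      omega
    have h1 : p ^ e ∣ Nat.gcd N (w ^ N) := Nat.dvd_gcd ⟨N', he⟩
      ((pow_dvd_pow_of_dvd hpw e).trans (pow_dvd_pow w hle))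
    have h2 : p ^ e * p ∣ p ^ e * N' := by
      rw [← he]; conv_rhs => rw [hR]
      exact mul_dvd_mul h1 hpR
    exact hN' (Nat.dvd_of_mul_dvd_mul_left (pow_pos hp.pos e) h2)
  refine ⟨_, R, hR, ?_, hwR, hS⟩
  refine Nat.coprime_of_dvd fun p hp hpS hpR => ?_
  exact hp.one_lt.ne' (Nat.dvd_one.1 (hwR ▸ Nat.dvd_gcd (hS p hp hpS) hpR))

lemma periodic (f : ℕ → α) (N i0 : ℕ) (hN : 0 < N)
    (hA : ∀ a a' : ℕ, a.Coprime N → a'.Coprime N → a ≡ a' [MOD N] → ∀ n, f (a * n) = f (a' * n))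
    (hB : ∀ p e N' : ℕ, p.Prime → N = p ^ e * N' → ∀ b : ℕ, b.Coprime N → b ≡ p [MOD N'] → ∀ n, p ^ i0 ∣ n → f (p * n) = f (b * n))
    (n n' : ℕ) (hn : 0 < n) (hn' : 0 < n') (h : n ≡ n' [MOD N ^ (i0 + 1)]) : f n = f n' := by
  have hP : 0 < N ^ i0 := pow_pos hN _
  have hg : n.gcd (N ^ i0) = n'.gcd (N ^ i0) := (h.of_dvd (pow_dvd_pow N (Nat.le_succ _))).gcd_eq
  set d := n.gcd (N ^ i0) with hd
  have hd0 : 0 < d := Nat.gcd_pos_of_pos_left _ hn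
  obtain ⟨w, hw⟩ := Nat.gcd_dvd_left n (N ^ i0)
  obtain ⟨w', hw'⟩ := Nat.gcd_dvd_left n' (N ^ i0)
  obtain ⟨c, hc⟩ := Nat.gcd_dvd_right n (N ^ i0)
  rw [← hd] at hw hc
  rw [← hg] at hw'
  have hwc : w.Coprime c := by
    have : d * w.gcd c = d * 1 := by
      rw [← Nat.gcd_mul_left, ← hw, ← hc, mul_one]
    exact Nat.eq_of_mul_eq_mul_left hd0 this
  have hww : w ≡ w' [MOD N] := by
    have : d * w ≡ d * w' [MOD d * (c * N)] := by
      rw [← hw, ← hw', ← mul_assoc, ← hc, ← pow_succ]; exact h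
    exact (Nat.ModEq.mul_left_cancel' hd0.ne' this).of_mul_left c
  obtain ⟨S, R, hSR, hco, hwR, hS⟩ := split_N (w := w) hN
  have hww' : w ≡ w' [MOD R] := hww.of_dvd ⟨S, by rw [hSR, mul_comm]⟩
  rw [hw, hw']
  refine X0 f N i0 hN hA hB S R hSR hco d ?_ w w' ?_ ?_ hwR (coprime_modEq hww'.symm hwR) hww'
  · intro p hp hpS
    have hpw := hS p hp hpS
    have hpc : (p ^ i0).Coprime c := (Nat.Coprime.coprime_dvd_left hpw hwc).pow_left _
    have : p ^ i0 ∣ d * c := by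
      rw [← hc]; exact pow_dvd_pow_of_dvd (hpS.trans ⟨R, hSR⟩) _
    exact hpc.dvd_of_dvd_mul_right this
  · exact Nat.pos_of_ne_zero (by rintro rfl; omega)
  · exact Nat.pos_of_ne_zero (by rintro rfl; omega)

end part18

section part19
open Finset IntermediateField

lemma fourier_rat (M : ℕ) [NeZero M] (ω : Om) (hω : IsPrimitiveRoot ω M) (H : ZMod M → Om)
    (hg : ∀ (g : Gam) (a : ℕ), a.Coprime M → g ω = ω ^ a → ∀ x, g (H x) = H (a * x)) :
    ∃ c : ZMod M → ℚ, ∀ n : ℕ, H n = ∑ j : ZMod M, (c j : Om) * ω ^ (j.val * n) := by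
  classical
  let χ := AddChar.zmodChar M hω.pow_eq_one
  have hχ : χ.IsPrimitive := AddChar.zmodChar_primitive_of_primitive_root M hω
  have hχn : ∀ n : ℕ, χ (n : ZMod M) = ω ^ n := fun n => AddChar.zmodChar_apply' _ n
  have hχg : ∀ (g : Gam) (a : ℕ), g ω = ω ^ a → ∀ x, g (χ x) = χ (a * x) := fun g a ha x => by
    obtain ⟨n, rfl⟩ : ∃ n : ℕ, (n : ZMod M) = x := ⟨x.val, ZMod.natCast_zmod_val x⟩
    rw [hχn, map_pow, ha, ← Nat.cast_mul, hχn, pow_mul]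
  let t : ZMod M → Om := fun j => ∑ x, χ (x * -j) * H x
  have ht : ∀ (g : Gam) j, g (t j) = t j := fun g j => by
    obtain ⟨a, ha, hco, hga⟩ := hω.isPrimitiveRoot_iff.1 (hω.map_of_injective (f := g) g.injective)
    simp only [t, map_sum, map_mul, hχg g a hga.symm, hg g a hco hga.symm]
    have hu : IsUnit (a : ZMod M) := (ZMod.isUnit_iff_coprime a M).2 hco
    refine Fintype.sum_bijective (fun x => (a : ZMod M) * x) ?_ _ _ fun x => ?_
    · exact (Units.mulLeft_bijective hu.unit)
    · rw [mul_assoc]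
  have hG : IsGalois ℚ Om := ⟨⟩
  have hq : ∀ j, ∃ q : ℚ, (q : Om) = t j := fun j => by
    have : t j ∈ (⊥ : IntermediateField ℚ Om) := (InfiniteGalois.mem_bot_iff_fixed _).2 fun g => ht g j
    obtain ⟨q, hq⟩ := IntermediateField.mem_bot.1 this
    exact ⟨q, by rw [← hq]; simp⟩
  choose q hq using hq
  refine ⟨fun j => q j / M, fun n => ?_⟩
  have hM : (M : Om) ≠ 0 := by exact_mod_cast NeZero.ne M
  have e1 : ∀ j : ZMod M, ω ^ (j.val * n) = χ (j * n) := fun j => by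
    rw [← hχn]; simp
  have e2 : ∑ j, t j * χ (j * n) = M * H n := by
    simp only [t, sum_mul]
    rw [sum_comm]
    have : ∀ x, ∑ j, χ (x * -j) * H x * χ (j * n) = if x = n then M * H x else 0 := fun x => by
      have h1 : ∀ j, χ (x * -j) * H x * χ (j * n) = χ (j * (n - x)) * H x := fun j => by
        have : j * ((n : ZMod M) - x) = x * -j + j * n := by ring
        rw [this, AddChar.map_add_eq_mul]; ring
      simp only [h1]
      rw [← sum_mul, AddChar.sum_mulShift _ hχ]
      by_cases h : x = n
      · simp [h]
      · rw [if_neg h, if_neg (fun h' => h (sub_eq_zero.1 h').symm)]; simp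
    simp only [this]
    rw [sum_ite_eq']; simp
  have e3 : ∑ j : ZMod M, ((q j / M : ℚ) : Om) * ω ^ (j.val * n) = (∑ j, t j * χ (j * n)) / M := by
    rw [sum_div]
    refine sum_congr rfl fun j _ => ?_
    rw [e1, ← hq]; push_cast; ring
  rw [e3, e2]; field_simp

theorem main_Om (ξ : ℕ+ → Om) (hW : IsW ξ) (hf : (Set.range ξ).Finite) :
    ∃ M : ℕ, 0 < M ∧ ∀ ω : Om, IsPrimitiveRoot ω M → ∃ c : ZMod M → ℚ, ∃ _ : NeZero M, ∀ n : ℕ+,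
      ξ n = ∑ j : ZMod M, (c j : Om) * ω ^ (j.val * (n : ℕ)) := by
  classical
  obtain ⟨N0, hN0, hN⟩ := cyc_field ξ hW hf
  have hVf : (⋃ f ∈ Set.range (fun φ : Gam => fun n => φ (ξ n)), Set.range f).Finite := by
    refine (orbit_finite ξ hf).biUnion ?_
    rintro _ ⟨φ, rfl⟩
    exact range_alg hf φ
  set V := ⋃ f ∈ Set.range (fun φ : Gam => fun n => φ (ξ n)), Set.range f with hVdef
  have hV : ∀ (g : Gam) n, g (ξ n) ∈ V := fun g n => by
    rw [hVdef]
    exact Set.mem_biUnion (Set.mem_range_self g) ⟨n, rfl⟩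
  obtain ⟨B, hB⟩ := dvd_bound V hVf
  set N := N0 * (B + 2).factorial with hNdef
  have hNpos : 0 < N := Nat.mul_pos hN0 (Nat.factorial_pos _)
  have hN2 : 2 ∣ N := (Nat.dvd_factorial (by norm_num) (by omega)).mul_left _
  have hNp : ∀ p : ℕ, p.Prime → p ≤ B → p ∣ N := fun p hp h => (Nat.dvd_factorial hp.pos (by omega)).mul_left _
  have hcpos : ∀ a : ℕ, a.Coprime N → 0 < a := fun a ha => Nat.pos_of_ne_zero (by
    rintro rfl
    rw [Nat.coprime_zero_left] at ha
    omega)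
  have iN : NeZero N := ⟨hNpos.ne'⟩
  set i0 := N + B with hi0
  have hMpos : 0 < N ^ (i0 + 1) := pow_pos hNpos _
  have iM : NeZero (N ^ (i0 + 1)) := ⟨hMpos.ne'⟩
  refine ⟨N ^ (i0 + 1), hMpos, fun ω hω => ?_⟩
  set ζ := ω ^ N ^ i0 with hζdef
  have hζ : IsPrimitiveRoot ζ N := hω.pow hMpos (by rw [pow_succ])
  have hm := hN N hNpos ⟨_, rfl⟩ ζ hζ
  have hA : ∀ a : ℕ, a.Coprime N → ∀ σ : Gam, σ ζ = ζ ^ a → ∀ n, ex ξ (a * n) = σ (ex ξ n) := by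
    intro a ha σ hσ n
    rcases Nat.eq_zero_or_pos n with rfl | hn
    · rw [mul_zero, ex_zero, map_zero]
    · rw [ex_pos _ hn, ex_pos _ (Nat.mul_pos (hcpos a ha) hn)]
      exact E1 hζ ξ hW hm V hV B hB hNp a (hcpos a ha) ha σ hσ (n.toPNat hn)
  have hper := periodic (ex ξ) N i0 hNpos ?_ ?_
  · let H : ZMod (N ^ (i0 + 1)) → Om := fun x => ex ξ (x.val + N ^ (i0+1))
    have hH : ∀ n : ℕ, 0 < n → H n = ex ξ n := fun n hn => by
      refine hper _ _ (by omega) hn ?_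
      rw [ZMod.val_natCast]
      simp [Nat.ModEq]
    obtain ⟨c, hc⟩ := fourier_rat (N ^ (i0 + 1)) ω hω H (fun g a ha hg x => by
      have hgz : g ζ = ζ ^ a := by rw [hζdef, map_pow, hg, ← pow_mul, ← pow_mul, mul_comm]
      have haN : a.Coprime N := Nat.Coprime.coprime_dvd_right (dvd_pow_self N (by omega)) ha
      show g (ex ξ _) = _
      rw [← hA a haN g hgz, ← hH _ (Nat.mul_pos (hcpos a haN) (by omega))]
      congr 1
      rw [Nat.cast_mul, Nat.cast_add, ZMod.natCast_self, ZMod.natCast_zmod_val, add_zero])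
    refine ⟨c, iM, fun n => ?_⟩
    rw [← hc n, hH _ n.pos, ex_pnat]
  · intro a a' ha ha' h n
    obtain ⟨σ, hσ⟩ := exists_sigma hζ a ha
    rw [hA a ha σ hσ, hA a' ha' σ (hσ.trans (pow_modEq hζ.pow_eq_one h))]
  · intro p e N' hp hNe b hb hbp n hn
    obtain ⟨ρ, hρ⟩ := exists_sigma hζ b hb
    rw [hA b hb ρ hρ]
    rcases Nat.eq_zero_or_pos n with rfl | hn0
    · simp [ex_zero]
    have hle : e ≤ N := by
      have h1 : e < p ^ e := Nat.lt_pow_self hp.one_lt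
      have h2 : p ^ e ≤ N := Nat.le_of_dvd hNpos ⟨N', hNe⟩
      omega
    obtain ⟨k, rfl⟩ := (pow_dvd_pow p (show e + B ≤ i0 by omega)).trans hn
    have hk : 0 < k := Nat.pos_of_mul_pos_left hn0
    have key := E2cong hζ p hp e N' hNe b hbp ρ hρ B ξ hW hm (k.toPNat hk)
    have hBp : B < p ^ (B + 1) := lt_trans (Nat.lt_succ_self B) (Nat.lt_pow_self hp.one_lt)
    have := hB _ hBp _ (hV 1 _) _ (hV ρ _) key
    rw [ex_pos _ hn0, ex_pos _ (Nat.mul_pos hp.pos hn0)]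
    have q1 : (p * (p ^ (e + B) * k)).toPNat (Nat.mul_pos hp.pos hn0)
        = (p.toPNat hp.pos) ^ (e + B + 1) * k.toPNat hk := PNat.eq (by
      rw [PNat.mul_coe, PNat.pow_coe]
      show p * (p ^ (e + B) * k) = p ^ (e + B + 1) * k
      ring)
    have q2 : (p ^ (e + B) * k).toPNat hn0
        = (p.toPNat hp.pos) ^ (e + B) * k.toPNat hk := PNat.eq (by
      rw [PNat.mul_coe, PNat.pow_coe]
      show p ^ (e + B) * k = p ^ (e + B) * k
      rfl)
    rw [q1, q2]
    exact this
end part19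

section part20
open Finset
open scoped Real

lemma zetaVec_pow (γ : ℚ) (n : ℕ+) : zetaVec γ n = (zetaVec γ 1) ^ (n : ℕ) := by
  simp only [zetaVec]
  rw [← Complex.exp_nat_mul]
  congr 1
  simp; ring

lemma zetaVec_add (γ δ : ℚ) : zetaVec (γ + δ) = zetaVec γ * zetaVec δ := by
  funext n
  simp only [zetaVec, Pi.mul_apply]
  rw [← Complex.exp_add]
  congr 1
  push_cast; ring

lemma zetaVec_int (k : ℤ) : zetaVec (k : ℚ) = 1 := by
  funext n
  simp only [zetaVec, Pi.one_apply]
  rw [Complex.exp_eq_one_iff]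
  refine ⟨k * n, ?_⟩
  push_cast; ring

lemma zetaVec_nat (γ : ℚ) (m : ℕ) : zetaVec γ ^ m = zetaVec (m * γ) := by
  funext n
  simp only [zetaVec, Pi.pow_apply]
  rw [← Complex.exp_nat_mul]
  congr 1
  push_cast; ring

lemma zetaVec_pow_den (γ : ℚ) : zetaVec γ ^ γ.den = 1 := by
  rw [zetaVec_nat, Rat.den_mul_eq_num, zetaVec_int]

lemma zetaVec_mem (γ : ℚ) : zetaVec γ ∈ WaQ := by
  have h1 : IsIntegral ℤ (zetaVec γ) :=
    IsIntegral.of_pow γ.den_pos (by rw [zetaVec_pow_den]; exact isIntegral_one)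
  refine mem_WaQ.2 ⟨IsW.char (fun n => ?_) (fun p hp n => ?_), h1⟩
  · refine IsIntegral.of_pow γ.den_pos ?_
    have := congrFun (zetaVec_pow_den γ) n
    rw [Pi.pow_apply] at this
    rw [this]; exact isIntegral_one
  · show zetaVec γ (p.toPNat hp.pos * n) = _
    rw [zetaVec_pow, zetaVec_pow γ n, ← pow_mul, PNat.mul_coe, mul_comm]
    rfl

lemma zeta_inj {γ δ : ℚ} (h : zetaVec γ 1 = zetaVec δ 1) : ∃ k : ℤ, γ = δ + k := by
  simp only [zetaVec] at h
  obtain ⟨k, hk⟩ := Complex.exp_eq_exp_iff_exists_int.1 h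
  refine ⟨k, ?_⟩
  have h2 : (2 * π * Complex.I : ℂ) ≠ 0 := Complex.two_pi_I_ne_zero
  have : (2 * π * Complex.I : ℂ) * γ = (2 * π * Complex.I : ℂ) * (δ + k) := by
    simp only [PNat.one_coe, Nat.cast_one, mul_one] at hk
    rw [hk]; ring
  exact_mod_cast mul_left_cancel₀ h2 this

noncomputable def zhom : AddCircle (1 : ℚ) →+ Additive (ℕ+ → ℂ) :=
  QuotientAddGroup.lift (AddSubgroup.zmultiples (1 : ℚ))
    { toFun := fun γ => Additive.ofMul (zetaVec γ)
      map_zero' := by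
        have := zetaVec_int 0
        rw [Int.cast_zero] at this
        rw [this]; rfl
      map_add' := fun γ δ => by rw [zetaVec_add]; rfl }
    (by
      rintro _ ⟨k, rfl⟩
      have := zetaVec_int k
      show Additive.ofMul (zetaVec (k • (1 : ℚ))) = _
      rw [zsmul_one, this]; rfl)

lemma zhom_coe (γ : ℚ) : (zhom (γ : AddCircle (1 : ℚ))).toMul = zetaVec γ := rfl

noncomputable def Phi : AddMonoidAlgebra ℚ (AddCircle (1 : ℚ)) →ₐ[ℚ] (ℕ+ → ℂ) :=
  AddMonoidAlgebra.lift ℚ (ℕ+ → ℂ) (AddCircle (1 : ℚ)) (AddMonoidHom.toMultiplicativeLeft zhom)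

lemma Phi_single (γ : ℚ) (q : ℚ) :
    Phi (AddMonoidAlgebra.single (↑γ : AddCircle (1 : ℚ)) q) = q • zetaVec γ := by
  rw [Phi, AddMonoidAlgebra.lift_single]; rfl

lemma Phi_apply (f : AddMonoidAlgebra ℚ (AddCircle (1 : ℚ))) :
    Phi f = f.coeff.sum fun g q => q • (zhom g).toMul := by
  rw [Phi, AddMonoidAlgebra.lift_apply]; rfl

lemma Phi_inj : Function.Injective Phi := by
  classical
  rw [injective_iff_map_eq_zero]
  intro f hf
  let z : AddCircle (1 : ℚ) → ℂ := fun g => (zhom g).toMul 1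
  have hz : ∀ g (n : ℕ+), (zhom g).toMul n = z g ^ (n : ℕ) := fun g n => by
    obtain ⟨γ, rfl⟩ := QuotientAddGroup.mk_surjective g
    exact zetaVec_pow γ n
  have hz0 : ∀ g, z g ≠ 0 := fun g => by
    obtain ⟨γ, rfl⟩ := QuotientAddGroup.mk_surjective g
    exact Complex.exp_ne_zero _
  have hzi : Function.Injective z := fun g g' h => by
    obtain ⟨γ, rfl⟩ := QuotientAddGroup.mk_surjective g
    obtain ⟨δ, rfl⟩ := QuotientAddGroup.mk_surjective g'
    obtain ⟨k, rfl⟩ := zeta_inj h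
    refine (QuotientAddGroup.eq.2 ⟨-k, ?_⟩)
    simp
  let χ : AddCircle (1 : ℚ) → (Multiplicative ℕ →* ℂ) := fun g => powersHom ℂ (z g)
  have hχi : Function.Injective χ := fun g g' h => hzi ((powersHom ℂ).injective h)
  have hli := (linearIndependent_monoidHom (Multiplicative ℕ) ℂ).comp χ hχi
  rw [linearIndependent_iff'] at hli
  have key := hli f.coeff.support (fun g => (f.coeff g : ℂ) * z g) (by
    funext m
    have h := congrFun hf (m.toAdd.succPNat)
    rw [Phi_apply, Finsupp.sum, Finset.sum_apply] at h
    rw [Finset.sum_apply]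
    refine Eq.trans (sum_congr rfl fun g _ => ?_) h
    rw [Pi.smul_apply, Pi.smul_apply, hz, Nat.succPNat_coe]
    simp only [Function.comp, χ, powersHom_apply, smul_eq_mul, Rat.smul_def]
    rw [Nat.succ_eq_add_one, pow_succ]; ring)
  apply AddMonoidAlgebra.coeff_injective
  ext g
  by_cases hg : g ∈ f.coeff.support
  · have := key g hg
    rcases mul_eq_zero.1 this with h | h
    · simpa using h
    · exact absurd h (hz0 g)
  · simpa using hg

lemma Phi_range : Set.range Phi = ↑(Submodule.span ℚ (Set.range zetaVec)) := by
  apply Set.Subset.antisymm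
  · rintro _ ⟨f, rfl⟩
    rw [Phi_apply]
    refine Submodule.sum_mem _ fun g _ => Submodule.smul_mem _ _ ?_
    obtain ⟨γ, rfl⟩ := QuotientAddGroup.mk_surjective g
    exact Submodule.subset_span ⟨γ, rfl⟩
  · have : Submodule.span ℚ (Set.range zetaVec) ≤ LinearMap.range Phi.toLinearMap := by
      rw [Submodule.span_le]
      rintro _ ⟨γ, rfl⟩
      exact ⟨AddMonoidAlgebra.single (↑γ : AddCircle (1 : ℚ)) 1, by
        show Phi _ = _
        rw [Phi_single, one_smul]⟩
    intro x hx
    exact this hx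

lemma WaQ_span {ξ : ℕ+ → ℂ} (h : ξ ∈ WaQ) : ξ ∈ Submodule.span ℚ (Set.range zetaVec) := by
  classical
  obtain ⟨hW, P, hP, hroot⟩ := mem_WaQ.1 h
  obtain ⟨ι⟩ := exists_iota
  have hr : ∀ n, Polynomial.eval₂ (Int.castRingHom ℂ) (ξ n) P = 0 := fun n => by
    have := congrArg (Pi.evalRingHom (fun _ : ℕ+ => ℂ) n) hroot
    rw [Polynomial.hom_eval₂] at this
    rw [← RingHom.eq_intCast' ((Pi.evalRingHom (fun _ : ℕ+ => ℂ) n).comp (algebraMap ℤ (ℕ+ → ℂ)))]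
    simpa using this
  let Q : Polynomial Om := P.map (Int.castRingHom Om)
  have hcomp : ι.comp (Int.castRingHom Om) = Int.castRingHom ℂ := RingHom.ext_int _ _
  have hQ : Q ≠ 0 := (hP.map _).ne_zero
  have hmem : ∀ n, ∃ x : Om, ι x = ξ n := fun n => by
    have : ξ n ∈ ι.range := by
      refine Polynomial.Splits.mem_range_of_isRoot (f := Q) (IsAlgClosed.splits _) hQ ?_
      have := hr n
      rw [Polynomial.IsRoot, Polynomial.map_map, Polynomial.eval_map, hcomp]
      exact this
    exact this
  choose ξ' hξ' using hmem
  have hW' : IsW ξ' := (IsW_map ι ξ').1 (by simpa only [hξ'] using hW)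
  have hfin : (Set.range ξ').Finite := by
    refine Set.Finite.subset (Q.roots.toFinset.finite_toSet) ?_
    rintro _ ⟨n, rfl⟩
    simp only [Finset.mem_coe, Multiset.mem_toFinset]
    rw [Polynomial.mem_roots hQ, Polynomial.IsRoot, Polynomial.eval_map]
    apply ι.injective
    rw [Polynomial.hom_eval₂, hξ', map_zero, hcomp]
    exact hr n
  obtain ⟨M, hM, hmain⟩ := main_Om ξ' hW' hfin
  have hpr := Complex.isPrimitiveRoot_exp M hM.ne'
  obtain ⟨ω, hω⟩ : ∃ ω : Om, ι ω = Complex.exp (2 * π * Complex.I / M) := by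
    have : Complex.exp (2 * π * Complex.I / M) ∈ ι.range := by
      refine Polynomial.Splits.mem_range_of_isRoot (f := Polynomial.X ^ M - 1) (IsAlgClosed.splits _) ?_ ?_
      · exact Polynomial.X_pow_sub_C_ne_zero hM 1
      · simp [hpr.pow_eq_one]
    exact this
  have hωp : IsPrimitiveRoot ω M := IsPrimitiveRoot.of_map_of_injective (f := ι) (by rw [hω]; exact hpr) ι.injective
  obtain ⟨c, iM, hc⟩ := hmain ω hωp
  have : ξ = ∑ j : ZMod M, c j • zetaVec (j.val / M) := by
    funext n
    rw [← hξ' n, hc n, map_sum, Finset.sum_apply]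
    refine sum_congr rfl fun j _ => ?_
    rw [map_mul, map_pow, hω, Pi.smul_apply, Rat.smul_def, map_ratCast, zetaVec, ← Complex.exp_nat_mul]
    congr 2
    push_cast; ring
  rw [this]
  exact Submodule.sum_mem _ fun j _ => Submodule.smul_mem _ _ (Submodule.subset_span ⟨_, rfl⟩)

end part20

/-- The `ℚ`-linear span of `W^a_ℤ(ℤ̄)` in `ℂ^{ℕ≥1}` equals the
`ℚ`-linear span of `{ζ^(γ) : γ ∈ ℚ}`; it is a `ℚ`-subalgebra of `ℂ^{ℕ≥1}`, and the
`ℚ`-algebra homomorphism `ℚ[ℚ/ℤ] → ℂ^{ℕ≥1}` determined by `[γ] ↦ ζ^(γ)` is injective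
with image this span. In particular `E_ℚ = ℚ ⊗ W^a_ℤ(ℤ̄) ≅ ℚ[ℚ/ℤ]`, and the algebraic
Witt vectors over `ℚ` are exactly the `ℚ`-linear combinations of the `ζ^(γ)`. -/
theorem span_WaQ_eq_group_algebra :
    Submodule.span ℚ WaQ = Submodule.span ℚ (Set.range zetaVec) ∧
    ∃ Φ : AddMonoidAlgebra ℚ (AddCircle (1 : ℚ)) →ₐ[ℚ] (ℕ+ → ℂ),
      (∀ γ : ℚ, Φ (AddMonoidAlgebra.single (↑γ : AddCircle (1 : ℚ)) 1) = zetaVec γ) ∧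
      Function.Injective Φ ∧
      Set.range Φ = ↑(Submodule.span ℚ (WaQ : Set (ℕ+ → ℂ))) := by
  have e : Submodule.span ℚ WaQ = Submodule.span ℚ (Set.range zetaVec) := by
    apply le_antisymm
    · exact Submodule.span_le.2 fun ξ h => WaQ_span h
    · refine Submodule.span_mono ?_
      rintro _ ⟨γ, rfl⟩
      exact zetaVec_mem γ
  refine ⟨e, Phi, fun γ => by rw [Phi_single, one_smul], Phi_inj, ?_⟩
  rw [Phi_range, e]
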